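/- Let H ∈ (0, 1/2). Define a_T = √(2 ln T) and b_T = a_T + a_T^{−1} [ (1/H − 3/2) ln ln T + ln( 2^{−3/2} 𝓗_{2H}² H^{−1} (2π)^{−1/2} ) ]. Then lim_{T→∞} sup_{x ∈ ℝ} | P( a_T (M_H(T) − b_T) ≤ x ) − exp(−e^{−x}) | = 0. -/

import Mathlib

open MeasureTheory ProbabilityTheory Real Filter Set

/-- Tail `Ψ(u) = P(N > u)` of a standard normal random variable. -/
noncomputable def stdNormalTail (u : ℝ) : ℝ :=
  ((ProbabilityTheory.gaussianReal 0 1) (Set.Ioi u)).toReal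

namespace SheppFBM

/-! ### Gaussian integration by parts and Slepian's inequality -/

lemma hasDerivAt_gaussianPDFReal (v : NNReal) (x : ℝ) :
    HasDerivAt (gaussianPDFReal 0 v) (-(x / v) * gaussianPDFReal 0 v x) x := by
  simp only [gaussianPDFReal_def]
  have h1 : HasDerivAt (fun x : ℝ => -(x - 0) ^ 2 / (2 * v)) (-(x / v)) x := by
    have := (((hasDerivAt_id x).sub_const 0).pow 2).neg.div_const (2 * (v : ℝ))
    refine this.congr_deriv ?_
    simp only [id]
    by_cases hv : (v : ℝ) = 0
    · simp [hv]
    · field_simp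
      simp
      ring
  refine (h1.exp.const_mul ((√(2 * π * v))⁻¹)).congr_deriv ?_
  ring

/-- Stein's identity for a centered real Gaussian measure. -/
lemma integral_id_mul_gaussianReal {v : NNReal} {g g' : ℝ → ℝ} {C : ℝ}
    (hg : ∀ x, HasDerivAt g (g' x) x) (hg' : Continuous g')
    (hC : ∀ x, |g x| ≤ C) (hC' : ∀ x, |g' x| ≤ C) :
    ∫ x, x * g x ∂(gaussianReal 0 v) = v * ∫ x, g' x ∂(gaussianReal 0 v) := by
  by_cases hv : v = 0
  · simp [hv]
  have hv' : (v : ℝ) ≠ 0 := by exact_mod_cast hv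
  rw [integral_gaussianReal_eq_integral_smul hv, integral_gaussianReal_eq_integral_smul hv]
  have hgc : Continuous g := continuous_iff_continuousAt.2 fun x => (hg x).continuousAt
  have hφ := integrable_gaussianPDFReal 0 v
  have hxφ : Integrable (fun x => x * gaussianPDFReal 0 v x) := by
    have h := (memLp_id_gaussianReal (μ := 0) (v := v) 1).integrable (by norm_num)
    rw [gaussianReal_of_var_ne_zero _ hv, integrable_withDensity_iff_integrable_smul'
      (measurable_gaussianPDF _ _) (ae_of_all _ fun _ => gaussianPDF_lt_top)] at h
    simpa [toReal_gaussianPDF, mul_comm] using h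
  have key := integral_mul_deriv_eq_deriv_mul_of_integrable (u := g) (u' := g')
    (v := gaussianPDFReal 0 v) (v' := fun x => -(x / v) * gaussianPDFReal 0 v x)
    (fun x _ => hg x) (fun x _ => hasDerivAt_gaussianPDFReal v x)
    (by
      have := (hxφ.const_mul (-(1 / (v : ℝ)))).bdd_mul (f := g) (c := C)
        hgc.aestronglyMeasurable (ae_of_all _ hC)
      refine this.congr (ae_of_all _ fun x => ?_)
      simp only [Pi.mul_apply]; ring)
    (hφ.bdd_mul (c := C) hg'.aestronglyMeasurable (ae_of_all _ hC'))
    (hφ.bdd_mul (c := C) hgc.aestronglyMeasurable (ae_of_all _ hC))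
  simp only [smul_eq_mul]
  calc ∫ x, gaussianPDFReal 0 v x * (x * g x)
      = ∫ x, (-(v : ℝ)) * (g x * (-(x / v) * gaussianPDFReal 0 v x)) := by
        congr 1; ext x; field_simp
    _ = v * ∫ x, g' x * gaussianPDFReal 0 v x := by
        rw [integral_const_mul, key]; ring
    _ = _ := by congr 2; ext x; ring

/-- Gaussian integration by parts. -/
lemma integral_mul_of_hasGaussianLaw {Ω ι : Type*} [MeasurableSpace Ω] [Fintype ι]
    {P : Measure Ω} {U : Ω → ℝ} {V : ι → Ω → ℝ}
    (hUV : HasGaussianLaw (fun ω => (U ω, fun j => V j ω)) P)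
    (hU : Measurable U) (hV : ∀ j, Measurable (V j))
    (hU0 : ∫ ω, U ω ∂P = 0) {f : (ι → ℝ) → ℝ} {D : ι → (ι → ℝ) → ℝ} {C : ℝ}
    (hf : ∀ (r c : ι → ℝ) (s : ℝ), HasDerivAt (fun s => f (r + s • c))
      (∑ j, c j * D j (r + s • c)) s)
    (hfc : Continuous f) (hD : ∀ j, Continuous (D j))
    (hfC : ∀ v, |f v| ≤ C) (hDC : ∀ j v, |D j v| ≤ C) :
    ∫ ω, U ω * f (fun j => V j ω) ∂P =
      ∑ j, (∫ ω, U ω * V j ω ∂P) * ∫ ω, D j (fun j => V j ω) ∂P := by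
  have hP : IsProbabilityMeasure P := hUV.isProbabilityMeasure
  have hUg : HasGaussianLaw U P := hUV.fst
  have hVg : HasGaussianLaw (fun ω j => V j ω) P := hUV.snd
  have hVj : ∀ j, HasGaussianLaw (V j) P := fun j => hVg.eval j
  set v : NNReal := Var[U; P].toNNReal with hv
  have hlaw : P.map U = gaussianReal 0 v := by rw [hUg.map_eq_gaussianReal, hU0]
  have hvar : (v : ℝ) = ∫ ω, U ω ^ 2 ∂P := by
    rw [hv, Real.coe_toNNReal _ (variance_nonneg _ _), variance_of_integral_eq_zero hU.aemeasurable hU0]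
  have hUU : MemLp U 2 P := hUg.memLp_two
  by_cases hv0 : (v : ℝ) = 0
  · have hU0' : U =ᵐ[P] 0 := by
      have := (integral_eq_zero_iff_of_nonneg (fun ω => sq_nonneg (U ω)) hUU.integrable_sq).1
        (hvar.symm.trans hv0)
      filter_upwards [this] with ω h
      simpa using h
    rw [integral_congr_ae (g := fun _ => (0 : ℝ)) (by filter_upwards [hU0'] with ω h; simp [h])]
    simp only [integral_zero]
    symm
    refine Finset.sum_eq_zero fun j _ => ?_
    rw [integral_congr_ae (g := fun _ => (0 : ℝ)) (by filter_upwards [hU0'] with ω h; simp [h])]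
    simp
  set c : ι → ℝ := fun j => (∫ ω, U ω * V j ω ∂P) / v with hc
  let R : ι → Ω → ℝ := fun j ω => V j ω - c j * U ω
  have hRm : ∀ j, Measurable (R j) := fun j => (hV j).sub (hU.const_mul _)
  have hRUlaw : HasGaussianLaw (fun ω => (fun j => R j ω, fun _ : Unit => U ω)) P := by
    let L : (ℝ × (ι → ℝ)) →L[ℝ] ((ι → ℝ) × (Unit → ℝ)) :=
      (ContinuousLinearMap.pi fun j => (ContinuousLinearMap.proj j ∘L ContinuousLinearMap.snd ℝ _ _)
        - c j • ContinuousLinearMap.fst ℝ _ _).prod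
      (ContinuousLinearMap.pi fun _ => ContinuousLinearMap.fst ℝ _ _)
    exact hUV.map_fun L
  have hind : IndepFun (fun ω j => R j ω) (fun ω (_ : Unit) => U ω) P := by
    refine hRUlaw.indepFun_of_covariance_eval (Y := fun _ : Unit => U) fun j _ => ?_
    have hRj : MemLp (R j) 2 P := (hVj j).memLp_two.sub (hUU.const_mul _)
    rw [covariance_eq_sub hRj hUU, hU0, mul_zero, sub_zero]
    have i1 : Integrable (fun ω => U ω * V j ω) P := hUU.integrable_mul (hVj j).memLp_two
    have i2 : Integrable (fun ω => U ω ^ 2) P := hUU.integrable_sq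
    have : (fun ω => (R j * U) ω) = fun ω => U ω * V j ω - c j * U ω ^ 2 := by
      ext ω; simp [R]; ring
    rw [this, integral_sub i1 (i2.const_mul _), integral_const_mul, ← hvar, hc]
    field_simp
    ring
  have hind' : IndepFun (fun ω j => R j ω) U P :=
    hind.comp (φ := id) (ψ := fun g : Unit → ℝ => g ()) measurable_id (measurable_pi_apply _)
  have hRm' : Measurable (fun ω j => R j ω) := measurable_pi_lambda _ hRm
  have hprod : P.map (fun ω => ((fun j => R j ω), U ω)) =
      (P.map (fun ω j => R j ω)).prod (gaussianReal 0 v) := by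
    rw [← hlaw]
    exact (indepFun_iff_map_prod_eq_prod_map_map hRm'.aemeasurable hU.aemeasurable).1 hind'
  have hmeas : Measurable (fun ω => ((fun j => R j ω), U ω)) := hRm'.prodMk hU
  have hprobR : IsProbabilityMeasure (P.map (fun ω j => R j ω)) :=
    Measure.isProbabilityMeasure_map hRm'.aemeasurable
  have hVR : ∀ ω, (fun j => V j ω) = (fun j => R j ω) + U ω • c := by
    intro ω; ext j; simp [R]; ring
  have hcadd : Continuous fun p : (ι → ℝ) × ℝ => p.1 + p.2 • c := by fun_prop
  have e1 : ∫ ω, U ω * f (fun j => V j ω) ∂P =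
      ∫ p, p.2 * f (p.1 + p.2 • c) ∂((P.map (fun ω j => R j ω)).prod (gaussianReal 0 v)) := by
    rw [← hprod, integral_map hmeas.aemeasurable]
    · simp [hVR]
    · exact (by fun_prop : Continuous fun p : (ι → ℝ) × ℝ => p.2 * f (p.1 + p.2 • c)).aestronglyMeasurable
  have e2 : ∀ j, ∫ ω, D j (fun j => V j ω) ∂P =
      ∫ p, D j (p.1 + p.2 • c) ∂((P.map (fun ω j => R j ω)).prod (gaussianReal 0 v)) := by
    intro j
    rw [← hprod, integral_map hmeas.aemeasurable]
    · simp [hVR]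
    · exact ((hD j).comp hcadd).aestronglyMeasurable
  have hDint : ∀ j, Integrable (fun p : (ι → ℝ) × ℝ => D j (p.1 + p.2 • c))
      ((P.map (fun ω j => R j ω)).prod (gaussianReal 0 v)) := fun j =>
    Integrable.of_bound ((hD j).comp hcadd).aestronglyMeasurable C (ae_of_all _ fun p => hDC j _)
  have h_int : Integrable (fun p : (ι → ℝ) × ℝ => p.2 * f (p.1 + p.2 • c))
      ((P.map (fun ω j => R j ω)).prod (gaussianReal 0 v)) := by
    refine Integrable.mul_bdd (c := C) ?_ (hfc.comp hcadd).aestronglyMeasurable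
      (ae_of_all _ fun p => hfC _)
    exact ((memLp_id_gaussianReal (μ := 0) (v := v) 1).integrable (by norm_num)).comp_snd _
  have hC0 : 0 ≤ C := (abs_nonneg _).trans (hfC 0)
  rw [e1, integral_prod _ h_int]
  have step : ∀ r : ι → ℝ, ∫ u, u * f (r + u • c) ∂(gaussianReal 0 v) =
      v * ∫ u, ∑ j, c j * D j (r + u • c) ∂(gaussianReal 0 v) := by
    intro r
    refine integral_id_mul_gaussianReal (C := C + ∑ j, |c j| * C) (fun s => hf r c s) ?_ ?_ ?_
    · fun_prop
    · intro x
      exact (hfC _).trans (le_add_of_nonneg_right (Finset.sum_nonneg fun j _ => by positivity))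
    · intro x
      refine (Finset.abs_sum_le_sum_abs _ _).trans
        (le_trans (Finset.sum_le_sum fun j _ => ?_) (le_add_of_nonneg_left hC0))
      rw [abs_mul]
      exact mul_le_mul_of_nonneg_left (hDC j _) (abs_nonneg _)
  simp only [step]
  rw [integral_const_mul, ← integral_prod (fun p : (ι → ℝ) × ℝ => ∑ j, c j * D j (p.1 + p.2 • c))
    (integrable_finsetSum _ fun j _ => (hDint j).const_mul _),
    integral_finsetSum _ fun j _ => (hDint j).const_mul _, Finset.mul_sum]
  refine Finset.sum_congr rfl fun j _ => ?_
  rw [integral_const_mul, e2 j, hc]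
  field_simp

/-- `V` is a linear space of centered (measurable) Gaussian random variables on `(Ω, P)`. -/
def GaussSpace {Ω : Type*} [MeasurableSpace Ω] (P : Measure Ω) (V : Submodule ℝ (Ω → ℝ)) : Prop :=
  ∀ f ∈ V, Measurable f ∧ ∃ v : NNReal, P.map f = gaussianReal 0 v

namespace GaussSpace

/-- The space of sums `f(ω) + g(ω')`. -/
def prod {Ω Ω' : Type*} (V : Submodule ℝ (Ω → ℝ)) (W : Submodule ℝ (Ω' → ℝ)) :
    Submodule ℝ (Ω × Ω' → ℝ) :=
  V.map (LinearMap.funLeft ℝ ℝ Prod.fst) ⊔ W.map (LinearMap.funLeft ℝ ℝ Prod.snd)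

lemma mem_prod {Ω Ω' : Type*} {V : Submodule ℝ (Ω → ℝ)} {W : Submodule ℝ (Ω' → ℝ)}
    {f : Ω → ℝ} {g : Ω' → ℝ} (hf : f ∈ V) (hg : g ∈ W) :
    (fun p : Ω × Ω' => f p.1 + g p.2) ∈ prod V W :=
  Submodule.add_mem_sup (Submodule.mem_map_of_mem (f := LinearMap.funLeft ℝ ℝ Prod.fst) hf)
    (Submodule.mem_map_of_mem (f := LinearMap.funLeft ℝ ℝ Prod.snd) hg)

variable {Ω : Type*} [MeasurableSpace Ω] {P : Measure Ω} {V : Submodule ℝ (Ω → ℝ)}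

lemma measurable (hV : GaussSpace P V) {f : Ω → ℝ} (hf : f ∈ V) : Measurable f := (hV f hf).1

lemma isProbabilityMeasure (hV : GaussSpace P V) : IsProbabilityMeasure P := by
  obtain ⟨hm, v, hv⟩ := hV 0 V.zero_mem
  constructor
  have : P.map (0 : Ω → ℝ) univ = 1 := by rw [hv]; simp
  rwa [Measure.map_apply hm MeasurableSet.univ, preimage_univ] at this

lemma integral_eq_zero (hV : GaussSpace P V) {f : Ω → ℝ} (hf : f ∈ V) : ∫ ω, f ω ∂P = 0 := by
  obtain ⟨hm, v, hv⟩ := hV f hf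
  have := integral_map (μ := P) hm.aemeasurable (f := fun x : ℝ => x)
    continuous_id.aestronglyMeasurable
  rw [← this, hv]
  exact integral_id_gaussianReal

lemma memLp_two (hV : GaussSpace P V) {f : Ω → ℝ} (hf : f ∈ V) : MemLp f 2 P := by
  obtain ⟨hm, v, hv⟩ := hV f hf
  have h := memLp_id_gaussianReal (μ := 0) (v := v) 2
  rw [← hv, memLp_map_measure_iff continuous_id.aestronglyMeasurable hm.aemeasurable] at h
  exact h

lemma integrable_mul (hV : GaussSpace P V) {f g : Ω → ℝ} (hf : f ∈ V) (hg : g ∈ V) :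
    Integrable (fun ω => f ω * g ω) P :=
  (hV.memLp_two hf).integrable_mul (hV.memLp_two hg)

lemma map_eq (hV : GaussSpace P V) {f : Ω → ℝ} (hf : f ∈ V) :
    P.map f = gaussianReal 0 (∫ ω, f ω * f ω ∂P).toNNReal := by
  have := hV.isProbabilityMeasure
  obtain ⟨hm, v, hv⟩ := hV f hf
  have h : Var[f; P] = v := by
    have h := variance_map (X := fun x : ℝ => x) (μ := P) (Y := f) (by fun_prop) hm.aemeasurable
    have e : ((fun x : ℝ => x) ∘ f) = f := rfl
    rw [e] at h
    rw [← h, hv]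
    exact variance_id_gaussianReal
  rw [variance_of_integral_eq_zero hm.aemeasurable (hV.integral_eq_zero hf)] at h
  rw [hv]
  congr 1
  have h2 : ∫ ω, f ω * f ω ∂P = v := by rw [← h]; simp [sq]
  rw [h2, Real.toNNReal_coe]

lemma hasGaussianLaw (hV : GaussSpace P V) {ι : Type*} [Fintype ι] {X : ι → Ω → ℝ}
    (hX : ∀ i, X i ∈ V) : HasGaussianLaw (fun ω i => X i ω) P := by
  constructor
  have hm : Measurable (fun ω i => X i ω) := measurable_pi_lambda _ fun i => hV.measurable (hX i)
  have := hV.isProbabilityMeasure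
  refine isGaussian_of_map_eq_gaussianReal fun L => ?_
  classical
  have hL : (L ∘ fun ω i => X i ω) = ∑ i, L (Pi.single i 1) • X i := by
    ext ω
    simp only [Function.comp, Finset.sum_apply, Pi.smul_apply, smul_eq_mul]
    have : (fun i => X i ω) = ∑ i, X i ω • (Pi.single i (1 : ℝ) : ι → ℝ) := by
      ext j; simp [Finset.sum_apply, Pi.single_apply]
    rw [this, map_sum]
    refine Finset.sum_congr rfl fun i _ => ?_
    rw [map_smul, smul_eq_mul, mul_comm]
  obtain ⟨_, v, hv⟩ := hV (L ∘ fun ω i => X i ω)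
    (hL ▸ V.sum_mem fun i _ => V.smul_mem _ (hX i))
  exact ⟨0, v, by rw [Measure.map_map (by fun_prop) hm, hv]⟩

lemma gaussSpace_prod {Ω' : Type*} [MeasurableSpace Ω'] {Q : Measure Ω'}
    {W : Submodule ℝ (Ω' → ℝ)} (hV : GaussSpace P V) (hW : GaussSpace Q W) :
    GaussSpace (P.prod Q) (prod V W) := by
  have := hV.isProbabilityMeasure
  have := hW.isProbabilityMeasure
  intro F hF
  obtain ⟨a, ha, b, hb, rfl⟩ := Submodule.mem_sup.1 hF
  obtain ⟨f, hf, rfl⟩ := ha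
  obtain ⟨g, hg, rfl⟩ := hb
  obtain ⟨hfm, v, hv⟩ := hV f hf
  obtain ⟨hgm, w, hw⟩ := hW g hg
  have e : ((LinearMap.funLeft ℝ ℝ Prod.fst) f + (LinearMap.funLeft ℝ ℝ Prod.snd) g : Ω × Ω' → ℝ) =
    (fun p => f p.1) + (fun p => g p.2) := rfl
  rw [e]
  refine ⟨(hfm.comp measurable_fst).add (hgm.comp measurable_snd), v + w, ?_⟩
  have := gaussianReal_add_gaussianReal_of_indepFun (P := P.prod Q) (m₁ := 0) (m₂ := 0) (v₁ := v)
    (v₂ := w) (X := fun p => f p.1) (Y := fun p => g p.2) (indepFun_prod hfm hgm) ?_ ?_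
  · simpa using this
  · rw [← hv]
    exact (Measure.map_map hfm measurable_fst).symm.trans (by rw [Measure.map_fst_prod]; simp)
  · rw [← hw]
    exact (Measure.map_map hgm measurable_snd).symm.trans (by rw [Measure.map_snd_prod]; simp)

end GaussSpace

lemma integral_prod_mul_cross {Ω Ω' : Type*} [MeasurableSpace Ω] [MeasurableSpace Ω'] {P : Measure Ω}
    {Q : Measure Ω'} {V : Submodule ℝ (Ω → ℝ)} {W : Submodule ℝ (Ω' → ℝ)} (hV : GaussSpace P V)
    (hW : GaussSpace Q W) {f f' : Ω → ℝ} {g g' : Ω' → ℝ} (hf : f ∈ V) (hf' : f' ∈ V)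
    (hg : g ∈ W) (hg' : g' ∈ W) :
    ∫ p, (f p.1 + g p.2) * (f' p.1 + g' p.2) ∂(P.prod Q) =
      ∫ ω, f ω * f' ω ∂P + ∫ ω, g ω * g' ω ∂Q := by
  have := hV.isProbabilityMeasure
  have := hW.isProbabilityMeasure
  have i1 := (hV.integrable_mul hf hf').comp_fst Q
  have i2 := (hW.integrable_mul hg hg').comp_snd P
  have i3 := ((hV.memLp_two hf).integrable (by norm_num)).mul_prod
    ((hW.memLp_two hg').integrable (by norm_num))
  have i4 := ((hV.memLp_two hf').integrable (by norm_num)).mul_prod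
    ((hW.memLp_two hg).integrable (by norm_num))
  calc _ = ∫ p, (f p.1 * f' p.1 + g p.2 * g' p.2) + (f p.1 * g' p.2 + f' p.1 * g p.2) ∂(P.prod Q) := by
        congr 1; ext p; ring
    _ = _ := by
        rw [integral_add (f := fun p : Ω × Ω' => f p.1 * f' p.1 + g p.2 * g' p.2)
            (g := fun p => f p.1 * g' p.2 + f' p.1 * g p.2) (i1.add i2) (i3.add i4),
          integral_add i1 i2, integral_add i3 i4,
          integral_prod_mul, integral_prod_mul, hV.integral_eq_zero hf, hV.integral_eq_zero hf',
          integral_fun_fst (fun ω => f ω * f' ω), integral_fun_snd (fun ω => g ω * g' ω)]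
        simp
lemma hasDerivAt_prod_comp_line {ι : Type*} [Fintype ι] [DecidableEq ι] {p p' : ι → ℝ → ℝ}
    (hp : ∀ i x, HasDerivAt (p i) (p' i x) x) {z z' : ι → ℝ → ℝ} {s : ℝ}
    (hz : ∀ i, HasDerivAt (z i) (z' i s) s) :
    HasDerivAt (fun s => ∏ i, p i (z i s))
      (∑ j, z' j s * ∏ i, Function.update p j (p' j) i (z i s)) s := by
  have h := HasDerivAt.fun_finsetProd (u := Finset.univ) (f := fun i s => p i (z i s))
    (f' := fun i => p' i (z i s) * z' i s) (x := s) fun i _ => (hp i _).comp s (hz i)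
  refine h.congr_deriv (Finset.sum_congr rfl fun j _ => ?_)
  rw [← Finset.mul_prod_erase Finset.univ _ (Finset.mem_univ j), Function.update_self, smul_eq_mul]
  have : ∏ i ∈ Finset.univ.erase j, Function.update p j (p' j) i (z i s) =
      ∏ i ∈ Finset.univ.erase j, p i (z i s) :=
    Finset.prod_congr rfl fun i hi => by rw [Function.update_of_ne (Finset.ne_of_mem_erase hi)]
  rw [this]
  ring

lemma abs_prod_le_of_le {ι : Type*} [Fintype ι] {p : ι → ℝ → ℝ} {C : ℝ}
    (hC : ∀ i x, |p i x| ≤ C) (v : ι → ℝ) : |∏ i, p i (v i)| ≤ C ^ Fintype.card ι := by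
  rw [Finset.abs_prod, ← Finset.card_univ, ← Finset.prod_const]
  exact Finset.prod_le_prod (fun i _ => abs_nonneg _) fun i _ => hC i _

/-- Comparison of Gaussian expectations of products of decreasing functions. -/
lemma integral_prod_le_of_cov_le {Ω Ω' ι : Type*} [MeasurableSpace Ω] [MeasurableSpace Ω']
    [Fintype ι] {P : Measure Ω} {Q : Measure Ω'} {V : Submodule ℝ (Ω → ℝ)}
    {W : Submodule ℝ (Ω' → ℝ)} (hV : GaussSpace P V) (hW : GaussSpace Q W)
    {X : ι → Ω → ℝ} {Y : ι → Ω' → ℝ} (hX : ∀ i, X i ∈ V) (hY : ∀ i, Y i ∈ W)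
    (hvar : ∀ i, ∫ ω, X i ω * X i ω ∂P = ∫ ω, Y i ω * Y i ω ∂Q)
    (hcov : ∀ i j, ∫ ω, X i ω * X j ω ∂P ≤ ∫ ω, Y i ω * Y j ω ∂Q)
    {h h' h'' : ι → ℝ → ℝ} {C : ℝ}
    (hh : ∀ i x, HasDerivAt (h i) (h' i x) x) (hh' : ∀ i x, HasDerivAt (h' i) (h'' i x) x)
    (hh'' : ∀ i, Continuous (h'' i))
    (h0 : ∀ i x, 0 ≤ h i x) (h1 : ∀ i x, h' i x ≤ 0)
    (b0 : ∀ i x, |h i x| ≤ C) (b1 : ∀ i x, |h' i x| ≤ C) (b2 : ∀ i x, |h'' i x| ≤ C) :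
    ∫ ω, ∏ i, h i (X i ω) ∂P ≤ ∫ ω, ∏ i, h i (Y i ω) ∂Q := by
  classical
  have := hV.isProbabilityMeasure
  have := hW.isProbabilityMeasure
  have hPQ := GaussSpace.gaussSpace_prod hV hW
  have hc : ∀ i, Continuous (h i) := fun i =>
    continuous_iff_continuousAt.2 fun x => (hh i x).continuousAt
  have hc' : ∀ i, Continuous (h' i) := fun i =>
    continuous_iff_continuousAt.2 fun x => (hh' i x).continuousAt
  set q : ι → ι → ℝ → ℝ := fun i => Function.update h i (h' i) with hq
  set q' : ι → ι → ℝ → ℝ := fun i => Function.update h' i (h'' i) with hq'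
  set r : ι → ι → ι → ℝ → ℝ := fun i j => Function.update (q i) j (q' i j) with hr
  have upd : ∀ {p : ι → ℝ → ℝ} {i : ι} {a : ℝ → ℝ} {R : (ℝ → ℝ) → Prop}, (∀ j, R (p j)) → R a →
      ∀ j, R (Function.update p i a j) := by
    intro p i a R hp ha j
    by_cases hj : j = i
    · subst hj; simpa using ha
    · simpa [Function.update_of_ne hj] using hp j
  have hqq : ∀ i j x, HasDerivAt (q i j) (q' i j x) x := by
    intro i j x
    by_cases hj : j = i
    · subst hj; simpa [hq, hq'] using hh' j x
    · simpa [hq, hq', Function.update_of_ne hj] using hh j x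
  have qc : ∀ i j, Continuous (q i j) := fun i => upd hc (hc' i)
  have qc' : ∀ i j, Continuous (q' i j) := fun i => upd hc' (hh'' i)
  have rc : ∀ i j m, Continuous (r i j m) := fun i j => upd (qc i) (qc' i j)
  have qb : ∀ i j x, |q i j x| ≤ C := fun i => upd (R := fun f => ∀ x, |f x| ≤ C) b0 (b1 i)
  have qb' : ∀ i j x, |q' i j x| ≤ C := fun i => upd (R := fun f => ∀ x, |f x| ≤ C) b1 (b2 i)
  have rb : ∀ i j m x, |r i j m x| ≤ C := fun i j =>
    upd (R := fun f => ∀ x, |f x| ≤ C) (qb i) (qb' i j)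
  -- the interpolation
  let Z : ι → ℝ → Ω × Ω' → ℝ := fun i θ p => cos θ * X i p.1 + sin θ * Y i p.2
  let Z' : ι → ℝ → Ω × Ω' → ℝ := fun i θ p => -sin θ * X i p.1 + cos θ * Y i p.2
  have hZm : ∀ i θ, Z i θ ∈ GaussSpace.prod V W := fun i θ =>
    GaussSpace.mem_prod (V.smul_mem (cos θ) (hX i)) (W.smul_mem (sin θ) (hY i))
  have hZm' : ∀ i θ, Z' i θ ∈ GaussSpace.prod V W := fun i θ =>
    GaussSpace.mem_prod (V.smul_mem (-sin θ) (hX i)) (W.smul_mem (cos θ) (hY i))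
  have hZd : ∀ i θ p, HasDerivAt (fun θ => Z i θ p) (Z' i θ p) θ := by
    intro i θ p
    exact ((hasDerivAt_cos θ).mul_const _).add ((hasDerivAt_sin θ).mul_const _)
  have hZmeas : ∀ i θ, Measurable (Z i θ) := fun i θ => hPQ.measurable (hZm i θ)
  have hZmeas' : ∀ i θ, Measurable (Z' i θ) := fun i θ => hPQ.measurable (hZm' i θ)
  have hcovZ : ∀ i j θ, ∫ p, Z' i θ p * Z j θ p ∂(P.prod Q) =
      sin θ * cos θ * (∫ ω, Y i ω * Y j ω ∂Q - ∫ ω, X i ω * X j ω ∂P) := by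
    intro i j θ
    rw [integral_prod_mul_cross (f := fun ω => -sin θ * X i ω) (f' := fun ω => cos θ * X j ω)
      (g := fun ω => cos θ * Y i ω) (g' := fun ω => sin θ * Y j ω) hV hW
      (V.smul_mem (-sin θ) (hX i)) (V.smul_mem (cos θ) (hX j))
      (W.smul_mem (cos θ) (hY i)) (W.smul_mem (sin θ) (hY j))]
    have e1 : ∀ ω, -sin θ * X i ω * (cos θ * X j ω) = (-sin θ * cos θ) * (X i ω * X j ω) :=
      fun ω => by ring
    have e2 : ∀ ω, cos θ * Y i ω * (sin θ * Y j ω) = (sin θ * cos θ) * (Y i ω * Y j ω) :=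
      fun ω => by ring
    simp only [e1, e2, integral_const_mul]
    ring
  set N := Fintype.card ι
  have hFm : ∀ θ, Measurable (fun p => ∏ i, h i (Z i θ p)) := fun θ =>
    Finset.measurable_fun_prod _ fun i _ => (hc i).measurable.comp (hZmeas i θ)
  have hqm : ∀ i θ, Measurable (fun p => ∏ j, q i j (Z j θ p)) := fun i θ =>
    Finset.measurable_fun_prod _ fun j _ => (qc i j).measurable.comp (hZmeas j θ)
  have hIX : ∀ i, Integrable (X i) P := fun i => (hV.memLp_two (hX i)).integrable (by norm_num)
  have hIY : ∀ i, Integrable (Y i) Q := fun i => (hW.memLp_two (hY i)).integrable (by norm_num)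
  have hderiv : ∀ θ, HasDerivAt (fun θ => ∫ p, ∏ i, h i (Z i θ p) ∂(P.prod Q))
      (∫ p, ∑ i, Z' i θ p * ∏ j, q i j (Z j θ p) ∂(P.prod Q)) θ := by
    intro θ
    refine (hasDerivAt_integral_of_dominated_loc_of_deriv_le
      (F := fun θ p => ∏ i, h i (Z i θ p))
      (F' := fun θ p => ∑ i, Z' i θ p * ∏ j, q i j (Z j θ p))
      (bound := fun p => ∑ i, (|X i p.1| + |Y i p.2|) * C ^ N) (s := univ)
      univ_mem (Eventually.of_forall fun θ => (hFm θ).aestronglyMeasurable) ?_ ?_ ?_ ?_ ?_).2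
    · exact Integrable.of_bound (hFm θ).aestronglyMeasurable (C ^ N)
        (ae_of_all _ fun p => abs_prod_le_of_le b0 _)
    · exact (Finset.measurable_fun_sum _ fun i _ => (hZmeas' i θ).mul (hqm i θ)).aestronglyMeasurable
    · refine ae_of_all _ fun p θ _ => ?_
      refine (Finset.abs_sum_le_sum_abs _ _).trans (Finset.sum_le_sum fun i _ => ?_)
      rw [abs_mul]
      refine mul_le_mul ?_ (abs_prod_le_of_le (qb i) _) (abs_nonneg _) (by positivity)
      refine (abs_add_le _ _).trans ?_
      rw [abs_mul, abs_mul, abs_neg]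
      have := abs_sin_le_one θ
      have := abs_cos_le_one θ
      have := abs_nonneg (X i p.1)
      have := abs_nonneg (Y i p.2)
      nlinarith
    · refine integrable_finsetSum _ fun i _ => Integrable.mul_const ?_ _
      exact ((hIX i).abs.comp_fst Q).add ((hIY i).abs.comp_snd P)
    · exact ae_of_all _ fun p θ _ => hasDerivAt_prod_comp_line
        (z := fun i θ => Z i θ p) (z' := fun i θ => Z' i θ p) hh (fun i => hZd i θ p)
  have hval : ∀ θ, ∫ p, ∑ i, Z' i θ p * ∏ j, q i j (Z j θ p) ∂(P.prod Q) =
      ∑ i, ∑ j, (∫ p, Z' i θ p * Z j θ p ∂(P.prod Q)) *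
        ∫ p, ∏ m, r i j m (Z m θ p) ∂(P.prod Q) := by
    intro θ
    rw [integral_finsetSum]
    · refine Finset.sum_congr rfl fun i _ => ?_
      have hlaw : HasGaussianLaw (fun p => (Z' i θ p, fun j => Z j θ p)) (P.prod Q) := by
        have hO := hPQ.hasGaussianLaw (X := fun o : Option ι => o.elim (Z' i θ) (fun j => Z j θ))
          (fun o => by cases o with
            | none => exact hZm' i θ
            | some j => exact hZm j θ)
        exact hO.map_fun ((ContinuousLinearMap.proj (R := ℝ) (φ := fun _ : Option ι => ℝ) none).prod
          (ContinuousLinearMap.pi fun j => ContinuousLinearMap.proj (some j)))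
      refine integral_mul_of_hasGaussianLaw (f := fun v => ∏ j, q i j (v j))
        (D := fun j v => ∏ m, r i j m (v m)) (C := C ^ N) hlaw (hZmeas' i θ)
        (fun j => hZmeas j θ) (hPQ.integral_eq_zero (hZm' i θ)) ?_ ?_ ?_ ?_ ?_
      · intro a c s
        refine hasDerivAt_prod_comp_line (z := fun i s => (a + s • c) i) (z' := fun i _ => c i)
          (hqq i) (fun j => ?_)
        simpa using ((hasDerivAt_id s).mul_const (c j)).const_add (a j)
      · exact continuous_finsetProd _ fun j _ => (qc i j).comp (continuous_apply j)
      · exact fun j => continuous_finsetProd _ fun m _ => (rc i j m).comp (continuous_apply m)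
      · exact fun v => abs_prod_le_of_le (qb i) v
      · exact fun j v => abs_prod_le_of_le (rb i j) v
    · intro i _
      exact Integrable.mul_bdd (c := C ^ N)
        ((hPQ.memLp_two (hZm' i θ)).integrable (by norm_num)) (hqm i θ).aestronglyMeasurable
        (ae_of_all _ fun p => abs_prod_le_of_le (qb i) _)
  have hpos : ∀ θ ∈ Icc 0 (π / 2), 0 ≤ ∫ p, ∑ i, Z' i θ p * ∏ j, q i j (Z j θ p) ∂(P.prod Q) := by
    intro θ hθ
    rw [hval]
    refine Finset.sum_nonneg fun i _ => Finset.sum_nonneg fun j _ => ?_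
    rw [hcovZ]
    by_cases hij : j = i
    · subst hij; rw [hvar j]; simp
    have hs : 0 ≤ sin θ := sin_nonneg_of_nonneg_of_le_pi hθ.1 (by linarith [hθ.2, pi_pos])
    have hcs : 0 ≤ cos θ := cos_nonneg_of_neg_pi_div_two_le_of_le (by linarith [hθ.1, pi_pos]) hθ.2
    refine mul_nonneg (mul_nonneg (mul_nonneg hs hcs) (sub_nonneg.2 (hcov i j))) ?_
    refine integral_nonneg fun p => ?_
    show 0 ≤ ∏ m, r i j m (Z m θ p)
    have hi : i ∈ Finset.univ.erase j := Finset.mem_erase.2 ⟨fun h => hij h.symm, Finset.mem_univ i⟩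
    rw [← Finset.mul_prod_erase Finset.univ _ (Finset.mem_univ j), ← Finset.mul_prod_erase _ _ hi,
      ← mul_assoc]
    refine mul_nonneg (mul_nonneg_of_nonpos_of_nonpos ?_ ?_) (Finset.prod_nonneg fun m hm => ?_)
    · simp only [hr, hq', Function.update_self, Function.update_of_ne hij]; exact h1 j _
    · simp only [hr, hq, Function.update_self, Function.update_of_ne (Ne.symm hij)]; exact h1 i _
    · have hmi := Finset.ne_of_mem_erase hm
      have hmj := Finset.ne_of_mem_erase (Finset.mem_of_mem_erase hm)
      simp only [hr, hq, Function.update_of_ne hmj, Function.update_of_ne hmi]; exact h0 m _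
  have hmono : MonotoneOn (fun θ => ∫ p, ∏ i, h i (Z i θ p) ∂(P.prod Q)) (Icc 0 (π / 2)) := by
    refine monotoneOn_of_deriv_nonneg (convex_Icc _ _)
      (fun θ _ => (hderiv θ).continuousAt.continuousWithinAt)
      (fun θ _ => (hderiv θ).differentiableAt.differentiableWithinAt) fun θ hθ => ?_
    rw [(hderiv θ).deriv]
    exact hpos θ (interior_subset hθ)
  have hfin := hmono (left_mem_Icc.2 (by positivity)) (right_mem_Icc.2 (by positivity))
    (by positivity : (0 : ℝ) ≤ π / 2)
  have e0 : ∫ p, ∏ i, h i (Z i 0 p) ∂(P.prod Q) = ∫ ω, ∏ i, h i (X i ω) ∂P := by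
    simp only [Z, cos_zero, sin_zero, one_mul, zero_mul, add_zero]
    rw [integral_fun_fst (fun ω => ∏ i, h i (X i ω))]; simp
  have e1 : ∫ p, ∏ i, h i (Z i (π / 2) p) ∂(P.prod Q) = ∫ ω, ∏ i, h i (Y i ω) ∂Q := by
    simp only [Z, cos_pi_div_two, sin_pi_div_two, one_mul, zero_mul, zero_add]
    rw [integral_fun_snd (fun ω => ∏ i, h i (Y i ω))]; simp
  simpa only [e0, e1] using hfin

lemma tendsto_sigmoid_step (l x : ℝ) :
    Tendsto (fun n : ℕ => sigmoid (√n - n * (x - l))) atTop (nhds (if x ≤ l then 1 else 0)) := by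
  have hs : Tendsto (fun n : ℕ => √(n : ℝ)) atTop atTop :=
    tendsto_sqrt_atTop.comp tendsto_natCast_atTop_atTop
  split_ifs with h
  · refine tendsto_sigmoid_atTop.comp (tendsto_atTop_mono (fun n => ?_) hs)
    have : (0 : ℝ) ≤ n * (l - x) := mul_nonneg (by positivity) (by linarith)
    linarith
  · push Not at h
    have h2 : Tendsto (fun n : ℕ => √(n : ℝ) * (√(n : ℝ) * (x - l) - 1)) atTop atTop := by
      refine hs.atTop_mul_atTop₀ (tendsto_atTop_add_const_right _ _ (hs.atTop_mul_const (by linarith)))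
    refine tendsto_sigmoid_atBot.comp ((tendsto_neg_atTop_atBot.comp h2).congr fun n => ?_)
    have := Real.mul_self_sqrt (Nat.cast_nonneg (α := ℝ) n)
    simp only [Function.comp]
    linear_combination (-(x - l)) * this

lemma abs_sigmoid_le (x : ℝ) : |sigmoid x| ≤ 1 := by
  rw [abs_of_pos (sigmoid_pos x)]; exact sigmoid_le_one x

lemma abs_one_sub_sigmoid_le (x : ℝ) : |1 - sigmoid x| ≤ 1 := by
  rw [abs_of_nonneg (by linarith [sigmoid_le_one x])]; linarith [sigmoid_pos x]

lemma tendsto_integral_prod_sigmoid {Ω ι : Type*} [MeasurableSpace Ω] [Fintype ι]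
    (P : Measure Ω) [IsProbabilityMeasure P]
    (X : ι → Ω → ℝ) (hX : ∀ i, Measurable (X i)) (l : ι → ℝ) :
    Tendsto (fun n : ℕ => ∫ ω, ∏ i, sigmoid (√n - n * (X i ω - l i)) ∂P) atTop
      (nhds (P.real {ω | ∀ i, X i ω ≤ l i})) := by
  classical
  have hm : MeasurableSet {ω | ∀ i, X i ω ≤ l i} := by
    rw [Set.ofPred_forall]
    exact MeasurableSet.iInter fun i => measurableSet_le (hX i) measurable_const
  have : P.real {ω | ∀ i, X i ω ≤ l i} = ∫ ω, ∏ i, (if X i ω ≤ l i then (1 : ℝ) else 0) ∂P := by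
    rw [← integral_indicator_one hm]
    congr 1
    ext ω
    rw [Finset.prod_ite_zero]
    simp [indicator_apply]
  rw [this]
  refine tendsto_integral_of_dominated_convergence (fun _ => 1) (fun n => ?_)
    (integrable_const _) (fun n => ae_of_all _ fun ω => ?_) (ae_of_all _ fun ω => ?_)
  · refine (Finset.measurable_fun_prod _ fun i _ => ?_).aestronglyMeasurable
    exact continuous_sigmoid.measurable.comp
      (measurable_const.sub (((hX i).sub_const _).const_mul _))
  · rw [Real.norm_eq_abs]
    have := abs_prod_le_of_le (p := fun (_ : ι) => sigmoid) (C := 1) (fun _ => abs_sigmoid_le)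
      (fun i => √n - n * (X i ω - l i))
    simpa using this
  · exact tendsto_finsetProd _ fun i _ => tendsto_sigmoid_step _ _

/-- Slepian's inequality, finite index. -/
lemma slepian_fintype {Ω Ω' ι : Type*} [MeasurableSpace Ω] [MeasurableSpace Ω']
    [Fintype ι] {P : Measure Ω} {Q : Measure Ω'} {V : Submodule ℝ (Ω → ℝ)}
    {W : Submodule ℝ (Ω' → ℝ)} (hV : GaussSpace P V) (hW : GaussSpace Q W)
    {X : ι → Ω → ℝ} {Y : ι → Ω' → ℝ} (hX : ∀ i, X i ∈ V) (hY : ∀ i, Y i ∈ W)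
    (hvar : ∀ i, ∫ ω, X i ω * X i ω ∂P = ∫ ω, Y i ω * Y i ω ∂Q)
    (hcov : ∀ i j, ∫ ω, X i ω * X j ω ∂P ≤ ∫ ω, Y i ω * Y j ω ∂Q) (l : ι → ℝ) :
    P.real {ω | ∀ i, X i ω ≤ l i} ≤ Q.real {ω | ∀ i, Y i ω ≤ l i} := by
  classical
  have := hV.isProbabilityMeasure
  have := hW.isProbabilityMeasure
  refine le_of_tendsto_of_tendsto' (tendsto_integral_prod_sigmoid P X (fun i => hV.measurable (hX i)) l)
    (tendsto_integral_prod_sigmoid Q Y (fun i => hW.measurable (hY i)) l) fun n => ?_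
  set s : ι → ℝ → ℝ := fun i x => sigmoid (√n - n * (x - l i)) with hs
  have hd : ∀ i x, HasDerivAt (s i) (-(n * (s i x * (1 - s i x)))) x := by
    intro i x
    have h1 : HasDerivAt (fun x => √n - n * (x - l i)) (-n : ℝ) x := by
      simpa using (((hasDerivAt_id x).sub_const (l i)).const_mul (n : ℝ)).const_sub (√n)
    exact ((hasDerivAt_sigmoid _).comp x h1).congr_deriv (by simp only [hs]; ring)
  have hd2 : ∀ i x, HasDerivAt (fun x => -(n * (s i x * (1 - s i x))))
      (n * n * ((s i x * (1 - s i x)) * (1 - 2 * s i x))) x := by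
    intro i x
    exact ((((hd i x).mul ((hd i x).const_sub 1))).const_mul (n : ℝ)).neg.congr_deriv (by ring)
  have hsc : ∀ i, Continuous (s i) := fun i =>
    continuous_iff_continuousAt.2 fun x => (hd i x).continuousAt
  have b0 : ∀ i x, |s i x| ≤ 1 := fun i x => abs_sigmoid_le _
  have b1 : ∀ i x, |1 - s i x| ≤ 1 := fun i x => abs_one_sub_sigmoid_le _
  have hn : (0 : ℝ) ≤ n := by positivity
  have b2 : ∀ i x, |s i x * (1 - s i x)| ≤ 1 := fun i x => by
    rw [abs_mul]; exact mul_le_one₀ (b0 i x) (abs_nonneg _) (b1 i x)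
  refine integral_prod_le_of_cov_le hV hW hX hY hvar hcov (h := s) (C := 1 + n + n * n * 3)
    hd hd2 (fun i => by have := hsc i; fun_prop) (fun i x => (sigmoid_pos _).le) ?_ ?_ ?_ ?_
  · intro i x
    have h1 : 0 ≤ s i x := (sigmoid_pos _).le
    have h2 : 0 ≤ 1 - s i x := by linarith [sigmoid_le_one (√n - n * (x - l i))]
    have := mul_nonneg hn (mul_nonneg h1 h2)
    linarith
  · intro i x
    exact (b0 i x).trans (by nlinarith)
  · intro i x
    rw [abs_neg, abs_mul, abs_of_nonneg hn]
    nlinarith [b2 i x, mul_le_mul_of_nonneg_left (b2 i x) hn]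
  · intro i x
    have h3 : |1 - 2 * s i x| ≤ 3 := by
      have := abs_le.1 (b0 i x)
      rw [abs_le]; constructor <;> linarith
    rw [abs_mul, abs_of_nonneg (mul_nonneg hn hn), abs_mul (s i x * (1 - s i x))]
    have : |s i x * (1 - s i x)| * |1 - 2 * s i x| ≤ 1 * 3 :=
      mul_le_mul (b2 i x) h3 (abs_nonneg _) zero_le_one
    nlinarith [mul_le_mul_of_nonneg_left this (mul_nonneg hn hn)]

lemma exists_dense_iff {I Ω : Type*} [TopologicalSpace I] {D : ℕ → I} (hD : DenseRange D)
    {X : I → Ω → ℝ} {l : I → ℝ} (hl : Continuous l) (ω : Ω)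
    (hX : Continuous fun i => X i ω) : (∃ i, l i < X i ω) ↔ ∃ n, l (D n) < X (D n) ω := by
  constructor
  · rintro ⟨i, hi⟩
    obtain ⟨n, hn⟩ := hD.exists_mem_open (isOpen_lt hl hX) ⟨i, hi⟩
    exact ⟨n, hn⟩
  · rintro ⟨n, hn⟩
    exact ⟨_, hn⟩

lemma measurableSet_exists_lt {I Ω : Type*} [TopologicalSpace I]
    [TopologicalSpace.SeparableSpace I] [MeasurableSpace Ω] {X : I → Ω → ℝ} {l : I → ℝ}
    (hl : Continuous l) (hX : ∀ ω, Continuous fun i => X i ω) (hm : ∀ i, Measurable (X i)) :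
    MeasurableSet {ω | ∃ i, l i < X i ω} := by
  rcases isEmpty_or_nonempty I with h | h
  · simp
  · simp only [exists_dense_iff (TopologicalSpace.denseRange_denseSeq I) hl _ (hX _)]
    rw [Set.ofPred_exists]
    exact MeasurableSet.iUnion fun i => measurableSet_lt measurable_const (hm _)

lemma tendsto_measureReal_exists_lt {Ω I : Type*} [MeasurableSpace Ω] [TopologicalSpace I]
    {D : ℕ → I} (hD : DenseRange D) (P : Measure Ω) [IsProbabilityMeasure P] {l : I → ℝ}
    (hl : Continuous l) (X : I → Ω → ℝ) (hX : ∀ ω, Continuous fun i => X i ω) :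
    Tendsto (fun n : ℕ => P.real {ω | ∃ k : Fin n, l (D k) < X (D k) ω}) atTop
      (nhds (P.real {ω | ∃ i, l i < X i ω})) := by
  have e : {ω | ∃ i, l i < X i ω} = ⋃ n : ℕ, {ω | ∃ k : Fin n, l (D k) < X (D k) ω} := by
    ext ω
    rw [Set.mem_ofPred_eq, exists_dense_iff hD hl _ (hX _)]
    simp only [mem_iUnion, Set.mem_ofPred_eq]
    exact ⟨fun ⟨n, hn⟩ => ⟨n + 1, Fin.last n, by simpa using hn⟩, fun ⟨n, k, hk⟩ => ⟨k, hk⟩⟩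
  rw [e]
  refine (ENNReal.tendsto_toReal (measure_ne_top _ _)).comp
    (tendsto_measure_iUnion_atTop fun m n hmn ω => ?_)
  rintro ⟨k, hk⟩
  exact ⟨Fin.castLE hmn k, hk⟩

lemma measureReal_exists_lt_eq {Ω ι : Type*} [MeasurableSpace Ω] [Fintype ι] (P : Measure Ω)
    [IsProbabilityMeasure P] (X : ι → Ω → ℝ) (hX : ∀ i, Measurable (X i)) (l : ι → ℝ) :
    P.real {ω | ∃ k, l k < X k ω} = 1 - P.real {ω | ∀ k, X k ω ≤ l k} := by
  rw [← probReal_compl_eq_one_sub]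
  · congr 1
    ext ω
    simp
  · rw [Set.ofPred_forall]
    exact MeasurableSet.iInter fun i => measurableSet_le (hX _) measurable_const

/-- Slepian's inequality for continuous processes over a separable index space. -/
lemma slepian {Ω Ω' I : Type*} [MeasurableSpace Ω] [MeasurableSpace Ω']
    [TopologicalSpace I] [TopologicalSpace.SeparableSpace I]
    {P : Measure Ω} {Q : Measure Ω'} {V : Submodule ℝ (Ω → ℝ)}
    {W : Submodule ℝ (Ω' → ℝ)} (hV : GaussSpace P V) (hW : GaussSpace Q W)
    {X : I → Ω → ℝ} {Y : I → Ω' → ℝ} (hX : ∀ i, X i ∈ V) (hY : ∀ i, Y i ∈ W)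
    (hXc : ∀ ω, Continuous fun i => X i ω) (hYc : ∀ ω, Continuous fun i => Y i ω)
    (hvar : ∀ i, ∫ ω, X i ω * X i ω ∂P = ∫ ω, Y i ω * Y i ω ∂Q)
    (hcov : ∀ i j, ∫ ω, Y i ω * Y j ω ∂Q ≤ ∫ ω, X i ω * X j ω ∂P)
    {l : I → ℝ} (hl : Continuous l) :
    P.real {ω | ∃ i, l i < X i ω} ≤ Q.real {ω | ∃ i, l i < Y i ω} := by
  have := hV.isProbabilityMeasure
  have := hW.isProbabilityMeasure
  rcases isEmpty_or_nonempty I with h | h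
  · simp
  set D := TopologicalSpace.denseSeq I
  have hD : DenseRange D := TopologicalSpace.denseRange_denseSeq I
  refine le_of_tendsto_of_tendsto' (tendsto_measureReal_exists_lt hD P hl X hXc)
    (tendsto_measureReal_exists_lt hD Q hl Y hYc) fun n => ?_
  have key := slepian_fintype hW hV (X := fun k : Fin n => Y (D k)) (Y := fun k : Fin n => X (D k))
    (fun _ => hY _) (fun _ => hX _) (fun _ => (hvar _).symm) (fun _ _ => hcov _ _)
    (fun k => l (D k))
  rw [measureReal_exists_lt_eq P _ fun k : Fin n => hV.measurable (hX (D k)),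
    measureReal_exists_lt_eq Q _ fun k : Fin n => hW.measurable (hY (D k))]
  linarith

lemma integral_inv_mul_mul {Ω I : Type*} [MeasurableSpace Ω] (P : Measure Ω) (X : I → Ω → ℝ)
    (σ : I → ℝ) (i j : I) :
    ∫ ω, (σ i)⁻¹ * X i ω * ((σ j)⁻¹ * X j ω) ∂P =
      ((σ i)⁻¹ * (σ j)⁻¹) * ∫ ω, X i ω * X j ω ∂P := by
  rw [← integral_const_mul]
  congr 1; ext ω; ring

lemma setOf_inv_mul_eq {Ω I : Type*} (X : I → Ω → ℝ) {σ : I → ℝ} (hσ : ∀ i, 0 < σ i) (l : I → ℝ) :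
    {ω | ∃ i, l i < (σ i)⁻¹ * X i ω} = {ω | ∃ i, σ i * l i < X i ω} := by
  ext ω
  refine exists_congr fun i => ?_
  rw [lt_inv_mul_iff₀ (hσ i)]

/-- Slepian's inequality for processes that are not normalised to have the same variances. -/
lemma slepian_normalized {Ω Ω' I : Type*} [MeasurableSpace Ω] [MeasurableSpace Ω']
    [TopologicalSpace I] [TopologicalSpace.SeparableSpace I]
    {P : Measure Ω} {Q : Measure Ω'} {V : Submodule ℝ (Ω → ℝ)}
    {W : Submodule ℝ (Ω' → ℝ)} (hV : GaussSpace P V) (hW : GaussSpace Q W)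
    {X : I → Ω → ℝ} {Y : I → Ω' → ℝ} (hX : ∀ i, X i ∈ V) (hY : ∀ i, Y i ∈ W)
    (hXc : ∀ ω, Continuous fun i => X i ω) (hYc : ∀ ω, Continuous fun i => Y i ω)
    {σ τ : I → ℝ} (hσ : ∀ i, 0 < σ i) (hτ : ∀ i, 0 < τ i) (hσc : Continuous σ) (hτc : Continuous τ)
    (hvX : ∀ i, ∫ ω, X i ω * X i ω ∂P = σ i ^ 2) (hvY : ∀ i, ∫ ω, Y i ω * Y i ω ∂Q = τ i ^ 2)
    (hcov : ∀ i j, (∫ ω, Y i ω * Y j ω ∂Q) * (σ i * σ j) ≤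
      (∫ ω, X i ω * X j ω ∂P) * (τ i * τ j))
    {l : I → ℝ} (hl : Continuous l) :
    P.real {ω | ∃ i, σ i * l i < X i ω} ≤ Q.real {ω | ∃ i, τ i * l i < Y i ω} := by
  have key := slepian hV hW (X := fun i ω => (σ i)⁻¹ * X i ω) (Y := fun i ω => (τ i)⁻¹ * Y i ω)
    (fun i => V.smul_mem _ (hX i)) (fun i => W.smul_mem _ (hY i))
    (fun ω => (hσc.inv₀ fun i => (hσ i).ne').mul (hXc ω))
    (fun ω => (hτc.inv₀ fun i => (hτ i).ne').mul (hYc ω)) ?_ ?_ hl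
  · rwa [setOf_inv_mul_eq X hσ l, setOf_inv_mul_eq Y hτ l] at key
  · intro i
    simp only [integral_inv_mul_mul, hvX, hvY]
    have := (hσ i).ne'
    have := (hτ i).ne'
    field_simp
  · intro i j
    simp only [integral_inv_mul_mul]
    have h1 := hσ i
    have h2 := hσ j
    have h3 := hτ i
    have h4 := hτ j
    rw [← mul_inv, ← mul_inv, inv_mul_eq_div, inv_mul_eq_div,
      div_le_div_iff₀ (mul_pos h3 h4) (mul_pos h1 h2)]
    exact hcov i j

namespace GaussSpace

/-- The space of sums `∑ k, f k (ω k)` with `f k ∈ V`. -/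
def pi {Ω : Type*} (V : Submodule ℝ (Ω → ℝ)) (κ : Type*) [Fintype κ] :
    Submodule ℝ ((κ → Ω) → ℝ) where
  carrier := {F | ∃ f : κ → Ω → ℝ, (∀ k, f k ∈ V) ∧ F = fun ω => ∑ k, f k (ω k)}
  add_mem' := by
    rintro _ _ ⟨f, hf, rfl⟩ ⟨g, hg, rfl⟩
    exact ⟨fun k => f k + g k, fun k => V.add_mem (hf k) (hg k), by
      ext ω; simp [Finset.sum_add_distrib]⟩
  zero_mem' := ⟨fun _ => 0, fun _ => V.zero_mem, by ext ω; simp⟩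
  smul_mem' := by
    rintro c _ ⟨f, hf, rfl⟩
    exact ⟨fun k => c • f k, fun k => V.smul_mem _ (hf k), by ext ω; simp [Finset.mul_sum]⟩

variable {Ω κ : Type*} [Fintype κ] {V : Submodule ℝ (Ω → ℝ)}

lemma mem_pi {f : κ → Ω → ℝ} (hf : ∀ k, f k ∈ V) : (fun ω : κ → Ω => ∑ k, f k (ω k)) ∈ pi V κ :=
  ⟨f, hf, rfl⟩

lemma comp_eval_mem_pi [DecidableEq κ] {f : Ω → ℝ} (hf : f ∈ V) (k : κ) :
    (fun ω : κ → Ω => f (ω k)) ∈ pi V κ := by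
  refine ⟨fun j => if j = k then f else 0, fun j => ?_, ?_⟩
  · by_cases h : j = k
    · simpa [h] using hf
    · simp [h]
  · ext ω
    rw [Finset.sum_eq_single k]
    · simp
    · intro j _ hj; simp [hj]
    · simp

variable [MeasurableSpace Ω] {P : Measure Ω}

lemma integral_comp_eval (hV : GaussSpace P V) (k : κ) {f : Ω → ℝ} (hf : Measurable f) :
    ∫ ω, f (ω k) ∂(Measure.pi fun _ : κ => P) = ∫ ω, f ω ∂P := by
  have := hV.isProbabilityMeasure
  have h := (measurePreserving_eval (fun _ : κ => P) k).map_eq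
  conv_rhs => rw [← h]
  rw [integral_map (measurable_pi_apply k).aemeasurable hf.aestronglyMeasurable]

lemma gaussSpace_pi (hV : GaussSpace P V) : GaussSpace (Measure.pi fun _ : κ => P) (pi V κ) := by
  have := hV.isProbabilityMeasure
  rintro _ ⟨f, hf, rfl⟩
  have hfm : ∀ k, Measurable (f k) := fun k => hV.measurable (hf k)
  have hm : Measurable (fun ω : κ → Ω => ∑ k, f k (ω k)) := by fun_prop
  refine ⟨hm, ?_⟩
  have hl : ∀ k, HasGaussianLaw (fun ω : κ → Ω => f k (ω k)) (Measure.pi fun _ : κ => P) := by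
    intro k
    obtain ⟨_, v, hv⟩ := hV _ (hf k)
    constructor
    have : (fun ω : κ → Ω => f k (ω k)) = f k ∘ Function.eval k := rfl
    rw [this, ← Measure.map_map (hfm k) (by fun_prop),
      (measurePreserving_eval (fun _ : κ => P) k).map_eq, hv]
    infer_instance
  have hi : iIndepFun (fun k (ω : κ → Ω) => f k (ω k)) (Measure.pi fun _ : κ => P) :=
    iIndepFun_pi fun k => (hfm k).aemeasurable
  have hs : HasGaussianLaw (fun ω : κ → Ω => ∑ k, f k (ω k)) (Measure.pi fun _ : κ => P) :=
    (hi.hasGaussianLaw hl).fun_sum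
  have h0 : ∫ ω, ∑ k, f k (ω k) ∂(Measure.pi fun _ : κ => P) = 0 := by
    rw [integral_finsetSum]
    · exact Finset.sum_eq_zero fun k _ => by
        rw [integral_comp_eval hV k (hfm k), hV.integral_eq_zero (hf k)]
    · exact fun k _ => (hl k).integrable
  exact ⟨_, by rw [hs.map_eq_gaussianReal, h0]⟩

lemma integral_eval_mul_eval [DecidableEq κ] (hV : GaussSpace P V) {f g : Ω → ℝ} (hf : f ∈ V)
    (hg : g ∈ V) (k j : κ) :
    ∫ ω, f (ω k) * g (ω j) ∂(Measure.pi fun _ : κ => P) =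
      if k = j then ∫ ω, f ω * g ω ∂P else 0 := by
  have := hV.isProbabilityMeasure
  split_ifs with h
  · subst h
    exact integral_comp_eval hV k ((hV.measurable hf).mul (hV.measurable hg))
  · have hi : iIndepFun (fun k (ω : κ → Ω) => ω k) (Measure.pi fun _ : κ => P) :=
      iIndepFun_pi (X := fun _ => id) fun k => aemeasurable_id
    have h2 := (hi.indepFun h).comp (hV.measurable hf) (hV.measurable hg)
    have h3 := h2.integral_fun_mul_eq_mul_integral
      ((hV.measurable hf).comp (measurable_pi_apply k)).aestronglyMeasurable
      ((hV.measurable hg).comp (measurable_pi_apply j)).aestronglyMeasurable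
    simp only [Function.comp_def] at h3
    rw [h3, integral_comp_eval hV k (hV.measurable hf), hV.integral_eq_zero hf, zero_mul]

lemma integral_sum_mul_sum (hV : GaussSpace P V) {f g : κ → Ω → ℝ} (hf : ∀ k, f k ∈ V)
    (hg : ∀ k, g k ∈ V) :
    ∫ ω, (∑ k, f k (ω k)) * (∑ k, g k (ω k)) ∂(Measure.pi fun _ : κ => P) =
      ∑ k, ∫ ω, f k ω * g k ω ∂P := by
  classical
  have hpi := hV.gaussSpace_pi (κ := κ)
  simp only [Finset.sum_mul_sum]
  rw [integral_finsetSum]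
  · refine Finset.sum_congr rfl fun k _ => ?_
    rw [integral_finsetSum]
    · simp [integral_eval_mul_eval hV (hf _) (hg _)]
    · exact fun j _ => hpi.integrable_mul (comp_eval_mem_pi (hf k) k) (comp_eval_mem_pi (hg j) j)
  · exact fun k _ => integrable_finsetSum _ fun j _ =>
      hpi.integrable_mul (comp_eval_mem_pi (hf k) k) (comp_eval_mem_pi (hg j) j)

end GaussSpace

/-- Fractional Brownian motion with Hurst index `H` and continuous paths. -/
structure FBM {Ω : Type*} [MeasurableSpace Ω] (μ : Measure Ω) (H : ℝ) (B : ℝ → Ω → ℝ) : Prop where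
  gauss : GaussSpace μ (Submodule.span ℝ (range B))
  cont : ∀ ω, Continuous fun t => B t ω
  zero : ∀ ω, B 0 ω = 0
  cov : ∀ t s : ℝ, 0 ≤ t → 0 ≤ s →
      ∫ ω, B t ω * B s ω ∂μ = (t ^ (2*H) + s ^ (2*H) - |t - s| ^ (2*H)) / 2

lemma gaussSpace_span {Ω : Type*} [MeasurableSpace Ω] {μ : Measure Ω} {B : ℝ → Ω → ℝ}
    (hmeas : ∀ t : ℝ, Measurable (B t))
    (hgauss : ∀ (n : ℕ) (c : Fin n → ℝ) (t : Fin n → ℝ),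
      ∃ v : NNReal, μ.map (fun ω => ∑ i, c i * B (t i) ω) = gaussianReal 0 v) :
    GaussSpace μ (Submodule.span ℝ (range B)) := by
  intro f hf
  obtain ⟨c, rfl⟩ := Finsupp.mem_span_range_iff_exists_finsupp.1 hf
  have e : (c.sum fun i a => a • B i) = fun ω => ∑ k : Fin c.support.card,
      c (c.support.equivFin.symm k) * B (c.support.equivFin.symm k) ω := by
    ext ω
    rw [Finsupp.sum, Finset.sum_apply, ← Finset.sum_coe_sort,
      ← Equiv.sum_comp c.support.equivFin.symm]
    simp
  rw [e]
  refine ⟨?_, hgauss _ _ _⟩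
  exact Finset.measurable_fun_sum _ fun k _ => (hmeas _).const_mul _

namespace FBM

lemma mem {Ω : Type*} {B : ℝ → Ω → ℝ} (t : ℝ) : B t ∈ Submodule.span ℝ (range B) := Submodule.subset_span ⟨t, rfl⟩

lemma sub_mem {Ω : Type*} {B : ℝ → Ω → ℝ} (s t : ℝ) : (fun ω => B t ω - B s ω) ∈ Submodule.span ℝ (range B) :=
  Submodule.sub_mem _ (mem t) (mem s)

variable {Ω : Type*} [MeasurableSpace Ω] {μ : Measure Ω} {H : ℝ} {B : ℝ → Ω → ℝ}

lemma cov_increments (hB : FBM μ H B) {a b c d : ℝ} (ha : 0 ≤ a) (hb : 0 ≤ b) (hc : 0 ≤ c)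
    (hd : 0 ≤ d) :
    ∫ ω, (B b ω - B a ω) * (B d ω - B c ω) ∂μ =
      (|b - c| ^ (2*H) + |a - d| ^ (2*H) - |b - d| ^ (2*H) - |a - c| ^ (2*H)) / 2 := by
  have i := fun s t => hB.gauss.integrable_mul (mem s) (mem t)
  have : (fun ω => (B b ω - B a ω) * (B d ω - B c ω)) =
    fun ω => (B b ω * B d ω - B b ω * B c ω) - (B a ω * B d ω - B a ω * B c ω) := by ext ω; ring
  have i1 : Integrable (fun ω => B b ω * B d ω - B b ω * B c ω) μ := (i b d).sub (i b c)
  have i2 : Integrable (fun ω => B a ω * B d ω - B a ω * B c ω) μ := (i a d).sub (i a c)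
  rw [this, integral_sub i1 i2, integral_sub (i b d) (i b c),
    integral_sub (i a d) (i a c), hB.cov _ _ hb hd, hB.cov _ _ hb hc, hB.cov _ _ ha hd,
    hB.cov _ _ ha hc]
  ring

/-- The supremum in the definition of the Pickands constant. -/
noncomputable def pickSup {Ω : Type*} (H : ℝ) (B : ℝ → Ω → ℝ) (lam : ℝ) (ω : Ω) : ℝ :=
  ⨆ t : Set.Icc (0:ℝ) lam, (Real.sqrt 2 * B (t:ℝ) ω - (t:ℝ) ^ (2*H))

lemma continuous_pick (hB : FBM μ H B) (hH : 0 < H) (ω : Ω) :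
    Continuous fun t : ℝ => √2 * B t ω - t ^ (2*H) := by
  have := hB.cont ω
  exact (this.const_mul _).sub (continuous_id.rpow_const fun _ => Or.inr (by positivity))

lemma le_pickSup (hB : FBM μ H B) (hH : 0 < H) {lam : ℝ} (ω : Ω) {t : ℝ} (ht : t ∈ Icc 0 lam) :
    √2 * B t ω - t ^ (2*H) ≤ pickSup H B lam ω := by
  have hb : BddAbove (range fun t : Set.Icc (0:ℝ) lam => (√2 * B (t:ℝ) ω - (t:ℝ) ^ (2*H))) :=
    (isCompact_range ((hB.continuous_pick hH ω).comp continuous_subtype_val)).bddAbove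
  exact le_ciSup hb (⟨t, ht⟩ : Set.Icc (0:ℝ) lam)

lemma exists_eq_pickSup (hB : FBM μ H B) (hH : 0 < H) {lam : ℝ} (hl : 0 ≤ lam) (ω : Ω) :
    ∃ t : Icc (0 : ℝ) lam, √2 * B t ω - (t : ℝ) ^ (2*H) = pickSup H B lam ω := by
  have : Nonempty (Icc (0 : ℝ) lam) := ⟨⟨0, le_refl _, hl⟩⟩
  obtain ⟨t, -, ht⟩ := (isCompact_univ (X := Icc (0 : ℝ) lam)).exists_isMaxOn univ_nonempty
    ((hB.continuous_pick hH ω).comp continuous_subtype_val).continuousOn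
  refine ⟨t, le_antisymm (hB.le_pickSup hH ω t.2) (ciSup_le fun s => ht (mem_univ s))⟩

lemma measurable_pickSup (hB : FBM μ H B) (hH : 0 < H) {lam : ℝ} (hl : 0 ≤ lam) :
    Measurable (pickSup H B lam) := by
  refine measurable_of_Ioi fun x => ?_
  have : pickSup H B lam ⁻¹' Ioi x =
      {ω | ∃ t : Icc (0 : ℝ) lam, x < √2 * B t ω - (t : ℝ) ^ (2*H)} := by
    ext ω
    refine ⟨fun h => ?_, fun ⟨t, ht⟩ => ht.trans_le (hB.le_pickSup hH ω t.2)⟩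
    obtain ⟨t, ht⟩ := hB.exists_eq_pickSup hH hl ω
    exact ⟨t, by rw [ht]; exact h⟩
  rw [this]
  exact measurableSet_exists_lt continuous_const
    (fun ω => (hB.continuous_pick hH ω).comp continuous_subtype_val)
    (fun t => ((hB.gauss.measurable (mem _)).const_mul _).sub_const _)

lemma pickSup_mono (hB : FBM μ H B) (hH : 0 < H) {l l' : ℝ} (hl : 0 ≤ l) (h : l ≤ l') (ω : Ω) :
    pickSup H B l ω ≤ pickSup H B l' ω := by
  obtain ⟨t, ht⟩ := hB.exists_eq_pickSup hH hl ω
  rw [← ht]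
  exact hB.le_pickSup hH ω ⟨t.2.1, t.2.2.trans h⟩

/-- The expectation in the definition of the Pickands constant. -/
noncomputable def pickMean {Ω : Type*} [MeasurableSpace Ω] (μ : Measure Ω) (H : ℝ) (B : ℝ → Ω → ℝ) (lam : ℝ) : ℝ :=
  ∫ ω, exp (pickSup H B lam ω) ∂μ

lemma integrable_exp_pickSup (hB : FBM μ H B) (hH : 0 < H) {HH : ℝ} (hHH : 0 < HH)
    (hPick : Tendsto (fun lam : ℝ => lam⁻¹ * pickMean μ H B lam) atTop (nhds HH))
    {l : ℝ} (hl : 0 ≤ l) : Integrable (fun ω => exp (pickSup H B l ω)) μ := by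
  obtain ⟨l', h1, h2⟩ := ((hPick.eventually (lt_mem_nhds hHH)).and (eventually_ge_atTop l)).exists
  have hi : Integrable (fun ω => exp (pickSup H B l' ω)) μ := by
    by_contra hc
    rw [pickMean, integral_undef hc] at h1
    simp at h1
  refine hi.mono' (hB.measurable_pickSup hH hl).exp.aestronglyMeasurable (ae_of_all _ fun ω => ?_)
  rw [Real.norm_eq_abs, abs_of_pos (exp_pos _)]
  exact exp_le_exp.2 (hB.pickSup_mono hH hl h2 ω)

end FBM

/-- The classical approximation of the normal tail. -/
noncomputable def millsTail (w : ℝ) : ℝ := exp (-(w ^ 2 / 2)) / (√(2 * π) * w)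

lemma millsTail_pos {w : ℝ} (hw : 0 < w) : 0 < millsTail w := by
  unfold millsTail; positivity

lemma stdNormalTail_nonneg (x : ℝ) : 0 ≤ stdNormalTail x := ENNReal.toReal_nonneg

lemma stdNormalTail_antitone : Antitone stdNormalTail := fun _ _ h =>
  ENNReal.toReal_mono (measure_ne_top _ _) (measure_mono (Ioi_subset_Ioi h))

lemma stdNormalTail_eq (x : ℝ) :
    stdNormalTail x = ∫ z in Ioi x, (√(2 * π))⁻¹ * exp (-(z ^ 2 / 2)) := by
  rw [stdNormalTail, gaussianReal_apply_eq_integral _ one_ne_zero, ENNReal.toReal_ofReal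
    (integral_nonneg fun z => gaussianPDFReal_nonneg _ _ _)]
  simp [gaussianPDFReal_def, neg_div]

lemma integrable_stdNormal : Integrable (fun z : ℝ => (√(2 * π))⁻¹ * exp (-(z ^ 2 / 2))) := by
  have := integrable_gaussianPDFReal 0 1
  simpa [gaussianPDFReal_def, neg_div] using this

lemma stdNormalTail_le {w : ℝ} (hw : 0 < w) (y : ℝ) :
    stdNormalTail (w - y / w) ≤ millsTail w * exp y := by
  have hneg : -w < 0 := by linarith
  calc stdNormalTail (w - y / w)
      ≤ ∫ z in Ioi (w - y / w), (√(2 * π))⁻¹ * exp (w ^ 2 / 2) * exp (-w * z) := by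
        rw [stdNormalTail_eq]
        refine setIntegral_mono integrable_stdNormal.integrableOn
          ((integrableOn_exp_mul_Ioi hneg _).const_mul _) fun z => ?_
        rw [mul_assoc, ← exp_add]
        refine mul_le_mul_of_nonneg_left (exp_le_exp.2 ?_) (by positivity)
        nlinarith [sq_nonneg (z - w)]
    _ = millsTail w * exp y := by
        rw [integral_const_mul, integral_exp_mul_Ioi hneg, millsTail]
        have : exp (-w * (w - y / w)) = exp (-(w ^ 2 / 2)) * exp (-(w ^ 2 / 2)) * exp y := by
          rw [← exp_add, ← exp_add]
          congr 1
          field_simp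
          ring
        rw [this]
        have h2 : exp (w ^ 2 / 2) * exp (-(w ^ 2 / 2)) = 1 := by rw [← exp_add]; simp
        have : 0 < √(2 * π) := by positivity
        field_simp
        linear_combination h2

lemma le_stdNormalTail {w : ℝ} (hw : 0 < w) (y : ℝ) {A : ℝ} (hA : 0 ≤ A) :
    millsTail w * (exp y * (1 - exp (-A)) * exp (-((|y| + A) / w) ^ 2 / 2)) ≤
      stdNormalTail (w - y / w) := by
  have hneg : -w < 0 := by linarith
  set x := w - y / w with hx
  set c := (√(2 * π))⁻¹ * exp (w ^ 2 / 2) * exp (-((|y| + A) / w) ^ 2 / 2) with hc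
  have hxA : x ≤ x + A / w := le_add_of_nonneg_right (by positivity)
  calc _ = ∫ z in Ioc x (x + A / w), c * exp (-w * z) := by
        rw [← intervalIntegral.integral_of_le hxA, intervalIntegral.integral_const_mul,
          intervalIntegral.integral_comp_mul_left (f := exp) hneg.ne, integral_exp, smul_eq_mul, hc,
          millsTail]
        have e1 : exp (-w * x) = exp (-(w ^ 2 / 2)) * exp (-(w ^ 2 / 2)) * exp y := by
          rw [← exp_add, ← exp_add, hx]
          congr 1
          field_simp
          ring
        have e2 : exp (-w * (x + A / w)) = exp (-w * x) * exp (-A) := by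
          rw [← exp_add]; congr 1; field_simp; ring
        rw [e2, e1]
        have h2 : exp (w ^ 2 / 2) * exp (-(w ^ 2 / 2)) = 1 := by rw [← exp_add]; simp
        have : 0 < √(2 * π) := by positivity
        field_simp
        linear_combination (-(1 - exp (-A))) * h2
    _ ≤ ∫ z in Ioc x (x + A / w), (√(2 * π))⁻¹ * exp (-(z ^ 2 / 2)) := by
        refine setIntegral_mono_on (IntegrableOn.mono_set (t := Ioi x)
          ((integrableOn_exp_mul_Ioi hneg x).const_mul c) Ioc_subset_Ioi_self) integrable_stdNormal.integrableOn measurableSet_Ioc fun z hz => ?_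
        rw [hc, mul_assoc, mul_assoc, ← exp_add, ← exp_add]
        refine mul_le_mul_of_nonneg_left (exp_le_exp.2 ?_) (by positivity)
        have h1 : |z - w| ≤ (|y| + A) / w := by
          have hz1 := hz.1
          have hz2 := hz.2
          rw [hx] at hz1 hz2
          have a1 : y / w ≤ |y| / w := div_le_div_of_nonneg_right (le_abs_self y) hw.le
          have a2 : -(|y| / w) ≤ y / w := by
            rw [← neg_div]; exact div_le_div_of_nonneg_right (neg_abs_le y) hw.le
          have a3 : 0 ≤ A / w := by positivity
          rw [add_div, abs_le]
          constructor <;> linarith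
        have h2 := pow_le_pow_left₀ (abs_nonneg _) h1 2
        rw [sq_abs] at h2
        nlinarith
    _ ≤ _ := by
        rw [stdNormalTail_eq]
        exact setIntegral_mono_set integrable_stdNormal.integrableOn
          (ae_of_all _ fun z => by positivity) Ioc_subset_Ioi_self.eventuallyLE

lemma tendsto_stdNormalTail_div (y : ℝ) :
    Tendsto (fun w => stdNormalTail (w - y / w) / millsTail w) atTop (nhds (exp y)) := by
  have hlow : Tendsto (fun w : ℝ => exp y * (1 - exp (-√w)) * exp (-((|y| + √w) / w) ^ 2 / 2))
      atTop (nhds (exp y)) := by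
    have h1 : Tendsto (fun w : ℝ => exp (-√w)) atTop (nhds 0) :=
      tendsto_exp_neg_atTop_nhds_zero.comp tendsto_sqrt_atTop
    have h2 : Tendsto (fun w : ℝ => (|y| + √w) / w) atTop (nhds 0) := by
      have a : Tendsto (fun w : ℝ => |y| / w) atTop (nhds 0) := tendsto_const_nhds.div_atTop tendsto_id
      have b : Tendsto (fun w : ℝ => √w / w) atTop (nhds 0) := by
        refine (tendsto_inv_atTop_zero.comp tendsto_sqrt_atTop).congr' ?_
        filter_upwards [eventually_gt_atTop 0] with w hw
        simp only [Function.comp]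
        rw [eq_div_iff hw.ne', inv_mul_eq_div, div_sqrt]
      simpa [add_div] using a.add b
    have h3 : Tendsto (fun w : ℝ => exp (-((|y| + √w) / w) ^ 2 / 2)) atTop (nhds 1) := by
      have := ((h2.neg.pow 2).div_const 2).neg.rexp
      refine Tendsto.congr (fun w => ?_) (by simpa using this)
      congr 1; ring
    simpa using ((h1.const_sub 1).const_mul (exp y)).mul h3
  refine tendsto_of_tendsto_of_tendsto_of_le_of_le' hlow tendsto_const_nhds ?_ ?_
  · filter_upwards [eventually_gt_atTop 0] with w hw
    rw [le_div_iff₀ (millsTail_pos hw), mul_comm]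
    exact le_stdNormalTail hw y (sqrt_nonneg _)
  · filter_upwards [eventually_gt_atTop 0] with w hw
    rw [div_le_iff₀ (millsTail_pos hw), mul_comm]
    exact stdNormalTail_le hw y

lemma gaussSpace_id : GaussSpace (gaussianReal 0 1) (Submodule.span ℝ {(id : ℝ → ℝ)}) := by
  intro f hf
  obtain ⟨c, rfl⟩ := Submodule.mem_span_singleton.1 hf
  refine ⟨measurable_id.const_smul c, ?_⟩
  have := gaussianReal_map_const_mul (μ := 0) (v := 1) c
  exact ⟨_, by simpa using! this⟩

lemma integral_id_mul_id : ∫ z : ℝ, z * z ∂(gaussianReal 0 1) = 1 := by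
  have h := variance_of_integral_eq_zero (X := fun x : ℝ => x) (μ := gaussianReal 0 1)
    (by fun_prop) (by exact integral_id_gaussianReal)
  rw [variance_fun_id_gaussianReal] at h
  simpa [sq] using h.symm

lemma mul_sqrt_add_le {w v : ℝ} (hv : 0 ≤ v) : w * √(w ^ 2 + v) - w ^ 2 ≤ v / 2 := by
  have := Real.sq_sqrt (by positivity : 0 ≤ w ^ 2 + v)
  nlinarith [sq_nonneg (√(w ^ 2 + v) - w)]

lemma abs_sqrt_sub_sqrt_le {w v v' : ℝ} (hw : 0 < w) (hv : 0 ≤ v) (hv' : 0 ≤ v') :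
    |√(w ^ 2 + v) - √(w ^ 2 + v')| ≤ |v - v'| / (2 * w) := by
  have h1 := Real.sq_sqrt (by positivity : 0 ≤ w ^ 2 + v)
  have h2 := Real.sq_sqrt (by positivity : 0 ≤ w ^ 2 + v')
  have h3 : w ≤ √(w ^ 2 + v) := Real.le_sqrt_of_sq_le (by linarith)
  have h4 : w ≤ √(w ^ 2 + v') := Real.le_sqrt_of_sq_le (by linarith)
  rw [le_div_iff₀ (by positivity)]
  have : v - v' = (√(w ^ 2 + v) - √(w ^ 2 + v')) * (√(w ^ 2 + v) + √(w ^ 2 + v')) := by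
    linear_combination h2 - h1
  rw [this, abs_mul, abs_of_pos (by linarith : 0 < √(w ^ 2 + v) + √(w ^ 2 + v'))]
  exact mul_le_mul_of_nonneg_left (by linarith) (abs_nonneg _)

lemma le_mul_sqrt_add {w v : ℝ} (hw : 0 < w) (hv : 0 ≤ v) :
    v / 2 - v ^ 2 / (8 * w ^ 2) ≤ w * √(w ^ 2 + v) - w ^ 2 := by
  have h1 := Real.sq_sqrt (by positivity : 0 ≤ w ^ 2 + v)
  have h2 := abs_sqrt_sub_sqrt_le hw hv le_rfl
  rw [add_zero, Real.sqrt_sq hw.le, sub_zero, abs_of_nonneg hv] at h2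
  have h3 := pow_le_pow_left₀ (abs_nonneg _) h2 2
  rw [sq_abs, div_pow] at h3
  have h4 : v ^ 2 / (8 * w ^ 2) = v ^ 2 / (2 * w) ^ 2 / 2 := by field_simp; ring
  rw [h4]
  linarith

namespace FBM

variable {Ω κ : Type*} [Fintype κ] [MeasurableSpace Ω] {μ : Measure Ω} {H : ℝ} {B : ℝ → Ω → ℝ}
  {lam : ℝ}

/-- The variance of `∑ k, √2 B(t k)` for independent copies of `B`. -/
noncomputable def locVar (H : ℝ) (t : κ → Icc (0 : ℝ) lam) : ℝ := ∑ k, 2 * (t k : ℝ) ^ (2*H)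

/-- A stationary-like field having the local structure of a high excursion. -/
noncomputable def locField (B : ℝ → Ω → ℝ) (w : ℝ) (t : κ → Icc (0 : ℝ) lam)
    (p : (κ → Ω) × ℝ) : ℝ := (∑ k, √2 * B (t k) (p.1 k)) + w * p.2

/-- The excursion probability of `locField`. -/
noncomputable def locProb (μ : Measure Ω) (H : ℝ) (B : ℝ → Ω → ℝ) (κ : Type*) [Fintype κ]
    (lam w : ℝ) : ℝ :=
  ((Measure.pi fun _ : κ => μ).prod (gaussianReal 0 1)).real
    {p | ∃ t : κ → Icc (0 : ℝ) lam, √(w ^ 2 + locVar H t) * w < locField B w t p}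

lemma locVar_nonneg (t : κ → Icc (0 : ℝ) lam) : 0 ≤ locVar H t :=
  Finset.sum_nonneg fun k _ => mul_nonneg zero_le_two (rpow_nonneg (t k).2.1 _)

lemma locVar_le (hH : 0 < H) (t : κ → Icc (0 : ℝ) lam) :
    locVar H t ≤ 2 * Fintype.card κ * lam ^ (2*H) := by
  refine (Finset.sum_le_sum (g := fun _ => 2 * lam ^ (2*H)) fun k _ => ?_).trans_eq ?_
  · exact mul_le_mul_of_nonneg_left (rpow_le_rpow (t k).2.1 (t k).2.2 (by positivity)) zero_le_two
  · simp; ring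

lemma continuous_locVar (hH : 0 < H) : Continuous fun t : κ → Icc (0 : ℝ) lam => locVar H t := by
  unfold locVar
  refine continuous_finsetSum _ fun k _ => continuous_const.mul ?_
  exact (continuous_subtype_val.comp (continuous_apply k)).rpow_const fun _ => Or.inr (by positivity)

lemma measurable_sum_pickSup (hB : FBM μ H B) (hH : 0 < H) (hl : 0 ≤ lam) :
    Measurable fun ω : κ → Ω => ∑ k, pickSup H B lam (ω k) :=
  Finset.measurable_fun_sum _ fun k _ => (hB.measurable_pickSup hH hl).comp (measurable_pi_apply k)

lemma prod_real_lt [IsProbabilityMeasure μ] {S : (κ → Ω) → ℝ} (hS : Measurable S) (w : ℝ) :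
    ((Measure.pi fun _ : κ => μ).prod (gaussianReal 0 1)).real
      {p | w - S p.1 / w < p.2} =
    ∫ ω, stdNormalTail (w - S ω / w) ∂(Measure.pi fun _ : κ => μ) := by
  have hm : MeasurableSet {p : (κ → Ω) × ℝ | w - S p.1 / w < p.2} :=
    measurableSet_lt (measurable_const.sub ((hS.comp measurable_fst).div_const _)) measurable_snd
  rw [measureReal_def, Measure.prod_apply hm, ← integral_toReal
    (measurable_measure_prodMk_left hm).aemeasurable (ae_of_all _ fun _ => measure_lt_top _ _)]
  rfl

lemma integral_exp_sum_pickSup (hB : FBM μ H B) :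
    ∫ ω, exp (∑ k, pickSup H B lam (ω k)) ∂(Measure.pi fun _ : κ => μ) =
      pickMean μ H B lam ^ Fintype.card κ := by
  have := hB.gauss.isProbabilityMeasure
  simp only [exp_sum]
  rw [integral_fintype_prod_eq_prod (f := fun _ ω => exp (pickSup H B lam ω))]
  simp [pickMean]

lemma integrable_exp_sum_pickSup (hB : FBM μ H B)
    (hi : Integrable (fun ω => exp (pickSup H B lam ω)) μ) :
    Integrable (fun ω : κ → Ω => exp (∑ k, pickSup H B lam (ω k))) (Measure.pi fun _ : κ => μ) := by
  have := hB.gauss.isProbabilityMeasure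
  simp only [exp_sum]
  exact Integrable.fintype_prod (f := fun _ ω => exp (pickSup H B lam ω)) fun _ => hi

lemma locField_lt_iff {Ω : Type*} {B : ℝ → Ω → ℝ} {w : ℝ} (t : κ → Icc (0 : ℝ) lam) (p : (κ → Ω) × ℝ) :
    √(w ^ 2 + locVar H t) * w < locField B w t p ↔
    w * √(w ^ 2 + locVar H t) - w ^ 2 - ∑ k, √2 * B (t k) (p.1 k) < w * (p.2 - w) := by
  unfold locField
  constructor <;> intro h <;> nlinarith

lemma sum_pick_eq {Ω : Type*} {B : ℝ → Ω → ℝ} (t : κ → Icc (0 : ℝ) lam) (ω : κ → Ω) :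
    ∑ k, √2 * B (t k) (ω k) =
      ∑ k, (√2 * B (t k) (ω k) - (t k : ℝ) ^ (2*H)) + locVar H t / 2 := by
  rw [Finset.sum_sub_distrib, locVar, Finset.sum_div, sub_add, ← Finset.sum_sub_distrib]; simp

lemma le_locProb (hB : FBM μ H B) (hH : 0 < H) (hl : 0 ≤ lam) {w : ℝ} (hw : 0 < w) :
    ∫ ω, stdNormalTail (w - (∑ k, pickSup H B lam (ω k)) / w) ∂(Measure.pi fun _ : κ => μ) ≤
      locProb μ H B κ lam w := by
  have := hB.gauss.isProbabilityMeasure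
  rw [← prod_real_lt (hB.measurable_sum_pickSup hH hl)]
  refine measureReal_mono fun p hp => ?_
  choose t ht using fun k => hB.exists_eq_pickSup hH hl (p.1 k)
  refine ⟨t, (locField_lt_iff t p).2 ?_⟩
  rw [sum_pick_eq (H := H)]
  simp only [ht]
  have hp' : w - (∑ k, pickSup H B lam (p.1 k)) / w < p.2 := hp
  have h1 : -(∑ k, pickSup H B lam (p.1 k)) < w * (p.2 - w) := by
    have := mul_lt_mul_of_pos_left hp' hw
    rw [mul_sub, mul_div_cancel₀ _ hw.ne'] at this
    linarith
  have hv := locVar_nonneg (H := H) t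
  have h2 := mul_sqrt_add_le (w := w) hv
  linarith

lemma locProb_le (hB : FBM μ H B) (hH : 0 < H) (hl : 0 ≤ lam) {w : ℝ} (hw : 0 < w)
    (hi : Integrable (fun ω => exp (pickSup H B lam ω)) μ) :
    locProb μ H B κ lam w ≤ millsTail w * exp ((2 * Fintype.card κ * lam ^ (2*H)) ^ 2 / (8 * w ^ 2)) *
      pickMean μ H B lam ^ Fintype.card κ := by
  have := hB.gauss.isProbabilityMeasure
  set K := 2 * Fintype.card κ * lam ^ (2*H) with hK
  set e := K ^ 2 / (8 * w ^ 2) with he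
  have hm := (hB.measurable_sum_pickSup (κ := κ) hH hl).add_const e
  calc locProb μ H B κ lam w ≤ ((Measure.pi fun _ : κ => μ).prod (gaussianReal 0 1)).real
        {p | w - (∑ k, pickSup H B lam (p.1 k) + e) / w < p.2} := by
        refine measureReal_mono ?_
        rintro p ⟨t, ht⟩
        rw [locField_lt_iff, sum_pick_eq (H := H)] at ht
        have h1 : ∑ k, (√2 * B (t k) (p.1 k) - (t k : ℝ) ^ (2*H)) ≤ ∑ k, pickSup H B lam (p.1 k) :=
          Finset.sum_le_sum fun k _ => hB.le_pickSup hH _ (t k).2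
        have h2 : locVar H t / 2 - e ≤ w * √(w ^ 2 + locVar H t) - w ^ 2 := by
          refine le_trans ?_ (le_mul_sqrt_add hw (locVar_nonneg t))
          have : locVar H t ^ 2 ≤ K ^ 2 := pow_le_pow_left₀ (locVar_nonneg t) (locVar_le hH t) 2
          have := div_le_div_of_nonneg_right this (by positivity : 0 ≤ 8 * w ^ 2)
          linarith
        show w - (∑ k, pickSup H B lam (p.1 k) + e) / w < p.2
        have h3 : -(∑ k, pickSup H B lam (p.1 k) + e) < w * (p.2 - w) := by linarith
        rw [sub_lt_iff_lt_add, ← sub_lt_iff_lt_add', lt_div_iff₀ hw]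
        linarith
    _ = ∫ ω, stdNormalTail (w - (∑ k, pickSup H B lam (ω k) + e) / w) ∂(Measure.pi fun _ : κ => μ) :=
        prod_real_lt hm w
    _ ≤ ∫ ω, millsTail w * exp e * exp (∑ k, pickSup H B lam (ω k)) ∂(Measure.pi fun _ : κ => μ) := by
        refine integral_mono_of_nonneg (ae_of_all _ fun _ => stdNormalTail_nonneg _)
          ((hB.integrable_exp_sum_pickSup hi).const_mul _) (ae_of_all _ fun ω => ?_)
        refine (stdNormalTail_le hw _).trans_eq ?_
        rw [exp_add]; ring
    _ = _ := by rw [integral_const_mul, hB.integral_exp_sum_pickSup]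

lemma eventually_le_locProb (hB : FBM μ H B) (hH : 0 < H) (hl : 0 ≤ lam)
    (hi : Integrable (fun ω => exp (pickSup H B lam ω)) μ) {c : ℝ}
    (hc : c < pickMean μ H B lam ^ Fintype.card κ) :
    ∀ᶠ w in atTop, millsTail w * c ≤ locProb μ H B κ lam w := by
  have := hB.gauss.isProbabilityMeasure
  have hm := hB.measurable_sum_pickSup (κ := κ) hH hl
  have hlim : Tendsto (fun w => ∫ ω, stdNormalTail (w - (∑ k, pickSup H B lam (ω k)) / w) /
      millsTail w ∂(Measure.pi fun _ : κ => μ)) atTop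
      (nhds (∫ ω, exp (∑ k, pickSup H B lam (ω k)) ∂(Measure.pi fun _ : κ => μ))) := by
    refine tendsto_integral_filter_of_dominated_convergence _ ?_ ?_
      (hB.integrable_exp_sum_pickSup hi) (ae_of_all _ fun ω => tendsto_stdNormalTail_div _)
    · refine Eventually.of_forall fun w => Measurable.aestronglyMeasurable ?_
      exact (stdNormalTail_antitone.measurable.comp
        (measurable_const.sub (hm.div_const _))).div_const _
    · filter_upwards [eventually_gt_atTop 0] with w hw
      refine ae_of_all _ fun ω => ?_
      rw [Real.norm_eq_abs, abs_of_nonneg (div_nonneg (stdNormalTail_nonneg _) (millsTail_pos hw).le),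
        div_le_iff₀ (millsTail_pos hw), mul_comm]
      exact stdNormalTail_le hw _
  rw [hB.integral_exp_sum_pickSup] at hlim
  filter_upwards [hlim.eventually (lt_mem_nhds hc), eventually_gt_atTop 0] with w h1 hw
  refine le_trans ?_ (hB.le_locProb hH hl hw)
  rw [integral_div, lt_div_iff₀ (millsTail_pos hw)] at h1
  linarith

end FBM

lemma abs_rpow_sub_rpow_le {p x y : ℝ} (hp : 0 ≤ p) (hp1 : p ≤ 1) (hx : 0 ≤ x) (hy : 0 ≤ y) :
    |x ^ p - y ^ p| ≤ |x - y| ^ p := by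
  wlog h : y ≤ x generalizing x y
  · rw [abs_sub_comm, abs_sub_comm x y]; exact this hy hx (le_of_not_ge h)
  rw [abs_of_nonneg (sub_nonneg.2 (rpow_le_rpow hy h hp)), abs_of_nonneg (sub_nonneg.2 h)]
  have := Real.rpow_add_le_add_rpow hy (sub_nonneg.2 h) hp hp1
  rw [add_sub_cancel] at this
  linarith

namespace FBM

variable {Ω κ : Type*} [Fintype κ] [MeasurableSpace Ω] {μ : Measure Ω} {H : ℝ} {B : ℝ → Ω → ℝ}
  {lam : ℝ}

/-- Half the variance of the increments of `∑ k, √2 B(t k)`. -/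
noncomputable def locDist (H : ℝ) (t s : κ → Icc (0 : ℝ) lam) : ℝ :=
  ∑ k, |(t k : ℝ) - s k| ^ (2*H)

lemma locDist_nonneg (t s : κ → Icc (0 : ℝ) lam) : 0 ≤ locDist H t s :=
  Finset.sum_nonneg fun _ _ => rpow_nonneg (abs_nonneg _) _

lemma abs_locVar_sub_le (hH : 0 ≤ H) (hH1 : 2 * H ≤ 1) (t s : κ → Icc (0 : ℝ) lam) :
    |locVar H t - locVar H s| ≤ 2 * locDist H t s := by
  unfold locVar locDist
  rw [← Finset.sum_sub_distrib, Finset.mul_sum]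
  refine (Finset.abs_sum_le_sum_abs _ _).trans (Finset.sum_le_sum fun k _ => ?_)
  rw [← mul_sub, abs_mul, abs_two]
  have := abs_rpow_sub_rpow_le (by positivity) hH1 (t k).2.1 (s k).2.1
  linarith

lemma locField_mem {Ω : Type*} {B : ℝ → Ω → ℝ} (w : ℝ) (t : κ → Icc (0 : ℝ) lam) : locField B w t ∈
    GaussSpace.prod (GaussSpace.pi (Submodule.span ℝ (range B)) κ)
      (Submodule.span ℝ {(id : ℝ → ℝ)}) := by
  refine GaussSpace.mem_prod (f := fun ω : κ → Ω => ∑ k, √2 * B (t k) (ω k))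
    (g := fun z : ℝ => w * z) ?_ ?_
  · exact GaussSpace.mem_pi (f := fun k ω => √2 * B (t k) ω)
      fun k => Submodule.smul_mem _ (√2) (mem (t k))
  · exact Submodule.mem_span_singleton.2 ⟨w, by ext; simp⟩

lemma gaussSpace_locField (hB : FBM μ H B) :
    GaussSpace ((Measure.pi fun _ : κ => μ).prod (gaussianReal 0 1))
      (GaussSpace.prod (GaussSpace.pi (Submodule.span ℝ (range B)) κ)
      (Submodule.span ℝ {(id : ℝ → ℝ)})) :=
  hB.gauss.gaussSpace_pi.gaussSpace_prod gaussSpace_id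

lemma continuous_locField (hB : FBM μ H B) (w : ℝ) (p : (κ → Ω) × ℝ) :
    Continuous fun t : κ → Icc (0 : ℝ) lam => locField B w t p := by
  unfold locField
  refine (continuous_finsetSum _ fun k _ => continuous_const.mul ?_).add continuous_const
  exact (hB.cont _).comp (continuous_subtype_val.comp (continuous_apply k))

lemma cov_locField (hB : FBM μ H B) (w : ℝ) (t s : κ → Icc (0 : ℝ) lam) :
    ∫ p, locField B w t p * locField B w s p
      ∂((Measure.pi fun _ : κ => μ).prod (gaussianReal 0 1)) =
    w ^ 2 + (locVar H t + locVar H s) / 2 - locDist H t s := by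
  have hm : ∀ t : κ → Icc (0 : ℝ) lam, ∀ k, (fun ω => √2 * B (t k) ω) ∈
      Submodule.span ℝ (range B) := fun t k => Submodule.smul_mem _ (√2) (mem (t k))
  have hz : (fun z : ℝ => w * z) ∈ Submodule.span ℝ {(id : ℝ → ℝ)} :=
    Submodule.mem_span_singleton.2 ⟨w, by ext; simp⟩
  unfold locField
  rw [integral_prod_mul_cross hB.gauss.gaussSpace_pi gaussSpace_id
    (f := fun ω : κ → Ω => ∑ k, √2 * B (t k) (ω k))
    (f' := fun ω : κ → Ω => ∑ k, √2 * B (s k) (ω k))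
    (g := fun z : ℝ => w * z) (g' := fun z : ℝ => w * z)
    (GaussSpace.mem_pi (hm t)) (GaussSpace.mem_pi (hm s)) hz hz,
    GaussSpace.integral_sum_mul_sum hB.gauss (hm t) (hm s)]
  have e1 : ∫ z : ℝ, w * z * (w * z) ∂(gaussianReal 0 1) = w ^ 2 := by
    have : (fun z : ℝ => w * z * (w * z)) = fun z => w ^ 2 * (z * z) := by ext; ring
    rw [this, integral_const_mul, integral_id_mul_id, mul_one]
  have e2 : ∀ k, ∫ ω, √2 * B (t k) ω * (√2 * B (s k) ω) ∂μ =
      (t k : ℝ) ^ (2*H) + (s k : ℝ) ^ (2*H) - |(t k : ℝ) - s k| ^ (2*H) := by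
    intro k
    have : (fun ω => √2 * B (t k) ω * (√2 * B (s k) ω)) = fun ω => 2 * (B (t k) ω * B (s k) ω) := by
      ext ω
      have := Real.mul_self_sqrt (zero_le_two (α := ℝ))
      linear_combination (B (t k) ω * B (s k) ω) * this
    rw [this, integral_const_mul, hB.cov _ _ (t k).2.1 (s k).2.1]
    ring
  rw [e1]
  simp only [e2]
  rw [Finset.sum_sub_distrib, Finset.sum_add_distrib, locVar, locVar, locDist, ← Finset.mul_sum,
    ← Finset.mul_sum]
  ring

lemma cov_locField_self (hB : FBM μ H B) (hH : 0 < H) (w : ℝ) (t : κ → Icc (0 : ℝ) lam) :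
    ∫ p, locField B w t p * locField B w t p
      ∂((Measure.pi fun _ : κ => μ).prod (gaussianReal 0 1)) = √(w ^ 2 + locVar H t) ^ 2 := by
  have : locDist H t t = 0 := by
    simp [locDist, zero_rpow (by positivity : 2 * H ≠ 0)]
  rw [hB.cov_locField, this, Real.sq_sqrt (add_nonneg (sq_nonneg _) (locVar_nonneg t))]
  ring

lemma cov_locField_le (hB : FBM μ H B) (hH : 0 < H) (hH1 : 2 * H ≤ 1) {w c : ℝ} (hw : 0 < w)
    (hc0 : 0 ≤ c)
    (hc : c * (w ^ 2 + 2 * Fintype.card κ * lam ^ (2*H)) ≤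
      1 - 2 * Fintype.card κ * lam ^ (2*H) / (4 * w ^ 2)) (t s : κ → Icc (0 : ℝ) lam) :
    ∫ p, locField B w t p * locField B w s p
      ∂((Measure.pi fun _ : κ => μ).prod (gaussianReal 0 1)) ≤
    (1 - c * locDist H t s) * (√(w ^ 2 + locVar H t) * √(w ^ 2 + locVar H s)) := by
  rw [hB.cov_locField]
  set K := 2 * Fintype.card κ * lam ^ (2*H)
  have ht := locVar_nonneg (H := H) t
  have hs := locVar_nonneg (H := H) s
  have htK : locVar H t ≤ K := locVar_le hH t
  have hsK : locVar H s ≤ K := locVar_le hH s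
  have hD := abs_locVar_sub_le hH.le hH1 t s
  have hD0 := locDist_nonneg (H := H) t s
  have h1 := Real.sq_sqrt (add_nonneg (sq_nonneg w) ht)
  have h2 := Real.sq_sqrt (add_nonneg (sq_nonneg w) hs)
  have h3 := abs_sqrt_sub_sqrt_le hw ht hs
  have h4 : |locVar H t - locVar H s| ≤ K := abs_sub_le_of_nonneg_of_le ht htK hs hsK
  set a := √(w ^ 2 + locVar H t)
  set b := √(w ^ 2 + locVar H s)
  set D := locDist H t s
  have ha : 0 ≤ a := sqrt_nonneg _
  have hb : 0 ≤ b := sqrt_nonneg _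
  have h5 : (a - b) ^ 2 ≤ 2 * D * K / (4 * w ^ 2) := by
    rw [← sq_abs]
    refine (pow_le_pow_left₀ (abs_nonneg _) h3 2).trans ?_
    rw [div_pow, (by ring : (2 * w) ^ 2 = 4 * w ^ 2)]
    refine div_le_div_of_nonneg_right ?_ (by positivity)
    rw [sq]
    exact mul_le_mul hD h4 (abs_nonneg _) (by positivity)
  have h6 : a * b ≤ w ^ 2 + K := by nlinarith [sq_nonneg (a - b)]
  have h7 : c * (a * b) ≤ 1 - K / (4 * w ^ 2) := (mul_le_mul_of_nonneg_left h6 hc0).trans hc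
  have h8 := mul_le_mul_of_nonneg_right h7 hD0
  have h9 : 2 * D * K / (4 * w ^ 2) = 2 * (K / (4 * w ^ 2) * D) := by ring
  nlinarith

lemma le_cov_locField (hB : FBM μ H B) {w c : ℝ} (hw : 0 < w)
    (hc : 1 ≤ c * w ^ 2) (t s : κ → Icc (0 : ℝ) lam) :
    (1 - c * locDist H t s) * (√(w ^ 2 + locVar H t) * √(w ^ 2 + locVar H s)) ≤
    ∫ p, locField B w t p * locField B w s p
      ∂((Measure.pi fun _ : κ => μ).prod (gaussianReal 0 1)) := by
  rw [hB.cov_locField]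
  have ht := locVar_nonneg (H := H) t
  have hs := locVar_nonneg (H := H) s
  have hD0 := locDist_nonneg (H := H) t s
  have h1 := Real.sq_sqrt (add_nonneg (sq_nonneg w) ht)
  have h2 := Real.sq_sqrt (add_nonneg (sq_nonneg w) hs)
  have h3 : w ≤ √(w ^ 2 + locVar H t) := Real.le_sqrt_of_sq_le (by linarith)
  have h4 : w ≤ √(w ^ 2 + locVar H s) := Real.le_sqrt_of_sq_le (by linarith)
  set a := √(w ^ 2 + locVar H t)
  set b := √(w ^ 2 + locVar H s)
  set D := locDist H t s
  have h5 : w ^ 2 ≤ a * b := by rw [sq]; exact mul_le_mul h3 h4 hw.le (hw.le.trans h3)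
  have h6 : 1 ≤ c * (a * b) := by
    have : 0 ≤ c := by
      by_contra h
      nlinarith [mul_pos (neg_pos.2 (lt_of_not_ge h)) (sq_pos_of_pos hw)]
    exact hc.trans (mul_le_mul_of_nonneg_left h5 this)
  nlinarith [sq_nonneg (a - b), mul_le_mul_of_nonneg_right h6 hD0]

/-- A field whose correlations exceed those of `locField` has fewer excursions. -/
lemma measureReal_le_locProb (hB : FBM μ H B) (hH : 0 < H) (hH1 : 2 * H ≤ 1) {w c : ℝ} (hw : 0 < w)
    (hc0 : 0 ≤ c)
    (hc : c * (w ^ 2 + 2 * Fintype.card κ * lam ^ (2*H)) ≤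
      1 - 2 * Fintype.card κ * lam ^ (2*H) / (4 * w ^ 2))
    {Ω' : Type*} [MeasurableSpace Ω'] {P : Measure Ω'} {V : Submodule ℝ (Ω' → ℝ)}
    (hV : GaussSpace P V) {X : (κ → Icc (0 : ℝ) lam) → Ω' → ℝ} (hX : ∀ t, X t ∈ V)
    (hXc : ∀ ω, Continuous fun t => X t ω) {σ : (κ → Icc (0 : ℝ) lam) → ℝ} (hσ : ∀ t, 0 < σ t)
    (hσc : Continuous σ) (hv : ∀ t, ∫ ω, X t ω * X t ω ∂P = σ t ^ 2)
    (hcov : ∀ t s, (1 - c * locDist H t s) * (σ t * σ s) ≤ ∫ ω, X t ω * X s ω ∂P) :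
    P.real {ω | ∃ t, σ t * w < X t ω} ≤ locProb μ H B κ lam w := by
  have hpos : ∀ t : κ → Icc (0 : ℝ) lam, 0 < w ^ 2 + locVar H t := fun t =>
    add_pos_of_pos_of_nonneg (sq_pos_of_pos hw) (locVar_nonneg t)
  have hτc : Continuous fun t : κ → Icc (0 : ℝ) lam => √(w ^ 2 + locVar H t) :=
    (continuous_const.add (continuous_locVar hH)).sqrt
  refine slepian_normalized hV hB.gaussSpace_locField hX (locField_mem w) hXc
    (hB.continuous_locField w) hσ (fun t => Real.sqrt_pos.2 (hpos t)) hσc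
    hτc hv (hB.cov_locField_self hH w)
    (fun t s => ?_) continuous_const
  · have h1 := mul_le_mul_of_nonneg_right (hB.cov_locField_le hH hH1 hw hc0 hc t s)
      (mul_pos (hσ t) (hσ s)).le
    have h2 := mul_le_mul_of_nonneg_right (hcov t s)
      (mul_nonneg (sqrt_nonneg (w ^ 2 + locVar H t)) (sqrt_nonneg (w ^ 2 + locVar H s)))
    linarith

/-- A field whose correlations are below those of `locField` has more excursions. -/
lemma locProb_le_measureReal (hB : FBM μ H B) (hH : 0 < H) {w c : ℝ} (hw : 0 < w)
    (hc : 1 ≤ c * w ^ 2)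
    {Ω' : Type*} [MeasurableSpace Ω'] {P : Measure Ω'} {V : Submodule ℝ (Ω' → ℝ)}
    (hV : GaussSpace P V) {X : (κ → Icc (0 : ℝ) lam) → Ω' → ℝ} (hX : ∀ t, X t ∈ V)
    (hXc : ∀ ω, Continuous fun t => X t ω) {σ : (κ → Icc (0 : ℝ) lam) → ℝ} (hσ : ∀ t, 0 < σ t)
    (hσc : Continuous σ) (hv : ∀ t, ∫ ω, X t ω * X t ω ∂P = σ t ^ 2)
    (hcov : ∀ t s, ∫ ω, X t ω * X s ω ∂P ≤ (1 - c * locDist H t s) * (σ t * σ s)) :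
    locProb μ H B κ lam w ≤ P.real {ω | ∃ t, σ t * w < X t ω} := by
  have hpos : ∀ t : κ → Icc (0 : ℝ) lam, 0 < w ^ 2 + locVar H t := fun t =>
    add_pos_of_pos_of_nonneg (sq_pos_of_pos hw) (locVar_nonneg t)
  have hτc : Continuous fun t : κ → Icc (0 : ℝ) lam => √(w ^ 2 + locVar H t) :=
    (continuous_const.add (continuous_locVar hH)).sqrt
  refine slepian_normalized hB.gaussSpace_locField hV (locField_mem w) hX
    (hB.continuous_locField w) hXc (fun t => Real.sqrt_pos.2 (hpos t)) hσ
    hτc hσc (hB.cov_locField_self hH w) hv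
    (fun t s => ?_) continuous_const
  · have h1 := mul_le_mul_of_nonneg_right (hB.le_cov_locField hw hc t s)
      (mul_pos (hσ t) (hσ s)).le
    have h2 := mul_le_mul_of_nonneg_right (hcov t s)
      (mul_nonneg (sqrt_nonneg (w ^ 2 + locVar H t)) (sqrt_nonneg (w ^ 2 + locVar H s)))
    linarith

end FBM

namespace FBM

variable {Ω : Type*} [MeasurableSpace Ω] {μ : Measure Ω} {H : ℝ} {B : ℝ → Ω → ℝ}

lemma eventually_pickMean_le (hH : 0 < H) {HH : ℝ}
    (hPick : Tendsto (fun lam : ℝ => lam⁻¹ * pickMean μ H B lam) atTop (nhds HH)) :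
    ∀ᶠ v : ℝ in atTop, pickMean μ H B (v ^ (1/H)) ≤ exp (v ^ 2) := by
  have h1 : ∀ᶠ l in atTop, pickMean μ H B l ≤ (HH + 1) * l := by
    filter_upwards [hPick.eventually (gt_mem_nhds (lt_add_one HH)), eventually_gt_atTop 0] with l h hl
    rw [inv_mul_lt_iff₀ hl] at h
    linarith
  have h2 : Tendsto (fun v : ℝ => v ^ (1/H)) atTop atTop := tendsto_rpow_atTop (by positivity)
  have h3 := ((tendsto_rpow_mul_exp_neg_mul_atTop_nhds_zero (1/(2*H)) 1 one_pos).comp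
    (tendsto_pow_atTop (two_ne_zero (α := ℕ)))).const_mul (HH + 1)
  rw [mul_zero] at h3
  filter_upwards [h2.eventually h1, h3.eventually (gt_mem_nhds one_pos), eventually_gt_atTop 0]
    with v h4 h5 hv
  refine h4.trans ?_
  simp only [Function.comp] at h5
  have e : (v ^ 2) ^ (1 / (2 * H)) = v ^ (1/H) := by
    rw [← rpow_natCast, ← rpow_mul hv.le]; congr 1; field_simp; norm_num
  rw [e, ← mul_assoc, neg_one_mul, exp_neg, ← div_eq_mul_inv, div_lt_one (exp_pos _)] at h5
  exact h5.le

lemma eventually_sup_le (hB : FBM μ H B) (hH : 0 < H) {HH : ℝ} (hHH : 0 < HH)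
    (hPick : Tendsto (fun lam : ℝ => lam⁻¹ * pickMean μ H B lam) atTop (nhds HH))
    (M : ℝ) (hM : 0 < M) :
    ∃ h > 0, ∀ᶠ v : ℝ in atTop, ∀ e : ℝ, e ^ 2 = 1 → ∀ c : ℝ, 0 ≤ c →
      μ.real {ω | ∃ t : Icc (0:ℝ) h, v < e * (B (c + t) ω - B c ω)} ≤ exp (-(M * v ^ 2)) := by
  have := hB.gauss.isProbabilityMeasure
  set g := √2 / (M + 2)
  have hg : 0 < g := by positivity
  have hgM : √2 / g = M + 2 := by simp only [g]; field_simp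
  set h := g ^ (1/H)
  have hh : 0 < h := by positivity
  have hhH : h ^ H = g := by rw [← rpow_mul hg.le, one_div_mul_cancel hH.ne', rpow_one]
  refine ⟨h, hh, ?_⟩
  filter_upwards [eventually_pickMean_le hH hPick, eventually_gt_atTop 0] with v hv1 hv e he c hc
  set l := v ^ (1/H) with hl
  have hl0 : 0 < l := by positivity
  have hlH : l ^ H = v := by rw [← rpow_mul hv.le, one_div_mul_cancel hH.ne', rpow_one]
  set r := l / h
  have hr : 0 < r := by positivity
  have hrH : r ^ H = v / g := by rw [div_rpow hl0.le hh.le, hlH, hhH]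
  have hα : 0 < 2 * H := by positivity
  have hcovY : ∀ t s : Icc (0:ℝ) h, ∫ ω, (r ^ H)⁻¹ * B (r * t) ω * ((r ^ H)⁻¹ * B (r * s) ω) ∂μ =
      ((t:ℝ) ^ (2*H) + (s:ℝ) ^ (2*H) - |(t:ℝ) - s| ^ (2*H)) / 2 := by
    intro t s
    have e1 : (fun ω => (r ^ H)⁻¹ * B (r * t) ω * ((r ^ H)⁻¹ * B (r * s) ω)) =
      fun ω => ((r ^ H)⁻¹ * (r ^ H)⁻¹) * (B (r * t) ω * B (r * s) ω) := by ext; ring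
    rw [e1, integral_const_mul, hB.cov _ _ (mul_nonneg hr.le t.2.1) (mul_nonneg hr.le s.2.1),
      ← mul_sub, abs_mul, abs_of_pos hr, mul_rpow hr.le t.2.1, mul_rpow hr.le s.2.1,
      mul_rpow hr.le (abs_nonneg _), two_mul, rpow_add hr, ← two_mul]
    field_simp
  have hcovX : ∀ t s : Icc (0:ℝ) h, ∫ ω, e * (B (c + t) ω - B c ω) * (e * (B (c + s) ω - B c ω)) ∂μ =
      ((t:ℝ) ^ (2*H) + (s:ℝ) ^ (2*H) - |(t:ℝ) - s| ^ (2*H)) / 2 := by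
    intro t s
    have e1 : (fun ω => e * (B (c + t) ω - B c ω) * (e * (B (c + s) ω - B c ω))) =
      fun ω => (B (c + t) ω - B c ω) * (B (c + s) ω - B c ω) := by
        ext ω; linear_combination ((B (c + t) ω - B c ω) * (B (c + s) ω - B c ω)) * he
    rw [e1, hB.cov_increments hc (add_nonneg hc t.2.1) hc (add_nonneg hc s.2.1)]
    rw [add_sub_cancel_left, sub_add_cancel_left, abs_neg, abs_of_nonneg t.2.1, abs_of_nonneg s.2.1,
      add_sub_add_left_eq_sub, sub_self, abs_zero, zero_rpow hα.ne']
    ring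
  have hsl := slepian hB.gauss hB.gauss (X := fun (t : Icc (0:ℝ) h) ω => e * (B (c + t) ω - B c ω))
    (Y := fun t ω => (r ^ H)⁻¹ * B (r * t) ω)
    (fun t => Submodule.smul_mem _ e (sub_mem c (c + t)))
    (fun t => Submodule.smul_mem _ (r ^ H)⁻¹ (mem _))
    (fun ω => by have := hB.cont ω; fun_prop) (fun ω => by have := hB.cont ω; fun_prop)
    (fun t => by rw [hcovX, hcovY]) (fun t s => by rw [hcovX, hcovY])
    (continuous_const (y := v))
  refine hsl.trans ?_
  have hsub : {ω | ∃ t : Icc (0:ℝ) h, v < (r ^ H)⁻¹ * B (r * t) ω} ⊆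
      {ω | exp ((M + 1) * v ^ 2) ≤ exp (pickSup H B l ω)} := by
    rintro ω ⟨t, ht⟩
    have hrt : r * t ≤ l := by
      calc r * t ≤ r * h := mul_le_mul_of_nonneg_left t.2.2 hr.le
        _ = l := div_mul_cancel₀ _ hh.ne'
    have h1 := hB.le_pickSup hH ω (⟨mul_nonneg hr.le t.2.1, hrt⟩ : r * t ∈ Icc 0 l)
    have h2 : (r * t) ^ (2*H) ≤ v ^ 2 := by
      refine (rpow_le_rpow (mul_nonneg hr.le t.2.1) hrt hα.le).trans_eq ?_
      rw [mul_comm, rpow_mul hl0.le, hlH]; norm_num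
    rw [lt_inv_mul_iff₀ (by positivity), hrH] at ht
    have h3 : (M + 2) * v ^ 2 ≤ √2 * B (r * t) ω := by
      rw [← hgM]
      have := mul_le_mul_of_nonneg_left ht.le (sqrt_nonneg 2)
      refine le_trans (le_of_eq ?_) this
      ring
    exact exp_le_exp.2 (by linarith)
  refine (measureReal_mono hsub).trans ?_
  have hmk := mul_meas_ge_le_integral_of_nonneg (ae_of_all _ fun ω => (exp_pos (pickSup H B l ω)).le)
    (hB.integrable_exp_pickSup hH hHH hPick hl0.le) (exp ((M + 1) * v ^ 2))
  rw [mul_comm, ← le_div_iff₀ (exp_pos _)] at hmk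
  refine hmk.trans ?_
  rw [div_le_iff₀ (exp_pos _), ← exp_add]
  refine hv1.trans (exp_le_exp.2 (by linarith))

end FBM

lemma rpow_add_rpow_le_of_le {p x y d : ℝ} (hp : 0 ≤ p) (hp1 : p ≤ 1) (hx : 0 ≤ x) (hxy : x ≤ y)
    (hd : 0 ≤ d) : x ^ p + (y + d) ^ p ≤ (x + d) ^ p + y ^ p := by
  rcases hxy.eq_or_lt with rfl | h
  · linarith
  have hL : 0 < y + d - x := by linarith
  have hc := Real.concaveOn_rpow hp hp1
  have hyd : y + d ∈ Ici (0:ℝ) := mem_Ici.2 (by linarith)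
  have hf := @hc.2 x (mem_Ici.2 hx) (y + d)
  have h1 := hf hyd (a := (y - x) / (y + d - x)) (b := d / (y + d - x))
    (div_nonneg (by linarith) hL.le) (div_nonneg hd hL.le) (by field_simp; ring)
  have h2 := hf hyd (a := d / (y + d - x)) (b := (y - x) / (y + d - x))
    (div_nonneg hd hL.le) (div_nonneg (by linarith) hL.le) (by field_simp; ring)
  simp only [smul_eq_mul] at h1 h2
  have e1 : (y - x) / (y + d - x) * x + d / (y + d - x) * (y + d) = x + d := by field_simp; ring
  have e2 : d / (y + d - x) * x + (y - x) / (y + d - x) * (y + d) = y := by field_simp; ring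
  rw [e1] at h1
  rw [e2] at h2
  have e3 : d / (y + d - x) = 1 - (y - x) / (y + d - x) := by field_simp; ring
  rw [e3] at h1 h2
  linarith

lemma rpow_add_sub_le {p x d : ℝ} (hp : 0 ≤ p) (hp1 : p ≤ 1) (hx : 0 < x) (hd : 0 ≤ d) :
    (x + d) ^ p - x ^ p ≤ p * x ^ (p - 1) * d := by
  have h := _root_.rpow_one_add_le_one_add_mul_self (s := d / x) (p := p)
    (by have := div_nonneg hd hx.le; linarith) hp hp1
  have e : (x + d) ^ p = x ^ p * (1 + d / x) ^ p := by
    rw [← mul_rpow hx.le (by positivity)]; congr 1; field_simp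
  rw [e, rpow_sub hx, rpow_one]
  have := mul_le_mul_of_nonneg_left h (rpow_nonneg hx.le p)
  calc _ ≤ x ^ p * (1 + p * (d / x)) - x ^ p := by linarith
    _ = _ := by field_simp; ring

lemma abs_rpow_sub_rpow_le_mul {p x y : ℝ} (hp : 0 ≤ p) (hp1 : p ≤ 1 / 2) (hx : 1 / 4 ≤ x)
    (hy : 1 / 4 ≤ y) : |x ^ p - y ^ p| ≤ 2 * |x - y| := by
  wlog h : y ≤ x generalizing x y
  · rw [abs_sub_comm, abs_sub_comm x y]; exact this hy hx (le_of_not_ge h)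
  have hy0 : 0 < y := by linarith
  rw [abs_of_nonneg (sub_nonneg.2 (rpow_le_rpow hy0.le h hp)), abs_of_nonneg (sub_nonneg.2 h)]
  have h1 := rpow_add_sub_le hp (by linarith) hy0 (sub_nonneg.2 h)
  rw [add_sub_cancel] at h1
  refine h1.trans (mul_le_mul_of_nonneg_right ?_ (sub_nonneg.2 h))
  have h2 : y ^ (p - 1) ≤ (1/4 : ℝ) ^ (p - 1) :=
    rpow_le_rpow_of_nonpos (by norm_num) hy (by linarith)
  have h3 : (1/4 : ℝ) ^ (p - 1) ≤ (1/4 : ℝ) ^ (-1 : ℝ) :=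
    rpow_le_rpow_of_exponent_ge (by norm_num) (by norm_num) (by linarith)
  rw [rpow_neg_one] at h3
  have h4 : 0 ≤ y ^ (p - 1) := rpow_nonneg hy0.le _
  norm_num at h3
  nlinarith

lemma mul_rpow_eq_rpow_two_mul {x H : ℝ} (hx : 0 ≤ x) : x ^ H * x ^ H = x ^ (2 * H) := by
  rw [two_mul, ← sq, ← rpow_natCast, ← rpow_mul hx]; congr 1; push_cast; ring

lemma sq_le_mul_rpow {x d p : ℝ} (hp1 : p ≤ 1) (hx : |x| ≤ d) (hd : d ≤ 1) :
    x ^ 2 ≤ d * |x| ^ p := by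
  rcases (abs_nonneg x).eq_or_lt with h | h
  · have := abs_eq_zero.1 h.symm
    subst this
    simp only [abs_zero] at hx
    have := mul_nonneg hx (rpow_nonneg (le_refl (0:ℝ)) p)
    simpa using this
  · rw [← sq_abs, sq]
    refine mul_le_mul hx ?_ h.le (h.le.trans hx)
    calc |x| = |x| ^ (1:ℝ) := (rpow_one _).symm
      _ ≤ _ := rpow_le_rpow_of_exponent_ge h (hx.trans hd) hp1

lemma min_le_mul_rpow {H x y : ℝ} (hH : 0 ≤ H) (hx : 0 ≤ x) (hy : 0 ≤ y) :
    min x y ^ (2 * H) ≤ x ^ H * y ^ H := by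
  rw [← mul_rpow_eq_rpow_two_mul (le_min hx hy)]
  exact mul_le_mul (rpow_le_rpow (le_min hx hy) (min_le_left _ _) hH)
    (rpow_le_rpow (le_min hx hy) (min_le_right _ _) hH) (rpow_nonneg (le_min hx hy) _)
    (rpow_nonneg hx _)

/-- Covariance of the increments of a fractional Brownian motion over `[a, b]` and `[c, d]`. -/
noncomputable def incCov (H a b c d : ℝ) : ℝ :=
  (|b - c| ^ (2*H) + |a - d| ^ (2*H) - |b - d| ^ (2*H) - |a - c| ^ (2*H)) / 2

lemma incCov_comm (H a b c d : ℝ) : incCov H a b c d = incCov H c d a b := by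
  unfold incCov
  rw [abs_sub_comm b c, abs_sub_comm a d, abs_sub_comm b d, abs_sub_comm a c]; ring

lemma incCov_self {H a b : ℝ} (hH : 0 < H) (hab : a ≤ b) : incCov H a b a b = ((b - a) ^ H) ^ 2 := by
  unfold incCov
  rw [sq, mul_rpow_eq_rpow_two_mul (sub_nonneg.2 hab), abs_sub_comm a b,
    abs_of_nonneg (sub_nonneg.2 hab), sub_self, sub_self, abs_zero, zero_rpow (by positivity)]
  ring

/-- The local squared distance of increments over `[a, b]` and `[c, d]`. -/
noncomputable def incDist (H a b c d : ℝ) : ℝ := |a - c| ^ (2*H) + |b - d| ^ (2*H)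

lemma incDist_nonneg (H a b c d : ℝ) : 0 ≤ incDist H a b c d :=
  add_nonneg (rpow_nonneg (abs_nonneg _) _) (rpow_nonneg (abs_nonneg _) _)

lemma incDist_comm (H a b c d : ℝ) : incDist H a b c d = incDist H c d a b := by
  unfold incDist; rw [abs_sub_comm a c, abs_sub_comm b d]

section
variable {H a b c d : ℝ}

/-- Increments over disjoint intervals are negatively correlated. -/
lemma incCov_nonpos_of_le (hH : 0 ≤ H) (hH1 : H ≤ 1/2) (hab : a ≤ b) (hbc : b ≤ c) (hcd : c ≤ d) :
    incCov H a b c d ≤ 0 := by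
  unfold incCov
  rw [abs_of_nonpos (by linarith : b - c ≤ 0), abs_of_nonpos (by linarith : a - d ≤ 0),
    abs_of_nonpos (by linarith : b - d ≤ 0), abs_of_nonpos (by linarith : a - c ≤ 0)]
  have := rpow_add_rpow_le_of_le (p := 2 * H) (x := c - b) (y := c - a) (d := d - c) (by linarith)
    (by linarith) (by linarith) (by linarith) (by linarith)
  have e1 : -(b - c) = c - b := by ring
  have e2 : -(a - d) = c - a + (d - c) := by ring
  have e3 : -(b - d) = c - b + (d - c) := by ring
  have e4 : -(a - c) = c - a := by ring
  rw [e1, e2, e3, e4]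
  linarith

/-- Increments over intervals separated by a gap are almost uncorrelated. -/
lemma neg_le_incCov_of_gap {g : ℝ} (hH : 0 < H) (hH1 : H ≤ 1/2) (hab : a ≤ b) (hg : 0 < g)
    (hbc : b + g ≤ c) (hcd : c ≤ d) (h1 : b - a ≤ 1) :
    -(H * g ^ (2 * H - 1) * ((b - a) ^ H * (d - c) ^ H)) ≤ incCov H a b c d := by
  set m := min (b - a) (d - c)
  have hm0 : 0 ≤ m := le_min (by linarith) (by linarith)
  have hm1 : m ≤ 1 := (min_le_left _ _).trans h1
  have hm : m ≤ (b - a) ^ H * (d - c) ^ H := by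
    refine le_trans ?_ (min_le_mul_rpow hH.le (by linarith) (by linarith))
    rcases hm0.eq_or_lt with h | h
    · rw [← h]; exact rpow_nonneg hm0 _
    · calc m = m ^ (1:ℝ) := (rpow_one _).symm
        _ ≤ _ := rpow_le_rpow_of_exponent_ge h hm1 (by linarith)
  have key : (c - b + m) ^ (2*H) - (c - b) ^ (2*H) ≤ 2 * (H * g ^ (2 * H - 1) * m) := by
    refine (rpow_add_sub_le (by linarith) (by linarith) (by linarith) hm0).trans ?_
    have : (c - b) ^ (2 * H - 1) ≤ g ^ (2 * H - 1) :=
      rpow_le_rpow_of_nonpos hg (by linarith) (by linarith)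
    have := mul_le_mul_of_nonneg_left this (mul_nonneg hH.le hm0)
    linarith
  have hk2 := mul_le_mul_of_nonneg_left hm (mul_nonneg hH.le (rpow_nonneg hg.le (2 * H - 1)))
  unfold incCov
  rw [abs_of_nonpos (by linarith : b - c ≤ 0), abs_of_nonpos (by linarith : a - d ≤ 0),
    abs_of_nonpos (by linarith : b - d ≤ 0), abs_of_nonpos (by linarith : a - c ≤ 0)]
  have e1 : -(b - c) = c - b := by ring
  rw [e1]
  rcases min_choice (b - a) (d - c) with h | h
  · have h3 : (-(b - d)) ^ (2*H) ≤ (-(a - d)) ^ (2*H) :=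
      rpow_le_rpow (by linarith) (by linarith) (by linarith)
    have e : -(a - c) = c - b + m := by simp only [m]; rw [h]; ring
    rw [e]
    linarith
  · have h3 : (-(a - c)) ^ (2*H) ≤ (-(a - d)) ^ (2*H) :=
      rpow_le_rpow (by linarith) (by linarith) (by linarith)
    have e : -(b - d) = c - b + m := by simp only [m]; rw [h]; ring
    rw [e]
    linarith

lemma neg_le_incCov (hH : 0 ≤ H) (hH1 : H ≤ 1/2) (hab : a ≤ b) (hcd : c ≤ d) :
    -((b - a) ^ H * (d - c) ^ H / 2) ≤ incCov H a b c d := by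
  wlog hac : a ≤ c generalizing a b c d
  · rw [incCov_comm, mul_comm]; exact this hcd hab (le_of_not_ge hac)
  have hp : 0 ≤ 2 * H := by linarith
  have hmin := min_le_mul_rpow (H := H) hH (sub_nonneg.2 hab) (sub_nonneg.2 hcd)
  have hpos : 0 ≤ (b - a) ^ H * (d - c) ^ H :=
    mul_nonneg (rpow_nonneg (by linarith) _) (rpow_nonneg (by linarith) _)
  unfold incCov
  rw [abs_of_nonpos (by linarith : a - d ≤ 0), abs_of_nonpos (by linarith : a - c ≤ 0)]
  rcases le_total b d with hbd | hbd
  · rw [abs_of_nonpos (by linarith : b - d ≤ 0)]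
    rcases min_choice (b - a) (d - c) with h | h
    · -- `[a, b]` is the shorter interval
      have h1 : (-(b - d)) ^ (2*H) ≤ (-(a - d)) ^ (2*H) :=
        rpow_le_rpow (by linarith) (by linarith) hp
      have h2 : (-(a - c)) ^ (2*H) ≤ |b - c| ^ (2*H) + (b - a) ^ (2*H) := by
        rcases le_total b c with hbc | hbc
        · rw [abs_of_nonpos (by linarith : b - c ≤ 0)]
          have := Real.rpow_add_le_add_rpow (by linarith : 0 ≤ -(b - c)) (by linarith : 0 ≤ b - a)
            hp (by linarith)
          rwa [(by ring : -(b - c) + (b - a) = -(a - c))] at this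
        · have := rpow_le_rpow (by linarith) (by linarith : -(a - c) ≤ b - a) hp
          have := rpow_nonneg (abs_nonneg (b - c)) (2*H)
          linarith
      rw [h] at hmin
      linarith
    · have h1 : (-(a - c)) ^ (2*H) ≤ (-(a - d)) ^ (2*H) :=
        rpow_le_rpow (by linarith) (by linarith) hp
      have h2 : (-(b - d)) ^ (2*H) ≤ |b - c| ^ (2*H) + (d - c) ^ (2*H) := by
        rcases le_total b c with hbc | hbc
        · rw [abs_of_nonpos (by linarith : b - c ≤ 0)]
          have := Real.rpow_add_le_add_rpow (by linarith : 0 ≤ -(b - c)) (by linarith : 0 ≤ d - c)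
            hp (by linarith)
          rwa [(by ring : -(b - c) + (d - c) = -(b - d))] at this
        · have := rpow_le_rpow (by linarith) (by linarith : -(b - d) ≤ d - c) hp
          have := rpow_nonneg (abs_nonneg (b - c)) (2*H)
          linarith
      rw [h] at hmin
      linarith
  · rw [abs_of_nonneg (by linarith : 0 ≤ b - d), abs_of_nonneg (by linarith : 0 ≤ b - c)]
    have h1 : (b - d) ^ (2*H) ≤ (b - c) ^ (2*H) := rpow_le_rpow (by linarith) (by linarith) hp
    have h2 : (-(a - c)) ^ (2*H) ≤ (-(a - d)) ^ (2*H) := rpow_le_rpow (by linarith) (by linarith) hp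
    linarith

lemma abs_incCov_sub_le {δ : ℝ} (hH : 0 < H) (hH1 : H ≤ 1/2) (hab : 3/4 ≤ b - a)
    (hcd : 3/4 ≤ d - c) (hδ : δ ≤ 1/4) (hac : |a - c| ≤ δ) (hbd : |b - d| ≤ δ) :
    |2 * ((b - a) ^ H * (d - c) ^ H) - 2 * incCov H a b c d - incDist H a b c d| ≤
      10 * δ * incDist H a b c d := by
  have hac' := abs_le.1 hac
  have hbd' := abs_le.1 hbd
  have hδ0 : 0 ≤ δ := (abs_nonneg _).trans hac
  unfold incCov incDist
  rw [abs_of_nonneg (by linarith : 0 ≤ b - c), abs_sub_comm a d, abs_of_nonneg (by linarith : 0 ≤ d - a)]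
  have h1 := abs_rpow_sub_rpow_le_mul hH.le hH1 (by linarith : 1/4 ≤ b - c) (by linarith : 1/4 ≤ d - a)
  have h2 := abs_rpow_sub_rpow_le_mul hH.le hH1 (x := (b - a) * (d - c)) (y := (b - c) * (d - a))
    (by nlinarith) (by nlinarith)
  rw [mul_rpow (by linarith) (by linarith), mul_rpow (by linarith) (by linarith)] at h2
  rw [← mul_rpow_eq_rpow_two_mul (by linarith : 0 ≤ b - c),
    ← mul_rpow_eq_rpow_two_mul (by linarith : 0 ≤ d - a)]
  have h3 : a - c = a - c := rfl
  have e1 : (b - a) * (d - c) - (b - c) * (d - a) = (a - c) * (b - d) := by ring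
  have e2 : b - c - (d - a) = (a - c) + (b - d) := by ring
  rw [e1, abs_mul] at h2
  rw [e2] at h1
  have h4 := sq_le_mul_rpow (by linarith : 2 * H ≤ 1) hac (by linarith)
  have h5 := sq_le_mul_rpow (by linarith : 2 * H ≤ 1) hbd (by linarith)
  have h6 : ((b - c) ^ H - (d - a) ^ H) ^ 2 ≤ 8 * ((a - c) ^ 2 + (b - d) ^ 2) := by
    have := pow_le_pow_left₀ (abs_nonneg _) h1 2
    rw [sq_abs, mul_pow, sq_abs] at this
    nlinarith [sq_nonneg ((a - c) - (b - d))]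
  have h7 : 2 * (|a - c| * |b - d|) ≤ (a - c) ^ 2 + (b - d) ^ 2 := by
    nlinarith [sq_nonneg (|a - c| - |b - d|), sq_abs (a - c), sq_abs (b - d)]
  have h8 := abs_le.1 h2
  have h9 := sq_nonneg ((b - c) ^ H - (d - a) ^ H)
  rw [abs_le]
  constructor <;> nlinarith

end

section
variable {H a b c d δ : ℝ}

lemma mul_rpow_le_one (hH : 0 ≤ H) {x y : ℝ} (hx : 0 ≤ x) (hy : 0 ≤ y) (hx1 : x ≤ 1) (hy1 : y ≤ 1) :
    x ^ H * y ^ H ≤ 1 :=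
  mul_le_one₀ (rpow_le_one hx hx1 hH) (rpow_nonneg hy _) (rpow_le_one hy hy1 hH)

lemma sub_le_mul_rpow (hH : 0 ≤ H) (hH1 : H ≤ 1/2) {x y : ℝ} (hδ : 0 ≤ δ) (hδ1 : δ < 1)
    (hx : 1 - δ ≤ x) (hy : 1 - δ ≤ y) : 1 - δ ≤ x ^ H * y ^ H := by
  have h0 : 0 < 1 - δ := by linarith
  have h1 : (1 - δ) ^ (1/2 : ℝ) ≤ (1 - δ) ^ H :=
    rpow_le_rpow_of_exponent_ge h0 (by linarith) hH1
  have h2 : (1 - δ) ^ (1/2 : ℝ) * (1 - δ) ^ (1/2 : ℝ) = 1 - δ := by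
    rw [← rpow_add h0]; norm_num
  rw [← h2]
  exact mul_le_mul (h1.trans (rpow_le_rpow h0.le hx hH)) (h1.trans (rpow_le_rpow h0.le hy hH))
    (rpow_nonneg h0.le _) (rpow_nonneg (h0.le.trans hx) _)

lemma incCov_le_local (hH : 0 < H) (hH1 : H ≤ 1/2) (hab : 3/4 ≤ b - a) (hcd : 3/4 ≤ d - c)
    (hab1 : b - a ≤ 1) (hcd1 : d - c ≤ 1) (hδ : δ ≤ 1/10) (hac : |a - c| ≤ δ) (hbd : |b - d| ≤ δ) :
    incCov H a b c d ≤
      (1 - (1 - 10 * δ) / 2 * incDist H a b c d) * ((b - a) ^ H * (d - c) ^ H) := by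
  have h := (abs_le.1 (abs_incCov_sub_le hH hH1 hab hcd (by linarith) hac hbd)).1
  have h1 := mul_rpow_le_one hH.le (by linarith : 0 ≤ b - a) (by linarith : 0 ≤ d - c) hab1 hcd1
  have h2 := mul_nonneg (by linarith : 0 ≤ 1 - 10 * δ) (incDist_nonneg H a b c d)
  nlinarith

lemma le_incCov_local (hH : 0 < H) (hH1 : H ≤ 1/2) (hab : 1 - δ ≤ b - a) (hcd : 1 - δ ≤ d - c)
    (hδ : δ ≤ 1/4) (hac : |a - c| ≤ δ) (hbd : |b - d| ≤ δ) :
    (1 - (1 + 10 * δ) / (1 - δ) / 2 * incDist H a b c d) * ((b - a) ^ H * (d - c) ^ H) ≤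
      incCov H a b c d := by
  have hδ0 : 0 ≤ δ := (abs_nonneg _).trans hac
  have h := (abs_le.1 (abs_incCov_sub_le hH hH1 (by linarith) (by linarith) (by linarith) hac hbd)).2
  have h1 := sub_le_mul_rpow hH.le hH1 hδ0 (by linarith) hab hcd
  have h2 := mul_nonneg (by positivity : 0 ≤ 1 + 10 * δ) (incDist_nonneg H a b c d)
  have h3 : 1 ≤ (b - a) ^ H * (d - c) ^ H / (1 - δ) := by
    rwa [le_div_iff₀ (by linarith), one_mul]
  have h4 := mul_le_mul_of_nonneg_left h3 h2
  have e : (1 - (1 + 10 * δ) / (1 - δ) / 2 * incDist H a b c d) * ((b - a) ^ H * (d - c) ^ H) =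
    (b - a) ^ H * (d - c) ^ H - (1 + 10 * δ) * incDist H a b c d *
      ((b - a) ^ H * (d - c) ^ H / (1 - δ)) / 2 := by ring
  rw [e]
  linarith

lemma incCov_le_global (hH : 0 < H) (hH1 : H ≤ 1/2) (hδ : δ ≤ 1/20) (hab : 1 - δ ≤ b - a)
    (hcd : 1 - δ ≤ d - c) (hab1 : b - a ≤ 1) (hcd1 : d - c ≤ 1) :
    incCov H a b c d ≤ max 0 (1 - incDist H a b c d / 4) * ((b - a) ^ H * (d - c) ^ H) := by
  wlog hac : a ≤ c generalizing a b c d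
  · rw [incCov_comm, incDist_comm, mul_comm (_ ^ H)]; exact this hcd hab hcd1 hab1 (le_of_not_ge hac)
  have hpos : 0 ≤ (b - a) ^ H * (d - c) ^ H :=
    mul_nonneg (rpow_nonneg (by linarith) _) (rpow_nonneg (by linarith) _)
  have h1 := mul_rpow_le_one hH.le (by linarith : 0 ≤ b - a) (by linarith : 0 ≤ d - c) hab1 hcd1
  have hδ0 : 0 ≤ δ := by linarith
  have hD := incDist_nonneg H a b c d
  rcases le_total b c with hbc | hbc
  · exact (incCov_nonpos_of_le hH.le hH1 (by linarith) hbc (by linarith)).trans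
      (mul_nonneg (le_max_left _ _) hpos)
  refine le_trans ?_ (mul_le_mul_of_nonneg_right (le_max_right _ _) hpos)
  rcases le_total d b with hdb | hdb
  · have := incCov_le_local hH hH1 (by linarith) (by linarith) hab1 hcd1 (δ := δ) (by linarith)
      (abs_le.2 ⟨by linarith, by linarith⟩) (abs_le.2 ⟨by linarith, by linarith⟩)
    refine this.trans (mul_le_mul_of_nonneg_right ?_ hpos)
    nlinarith
  · have hS : incDist H a b c d = (c - a) ^ (2*H) + (d - b) ^ (2*H) := by
      unfold incDist; rw [abs_sub_comm a c, abs_sub_comm b d, abs_of_nonneg (by linarith),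
        abs_of_nonneg (by linarith)]
    have key : 2 * incCov H a b c d ≤ (b - a) ^ (2*H) + (d - c) ^ (2*H) - incDist H a b c d := by
      rw [hS]
      unfold incCov
      rw [abs_of_nonneg (by linarith : 0 ≤ b - c), abs_sub_comm a d, abs_sub_comm b d,
        abs_sub_comm a c, abs_of_nonneg (by linarith : 0 ≤ d - a),
        abs_of_nonneg (by linarith : 0 ≤ d - b), abs_of_nonneg (by linarith : 0 ≤ c - a)]
      have := rpow_add_rpow_le_of_le (p := 2 * H) (x := b - c) (y := b - a) (d := d - b)
        (by linarith) (by linarith) (by linarith) (by linarith) (by linarith)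
      rw [(by ring : b - a + (d - b) = d - a), (by ring : b - c + (d - b) = d - c)] at this
      linarith
    have hτ : |(b - a) - (d - c)| ≤ δ := abs_le.2 ⟨by linarith, by linarith⟩
    have h2 := sq_le_mul_rpow (by linarith : 2 * H ≤ 1) hτ (by linarith)
    have h3 := abs_rpow_sub_rpow_le_mul hH.le hH1 (by linarith : 1/4 ≤ b - a)
      (by linarith : 1/4 ≤ d - c)
    have h4 : |(b - a) - (d - c)| ^ (2*H) ≤ incDist H a b c d := by
      rw [hS]
      refine le_trans (rpow_le_rpow (abs_nonneg _)
        (abs_le.2 ⟨by linarith, by linarith⟩ : |(b - a) - (d - c)| ≤ (c - a) + (d - b))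
        (by linarith)) ?_
      exact Real.rpow_add_le_add_rpow (by linarith) (by linarith) (by linarith) (by linarith)
    have h5 := pow_le_pow_left₀ (abs_nonneg _) h3 2
    rw [sq_abs, mul_pow, sq_abs] at h5
    rw [← mul_rpow_eq_rpow_two_mul (by linarith : 0 ≤ b - a),
      ← mul_rpow_eq_rpow_two_mul (by linarith : 0 ≤ d - c)] at key
    have h6 := mul_le_mul_of_nonneg_left h4 hδ0
    have h7 : δ * incDist H a b c d ≤ 1 / 20 * incDist H a b c d := mul_le_mul_of_nonneg_right hδ hD
    have h8 := mul_le_mul_of_nonneg_left h1 hD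
    have h9 : 2 * incCov H a b c d ≤ 2 * ((b - a) ^ H * (d - c) ^ H) - incDist H a b c d / 2 := by
      linear_combination key + h5 + 4 * h2 + 4 * h6 + 4 * h7 + 3/10 * hD
    linear_combination h9 / 2 + h8 / 4

end

/-- The event that an increment `B b - B a` with `(a, b) ∈ S` exceeds `u`. -/
def exceed {Ω : Type*} (B : ℝ → Ω → ℝ) (S : Set (ℝ × ℝ)) (u : ℝ) : Set Ω :=
  {ω | ∃ p ∈ S, u < B p.2 ω - B p.1 ω}

/-- The event that a standardized increment `(B b - B a) / (b - a) ^ H` with `(a, b) ∈ S`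
exceeds `u`. -/
def exceedStd {Ω : Type*} (H : ℝ) (B : ℝ → Ω → ℝ) (S : Set (ℝ × ℝ)) (u : ℝ) : Set Ω :=
  {ω | ∃ p ∈ S, (p.2 - p.1) ^ H * u < B p.2 ω - B p.1 ω}

/-- The square with side `h` and lower left corner `(a, b)`. -/
def square (a b h : ℝ) : Set (ℝ × ℝ) := Icc a (a + h) ×ˢ Icc b (b + h)

lemma exceed_mono {Ω : Type*} {B : ℝ → Ω → ℝ} {S T : Set (ℝ × ℝ)} (h : S ⊆ T) (u : ℝ) :
    exceed B S u ⊆ exceed B T u := fun _ ⟨p, hp, h1⟩ => ⟨p, h hp, h1⟩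

lemma div_rpow_abs {x q p : ℝ} (hq : 0 < q) : |x / q| ^ p = |x| ^ p / q ^ p := by
  rw [abs_div, abs_of_pos hq, div_rpow (abs_nonneg _) hq.le]

namespace FBM

variable {Ω : Type*} [MeasurableSpace Ω] {μ : Measure Ω} {H : ℝ} {B : ℝ → Ω → ℝ}

lemma measurableSet_exceed (hB : FBM μ H B) (S : Set (ℝ × ℝ)) (u : ℝ) :
    MeasurableSet (exceed B S u) := by
  have := measurableSet_exists_lt (I := S) (l := fun _ => u)
    (X := fun p ω => B p.1.2 ω - B p.1.1 ω) continuous_const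
    (fun ω => by have := hB.cont ω; fun_prop) (fun p => hB.gauss.measurable (sub_mem _ _))
  convert this using 1
  ext ω
  simp [exceed]

lemma incCov_eq (hB : FBM μ H B) {a b c d : ℝ} (ha : 0 ≤ a) (hb : 0 ≤ b) (hc : 0 ≤ c)
    (hd : 0 ≤ d) : ∫ ω, (B b ω - B a ω) * (B d ω - B c ω) ∂μ = incCov H a b c d :=
  hB.cov_increments ha hb hc hd

lemma exceedStd_square {Ω : Type*} {B : ℝ → Ω → ℝ} {a b q lam u : ℝ} (hq : 0 < q) :
    exceedStd H B (square a b (lam / q)) u =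
      {ω | ∃ t : Fin 2 → Icc (0:ℝ) lam,
        ((b + t 1 / q) - (a + t 0 / q)) ^ H * u < B (b + t 1 / q) ω - B (a + t 0 / q) ω} := by
  have hmem : ∀ x y : ℝ, x ∈ Icc y (y + lam / q) → (x - y) * q ∈ Icc 0 lam := by
    intro x y hx
    refine ⟨mul_nonneg (sub_nonneg.2 hx.1) hq.le, ?_⟩
    rw [← le_div_iff₀ hq]; linarith [hx.2]
  ext ω
  constructor
  · rintro ⟨p, ⟨h1, h2⟩, h3⟩
    refine ⟨![⟨(p.1 - a) * q, hmem _ _ h1⟩, ⟨(p.2 - b) * q, hmem _ _ h2⟩], ?_⟩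
    simp only [Matrix.cons_val_zero, Matrix.cons_val_one, mul_div_cancel_right₀ _ hq.ne',
      add_sub_cancel]
    exact h3
  · rintro ⟨t, ht⟩
    refine ⟨(a + t 0 / q, b + t 1 / q), ⟨⟨?_, ?_⟩, ⟨?_, ?_⟩⟩, ht⟩
    · exact le_add_of_nonneg_right (div_nonneg (t 0).2.1 hq.le)
    · exact add_le_add_right (div_le_div_of_nonneg_right (t 0).2.2 hq.le) _
    · exact le_add_of_nonneg_right (div_nonneg (t 1).2.1 hq.le)
    · exact add_le_add_right (div_le_div_of_nonneg_right (t 1).2.2 hq.le) _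

lemma incDist_square {a b q lam : ℝ} (hq : 0 < q) (t s : Fin 2 → Icc (0:ℝ) lam) :
    incDist H (a + t 0 / q) (b + t 1 / q) (a + s 0 / q) (b + s 1 / q) =
      locDist H t s / q ^ (2*H) := by
  unfold incDist locDist
  rw [add_sub_add_left_eq_sub, add_sub_add_left_eq_sub, ← sub_div, ← sub_div, div_rpow_abs hq,
    div_rpow_abs hq, Fin.sum_univ_two, add_div]

lemma abs_sub_le_div {q lam : ℝ} (hq : 0 < q) (a : ℝ) (t s : Icc (0:ℝ) lam) :
    |(a + t / q) - (a + s / q)| ≤ lam / q := by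
  rw [add_sub_add_left_eq_sub, ← sub_div, abs_div, abs_of_pos hq]
  exact div_le_div_of_nonneg_right (abs_sub_le_of_nonneg_of_le t.2.1 t.2.2 s.2.1 s.2.2) hq.le

lemma measureReal_exceedStd_square_le (hB : FBM μ H B) (hH : 0 < H) (hH1 : H ≤ 1/2)
    {a b q lam w δ : ℝ} (hq : 0 < q) (hw : 0 < w) (ha : 0 ≤ a) (hδ : δ ≤ 1/4)
    (hlδ : lam / q ≤ δ) (hl : 0 ≤ lam) (hab : 1 - δ ≤ b - a - lam / q)
    (hc : (1 + 10 * δ) / (1 - δ) / 2 / q ^ (2*H) * (w ^ 2 + 4 * lam ^ (2*H)) ≤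
      1 - lam ^ (2*H) / w ^ 2) :
    μ.real (exceedStd H B (square a b (lam / q)) w) ≤ locProb μ H B (Fin 2) lam w := by
  have hlq : 0 ≤ lam / q := div_nonneg hl hq.le
  have hδ0 : 0 ≤ δ := hlq.trans hlδ
  have h0 : ∀ t : Icc (0:ℝ) lam, 0 ≤ (t:ℝ) / q := fun t => div_nonneg t.2.1 hq.le
  have h1 : ∀ t : Icc (0:ℝ) lam, (t:ℝ) / q ≤ lam / q := fun t =>
    div_le_div_of_nonneg_right t.2.2 hq.le
  have hτ : ∀ t : Fin 2 → Icc (0:ℝ) lam, 1 - δ ≤ (b + t 1 / q) - (a + t 0 / q) := fun t => by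
    linarith [h0 (t 1), h1 (t 0)]
  have hq' : 0 < q ^ (2*H) := rpow_pos_of_pos hq _
  rw [exceedStd_square hq]
  refine hB.measureReal_le_locProb (c := (1 + 10 * δ) / (1 - δ) / 2 / q ^ (2*H)) hH (by linarith) hw
    (div_nonneg (div_nonneg (div_nonneg (by linarith) (by linarith)) zero_le_two) hq'.le)
    (by convert hc using 2 <;> simp only [Fintype.card_fin] <;> push_cast <;> field_simp <;> ring)
    hB.gauss
    (X := fun (t : Fin 2 → Icc (0:ℝ) lam) ω => B (b + t 1 / q) ω - B (a + t 0 / q) ω)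
    (σ := fun t => ((b + t 1 / q) - (a + t 0 / q)) ^ H) (fun t => sub_mem _ _)
    (fun ω => by have := hB.cont ω; fun_prop) (fun t => rpow_pos_of_pos (by linarith [hτ t]) _)
    (Continuous.rpow_const (by fun_prop) fun t => Or.inr hH.le)
    (fun t => ?_) (fun t s => ?_)
  · rw [hB.incCov_eq (by linarith [h0 (t 0)]) (by linarith [h0 (t 1)]) (by linarith [h0 (t 0)])
      (by linarith [h0 (t 1)]), incCov_self hH (by linarith [hτ t])]
  · rw [hB.incCov_eq (by linarith [h0 (t 0)]) (by linarith [h0 (t 1)]) (by linarith [h0 (s 0)])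
      (by linarith [h0 (s 1)])]
    refine le_trans (le_of_eq ?_) (le_incCov_local hH hH1 (hτ t) (hτ s) hδ
      ((abs_sub_le_div hq _ _ _).trans hlδ) ((abs_sub_le_div hq _ _ _).trans hlδ))
    rw [incDist_square hq]
    ring

lemma locProb_le_measureReal_exceedStd_square (hB : FBM μ H B) (hH : 0 < H) (hH1 : H ≤ 1/2)
    {a b q lam w δ : ℝ} (hq : 0 < q) (hw : 0 < w) (ha : 0 ≤ a) (hδ : δ ≤ 1/10)
    (hlδ : lam / q ≤ δ) (hl : 0 ≤ lam) (hab : 3/4 ≤ b - a - lam / q) (hab1 : b - a + lam / q ≤ 1)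
    (hc : 1 ≤ (1 - 10 * δ) / 2 / q ^ (2*H) * w ^ 2) :
    locProb μ H B (Fin 2) lam w ≤ μ.real (exceedStd H B (square a b (lam / q)) w) := by
  have hlq : 0 ≤ lam / q := div_nonneg hl hq.le
  have hδ0 : 0 ≤ δ := hlq.trans hlδ
  have h0 : ∀ t : Icc (0:ℝ) lam, 0 ≤ (t:ℝ) / q := fun t => div_nonneg t.2.1 hq.le
  have h1 : ∀ t : Icc (0:ℝ) lam, (t:ℝ) / q ≤ lam / q := fun t =>
    div_le_div_of_nonneg_right t.2.2 hq.le
  have hτ : ∀ t : Fin 2 → Icc (0:ℝ) lam, 3/4 ≤ (b + t 1 / q) - (a + t 0 / q) := fun t => by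
    linarith [h0 (t 1), h1 (t 0)]
  have hτ1 : ∀ t : Fin 2 → Icc (0:ℝ) lam, (b + t 1 / q) - (a + t 0 / q) ≤ 1 := fun t => by
    linarith [h0 (t 0), h1 (t 1)]
  rw [exceedStd_square hq]
  refine hB.locProb_le_measureReal hH hw hc hB.gauss
    (X := fun (t : Fin 2 → Icc (0:ℝ) lam) ω => B (b + t 1 / q) ω - B (a + t 0 / q) ω)
    (σ := fun t => ((b + t 1 / q) - (a + t 0 / q)) ^ H) (fun t => sub_mem _ _)
    (fun ω => by have := hB.cont ω; fun_prop) (fun t => rpow_pos_of_pos (by linarith [hτ t]) _)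
    (Continuous.rpow_const (by fun_prop) fun t => Or.inr hH.le)
    (fun t => ?_) (fun t s => ?_)
  · rw [hB.incCov_eq (by linarith [h0 (t 0)]) (by linarith [h0 (t 1)]) (by linarith [h0 (t 0)])
      (by linarith [h0 (t 1)]), incCov_self hH (by linarith [hτ t])]
  · rw [hB.incCov_eq (by linarith [h0 (t 0)]) (by linarith [h0 (t 1)]) (by linarith [h0 (s 0)])
      (by linarith [h0 (s 1)])]
    refine (incCov_le_local hH hH1 (hτ t) (hτ s) (hτ1 t) (hτ1 s) hδ
      ((abs_sub_le_div hq _ _ _).trans hlδ) ((abs_sub_le_div hq _ _ _).trans hlδ)).trans_eq ?_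
    rw [incDist_square hq]
    ring

end FBM

lemma sum_exp_neg_le {θ : ℝ} (hθ : 0 < θ) (n : ℕ) :
    ∑ k ∈ Finset.range n, exp (-(θ * k)) ≤ 1 + 1 / θ := by
  have h1 : exp (-θ) < 1 := by rw [← exp_zero]; exact exp_lt_exp.2 (by linarith)
  have h2 : ∀ k : ℕ, exp (-(θ * k)) = exp (-θ) ^ k := fun k => by rw [← exp_nat_mul]; ring_nf
  simp only [h2]
  refine ((summable_geometric_of_lt_one (exp_pos _).le h1).sum_le_tsum _
    fun _ _ => pow_nonneg (exp_pos _).le _).trans ?_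
  rw [tsum_geometric_of_lt_one (exp_pos _).le h1, inv_le_comm₀ (by linarith) (by positivity)]
  have h3 : exp (-θ) ≤ (1 + θ)⁻¹ := by
    rw [exp_neg]; exact inv_anti₀ (by positivity) (by linarith [add_one_le_exp θ])
  have h4 : (1 + 1 / θ)⁻¹ = 1 - (1 + θ)⁻¹ := by field_simp; ring
  linarith

lemma sum_exp_neg_pred_le {θ : ℝ} (hθ : 0 < θ) (n : ℕ) :
    ∑ k ∈ Finset.range n, exp (-(θ * (k - 1 : ℕ))) ≤ 2 + 1 / θ := by
  rcases n with _ | n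
  · simp; positivity
  · rw [Finset.sum_range_succ']
    have := sum_exp_neg_le hθ n
    simp only [Nat.add_sub_cancel, zero_tsub, Nat.cast_zero, mul_zero, neg_zero, exp_zero]
    linarith

lemma millsTail_mul_le {u x : ℝ} (hu : 0 < u) (hx : 0 ≤ x) :
    millsTail (u * (1 + x)) ≤ millsTail u * exp (-(u ^ 2 * x)) := by
  unfold millsTail
  rw [div_mul_eq_mul_div, ← exp_add]
  have h1 : 0 < √(2 * π) * u := by positivity
  refine div_le_div₀ (exp_pos _).le (exp_le_exp.2 ?_) h1 ?_
  · nlinarith [mul_nonneg (sq_nonneg u) (sq_nonneg x)]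
  · exact mul_le_mul_of_nonneg_left (le_mul_of_one_le_right hu.le (by linarith)) (sqrt_nonneg _)

lemma one_sub_rpow_mul_le {H x : ℝ} (hH : 0 ≤ H) (hH1 : H ≤ 1) (hx1 : x ≤ 1) :
    (1 - x) ^ H * (1 + H * x) ≤ 1 ∨ 1 + H * x < 0 := by
  by_cases h : 0 ≤ 1 + H * x
  · left
    have h1 := rpow_one_add_le_one_add_mul_self (s := -x) (by linarith) hH hH1
    rw [← sub_eq_add_neg] at h1
    nlinarith [sq_nonneg (H * x), mul_le_mul_of_nonneg_right h1 h]
  · right; linarith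

/-- Pairs `(a, b)` with `a ∈ [c, c + l]` and `b - a ∈ [s, t]`. -/
def strip (c l s t : ℝ) : Set (ℝ × ℝ) := {p | p.1 ∈ Icc c (c + l) ∧ p.2 - p.1 ∈ Icc s t}

namespace FBM

variable {Ω : Type*} [MeasurableSpace Ω] {μ : Measure Ω} {H : ℝ} {B : ℝ → Ω → ℝ}

lemma exceed_strip_subset {Ω : Type*} {B : ℝ → Ω → ℝ} {c h δ u : ℝ} (hH : 0 < H) (hH1 : H ≤ 1/2)
    (hh : 0 < h) (hδ : δ ≤ 1) (hu : 0 < u) :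
    exceed B (strip c 1 (1 - δ) 1) u ⊆
      ⋃ i ∈ Finset.range (⌊1 / h⌋₊ + 1), ⋃ k ∈ Finset.range (⌊δ / h + 1⌋₊ + 1),
        exceedStd H B (square (c + i * h) (c + 1 + i * h - k * h) h)
          (u * (1 + H * ((k - 1 : ℕ) * h))) := by
  rintro ω ⟨⟨a, b⟩, ⟨⟨ha1, ha2⟩, hb1, hb2⟩, hlt⟩
  simp only at ha1 ha2 hb1 hb2 hlt
  set i := ⌊(a - c) / h⌋₊
  have hi1 : i * h ≤ a - c := by
    rw [← le_div_iff₀ hh]; exact Nat.floor_le (div_nonneg (by linarith) hh.le)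
  have hi2 : a - c < (i + 1) * h := by
    rw [← div_lt_iff₀ hh]; exact Nat.lt_floor_add_one _
  set k := ⌊(c + 1 + (i + 1) * h - b) / h⌋₊
  have hk0 : 0 ≤ c + 1 + (i + 1) * h - b := by linarith
  have hk1 : k * h ≤ c + 1 + (i + 1) * h - b := by
    rw [← le_div_iff₀ hh]; exact Nat.floor_le (div_nonneg hk0 hh.le)
  have hk2 : c + 1 + (i + 1) * h - b < (k + 1) * h := by
    rw [← div_lt_iff₀ hh]; exact Nat.lt_floor_add_one _
  simp only [mem_iUnion, Finset.mem_range]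
  refine ⟨i, Nat.lt_succ_of_le (Nat.floor_le_floor (div_le_div_of_nonneg_right (by linarith) hh.le)),
    k, Nat.lt_succ_of_le (Nat.floor_le_floor ?_), (a, b), ⟨⟨?_, ?_⟩, ?_, ?_⟩, lt_of_le_of_lt ?_ hlt⟩
  · rw [div_le_iff₀ hh]
    have e : (δ / h + 1) * h = δ + h := by field_simp
    rw [e]; linarith
  · simp only; linarith
  · simp only; linarith
  · simp only; linarith
  · simp only; linarith
  · simp only
    set x := ((k - 1 : ℕ) : ℝ) * h
    have hx0 : 0 ≤ x := by positivity
    have hx : b - a ≤ 1 - x := by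
      rcases Nat.eq_zero_or_pos k with h0 | h0
      · simp only [x, h0, zero_tsub, Nat.cast_zero, zero_mul]; linarith
      · simp only [x]; rw [Nat.cast_sub h0]; push_cast; linarith
    have hba : 0 ≤ b - a := by linarith
    rcases one_sub_rpow_mul_le hH.le (by linarith) (by linarith : x ≤ 1) with h2 | h2
    · have h3 : (b - a) ^ H ≤ (1 - x) ^ H := rpow_le_rpow hba hx hH.le
      have h4 : 0 ≤ u * (1 + H * x) := by positivity
      calc (b - a) ^ H * (u * (1 + H * x)) ≤ (1 - x) ^ H * (u * (1 + H * x)) :=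
            mul_le_mul_of_nonneg_right h3 h4
        _ = u * ((1 - x) ^ H * (1 + H * x)) := by ring
        _ ≤ u := mul_le_of_le_one_right hu.le h2
    · have := mul_nonneg hH.le hx0
      linarith

lemma measureReal_exceed_strip_le_sum (hB : FBM μ H B) (hH : 0 < H) (hH1 : H ≤ 1/2)
    {c q lam u δ δ' : ℝ} (hq : 0 < q) (hl : 0 < lam) (hu : 0 < u) (hc : 0 ≤ c) (hδ0 : 0 ≤ δ)
    (hδδ' : δ + 2 * (lam / q) ≤ δ') (hδ' : δ' ≤ 1/4)
    (hi : Integrable (fun ω => exp (pickSup H B lam ω)) μ)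
    (hcond : (1 + 10 * δ') / (1 - δ') / 2 / q ^ (2*H) * ((u * (1 + δ)) ^ 2 + 4 * lam ^ (2*H)) ≤
      1 - lam ^ (2*H) / u ^ 2) :
    μ.real (exceed B (strip c 1 (1 - δ) 1) u) ≤
      (1 / (lam / q) + 1) * (2 + 1 / (H * u ^ 2 * (lam / q))) *
        (millsTail u * exp (2 * (lam ^ (2*H)) ^ 2 / u ^ 2) * pickMean μ H B lam ^ 2) := by
  have := hB.gauss.isProbabilityMeasure
  set h := lam / q
  have hh : 0 < h := by positivity
  set G := millsTail u * exp (2 * (lam ^ (2*H)) ^ 2 / u ^ 2) * pickMean μ H B lam ^ 2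
  have hG : 0 ≤ G := mul_nonneg (mul_nonneg (millsTail_pos hu).le (exp_pos _).le) (sq_nonneg _)
  have hcell : ∀ i : ℕ, ∀ k ∈ Finset.range (⌊δ / h + 1⌋₊ + 1),
      μ.real (exceedStd H B (square (c + i * h) (c + 1 + i * h - k * h) h)
          (u * (1 + H * ((k - 1 : ℕ) * h)))) ≤ exp (-(H * u ^ 2 * h * (k - 1 : ℕ))) * G := by
    intro i k hk
    have hk1 : (k : ℝ) * h ≤ δ + h := by
      have := (Nat.le_floor_iff (by positivity)).1 (Nat.lt_succ_iff.1 (Finset.mem_range.1 hk))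
      have := mul_le_mul_of_nonneg_right this hh.le
      rwa [add_mul, div_mul_cancel₀ _ hh.ne', one_mul] at this
    set x := ((k - 1 : ℕ) : ℝ) * h with hx
    have hx0 : 0 ≤ x := by positivity
    have hxδ : x ≤ δ := by
      rcases Nat.eq_zero_or_pos k with h0 | h0
      · simp only [x, h0, zero_tsub, Nat.cast_zero, zero_mul]; exact hδ0
      · simp only [x]; rw [Nat.cast_sub h0]; push_cast; linarith
    have hHx : H * x ≤ δ := by nlinarith
    set w := u * (1 + H * x)
    have hw : u ≤ w := le_mul_of_one_le_right hu.le (by nlinarith)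
    have hw0 : 0 < w := hu.trans_le hw
    have hw1 : w ≤ u * (1 + δ) := mul_le_mul_of_nonneg_left (by linarith) hu.le
    have hδ1 : 0 < 1 - δ' := by linarith
    have h1 := hB.measureReal_exceedStd_square_le hH hH1 (a := c + i * h)
      (b := c + 1 + i * h - k * h) (lam := lam) (w := w) (δ := δ') hq hw0 (by positivity) hδ'
      (by linarith) hl.le (by linarith) (by
        refine le_trans (le_trans ?_ hcond) ?_
        · have : w ^ 2 ≤ (u * (1 + δ)) ^ 2 := pow_le_pow_left₀ hw0.le hw1 2
          have h3 : 0 ≤ (1 + 10 * δ') / (1 - δ') / 2 / q ^ (2*H) := by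
            have : 0 ≤ 1 + 10 * δ' := by linarith
            positivity
          exact mul_le_mul_of_nonneg_left (by linarith) h3
        · have : lam ^ (2*H) / w ^ 2 ≤ lam ^ (2*H) / u ^ 2 :=
            div_le_div_of_nonneg_left (by positivity) (by positivity)
              (pow_le_pow_left₀ hu.le hw 2)
          linarith)
    refine h1.trans ((hB.locProb_le hH hl.le hw0 hi).trans ?_)
    have h2 : millsTail w ≤ millsTail u * exp (-(H * u ^ 2 * h * (k - 1 : ℕ))) := by
      refine (millsTail_mul_le hu (mul_nonneg hH.le hx0)).trans_eq ?_
      congr 2; rw [hx]; ring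
    have h3 : exp ((2 * Fintype.card (Fin 2) * lam ^ (2*H)) ^ 2 / (8 * w ^ 2)) ≤
        exp (2 * (lam ^ (2*H)) ^ 2 / u ^ 2) := by
      refine exp_le_exp.2 ?_
      have : 2 * (lam ^ (2*H)) ^ 2 / w ^ 2 ≤ 2 * (lam ^ (2*H)) ^ 2 / u ^ 2 :=
        div_le_div_of_nonneg_left (by positivity) (by positivity) (pow_le_pow_left₀ hu.le hw 2)
      refine le_trans (le_of_eq ?_) this
      rw [Fintype.card_fin]; push_cast; field_simp; ring
    rw [Fintype.card_fin]
    have h5 := mul_le_mul h2 h3 (exp_pos _).le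
      (mul_nonneg (millsTail_pos hu).le (exp_pos _).le)
    refine (mul_le_mul_of_nonneg_right h5 (sq_nonneg _)).trans_eq ?_
    simp only [G]; ring
  refine (measureReal_mono (exceed_strip_subset (B := B) hH hH1 hh (by linarith) hu)
    (measure_ne_top _ _)).trans ?_
  refine (measureReal_biUnion_finset_le _ _).trans ?_
  have hrow : ∀ i ∈ Finset.range (⌊1 / h⌋₊ + 1),
      μ.real (⋃ k ∈ Finset.range (⌊δ / h + 1⌋₊ + 1),
        exceedStd H B (square (c + i * h) (c + 1 + i * h - k * h) h)
          (u * (1 + H * ((k - 1 : ℕ) * h)))) ≤ (2 + 1 / (H * u ^ 2 * h)) * G := by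
    intro i _
    refine (measureReal_biUnion_finset_le _ _).trans ((Finset.sum_le_sum (hcell i)).trans ?_)
    rw [← Finset.sum_mul]
    exact mul_le_mul_of_nonneg_right (sum_exp_neg_pred_le (by positivity) _) hG
  refine (Finset.sum_le_sum hrow).trans ?_
  rw [Finset.sum_const, Finset.card_range, nsmul_eq_mul, mul_assoc (1 / h + 1)]
  refine mul_le_mul_of_nonneg_right ?_ (mul_nonneg (by positivity) hG)
  push_cast
  have := Nat.floor_le (by positivity : 0 ≤ 1 / h)
  linarith

end FBM

/-- Asymptotic intensity of high excursions of the incremental field per unit of `s`. -/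
noncomputable def clumpRate (H HH u : ℝ) : ℝ :=
  HH ^ 2 * 2 ^ (-(1 / H)) * H⁻¹ * u ^ (2 / H - 2) * millsTail u

lemma clumpRate_pos {H HH u : ℝ} (hH : 0 < H) (hHH : 0 < HH) (hu : 0 < u) :
    0 < clumpRate H HH u := by
  have := millsTail_pos hu
  unfold clumpRate
  positivity

/-- The inverse of the spatial scale at which the field decorrelates at level `u`. -/
noncomputable def clumpScale (H κ u : ℝ) : ℝ := (κ * u ^ 2 / 2) ^ (1 / (2 * H))

section clumpScale

variable {H κ u : ℝ}

lemma clumpScale_pos (hκ : 0 < κ) (hu : 0 < u) : 0 < clumpScale H κ u := by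
  unfold clumpScale; positivity

lemma clumpScale_rpow (hH : 0 < H) (hκ : 0 < κ) : clumpScale H κ u ^ (2 * H) = κ * u ^ 2 / 2 := by
  unfold clumpScale
  rw [← rpow_mul (by positivity), one_div, inv_mul_cancel₀ (by positivity), rpow_one]

lemma clumpScale_sq (hH : 0 < H) (hκ : 0 < κ) (hu : 0 < u) :
    clumpScale H κ u ^ 2 = κ ^ (1 / H) * 2 ^ (-(1 / H)) * u ^ (2 / H - 2) * u ^ 2 := by
  unfold clumpScale
  rw [← rpow_natCast, ← rpow_mul (by positivity)]
  have e : 1 / (2 * H) * ((2 : ℕ) : ℝ) = 1 / H := by push_cast; field_simp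
  rw [e, mul_div_assoc, mul_rpow hκ.le (by positivity), div_rpow (by positivity) (by norm_num),
    rpow_neg (by norm_num), ← rpow_natCast u 2, ← rpow_mul hu.le]
  have e2 : u ^ (2 / H - 2) * u ^ ((2 : ℕ) : ℝ) = u ^ (2 / H) := by
    rw [← rpow_add hu]; congr 1; push_cast; ring
  have e3 : ((2 : ℕ) : ℝ) * (1 / H) = 2 / H := by push_cast; ring
  rw [e3, ← e2]; ring

lemma tendsto_clumpBase (hκ : 0 < κ) : Tendsto (fun u : ℝ => κ * u ^ 2 / 2) atTop atTop := by
  have h := (tendsto_pow_atTop (α := ℝ) two_ne_zero).const_mul_atTop (show 0 < κ / 2 by positivity)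
  exact h.congr fun u => by ring

lemma tendsto_clumpScale (hH : 0 < H) (hκ : 0 < κ) :
    Tendsto (clumpScale H κ) atTop atTop :=
  (tendsto_rpow_atTop (by positivity)).comp (tendsto_clumpBase hκ)

lemma tendsto_sq_div_clumpScale (hH : 0 < H) (hH1 : H < 1/2) (hκ : 0 < κ) :
    Tendsto (fun u => u ^ 2 / clumpScale H κ u) atTop (nhds 0) := by
  have h1 : 0 < 1 / (2 * H) - 1 := by
    rw [sub_pos, lt_div_iff₀ (by positivity)]; linarith
  have h := ((tendsto_rpow_neg_atTop h1).comp (tendsto_clumpBase hκ)).const_mul (2 / κ)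
  rw [mul_zero] at h
  refine h.congr' ?_
  filter_upwards [eventually_gt_atTop 0] with u hu
  have hb : 0 < κ * u ^ 2 / 2 := by positivity
  simp only [Function.comp, clumpScale]
  rw [neg_sub, rpow_sub hb, rpow_one]
  field_simp

end clumpScale

namespace FBM

variable {Ω : Type*} [MeasurableSpace Ω] {μ : Measure Ω} {H HH : ℝ} {B : ℝ → Ω → ℝ}

lemma tendsto_pickMean_ratio (hHH : 0 < HH)
    (hPick : Tendsto (fun lam : ℝ => lam⁻¹ * pickMean μ H B lam) atTop (nhds HH)) :
    Tendsto (fun lam : ℝ => (lam⁻¹ * pickMean μ H B lam) ^ 2 / HH ^ 2) atTop (nhds 1) := by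
  have := (hPick.pow 2).div_const (HH ^ 2)
  rwa [div_self (by positivity)] at this

lemma eventually_exceed_strip_le (hB : FBM μ H B) (hH : 0 < H) (hH1 : H < 1/2) (hHH : 0 < HH)
    (hPick : Tendsto (fun lam : ℝ => lam⁻¹ * pickMean μ H B lam) atTop (nhds HH))
    {ε : ℝ} (hε : 0 < ε) :
    ∃ δ ∈ Ioo (0:ℝ) 1, ∀ᶠ u in atTop, ∀ c, 0 ≤ c →
      μ.real (exceed B (strip c 1 (1 - δ) 1) u) ≤ (1 + ε) * clumpRate H HH u := by
  set κ := (1 + ε) ^ (H / 2) with hκd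
  have hκ1 : 1 < κ := one_lt_rpow (by linarith) (by positivity)
  have hκ0 : 0 < κ := by linarith
  have hκH : κ ^ (1 / H) = (1 + ε) ^ (1 / 2 : ℝ) := by
    rw [hκd, ← rpow_mul (by positivity)]; congr 1; field_simp
  have hs1 : 1 < (1 + ε) ^ (1 / 2 : ℝ) := one_lt_rpow (by linarith) (by positivity)
  obtain ⟨lam, hlam, hl⟩ := (((tendsto_pickMean_ratio hHH hPick).eventually
    (gt_mem_nhds hs1)).and (eventually_gt_atTop 0)).exists
  set P := pickMean μ H B lam
  obtain ⟨δ, hδκ, hδ0, hδ1⟩ : ∃ δ : ℝ, (1 + 10 * (2 * δ)) / (1 - 2 * δ) * (1 + δ) ^ 2 < κ ∧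
      0 < δ ∧ δ < 1/8 := by
    have h1 : Tendsto (fun δ : ℝ => (1 + 10 * (2 * δ)) / (1 - 2 * δ) * (1 + δ) ^ 2)
        (nhds 0) (nhds ((1 + 10 * (2 * 0)) / (1 - 2 * 0) * (1 + 0) ^ 2)) := by
      refine ContinuousAt.tendsto (f := fun δ : ℝ => (1 + 10 * (2 * δ)) / (1 - 2 * δ) * (1 + δ) ^ 2)
        (ContinuousAt.mul (ContinuousAt.div ?_ ?_ (by norm_num)) ?_) <;> fun_prop
    have h2 := h1.mono_left (nhdsWithin_le_nhds (s := Ioi 0))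
    have h3 := h2.eventually (gt_mem_nhds (show _ < κ by norm_num; exact hκ1))
    obtain ⟨δ, h, h'⟩ := (h3.and (Ioo_mem_nhdsGT (show (0:ℝ) < 1/8 by norm_num))).exists
    exact ⟨δ, h, h'.1, h'.2⟩
  refine ⟨δ, ⟨hδ0, by linarith⟩, ?_⟩
  have hq := tendsto_clumpScale (κ := κ) hH hκ0
  have hh : Tendsto (fun u => lam / clumpScale H κ u) atTop (nhds 0) := hq.const_div_atTop lam
  have hθ : Tendsto (fun u => H * u ^ 2 * (lam / clumpScale H κ u)) atTop (nhds 0) := by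
    have := (tendsto_sq_div_clumpScale hH hH1 hκ0).const_mul (H * lam)
    rw [mul_zero] at this
    exact this.congr fun u => by ring
  have hu2 : Tendsto (fun u : ℝ => u ^ 2) atTop atTop := tendsto_pow_atTop two_ne_zero
  have hinv : ∀ a : ℝ, Tendsto (fun u : ℝ => a / u ^ 2) atTop (nhds 0) := fun a =>
    hu2.const_div_atTop a
  have hratio : Tendsto (fun u => κ ^ (1 / H) * ((lam⁻¹ * P) ^ 2 / HH ^ 2) *
      (1 + lam / clumpScale H κ u) * (1 + 2 * (H * u ^ 2 * (lam / clumpScale H κ u))) *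
      exp (2 * (lam ^ (2*H)) ^ 2 / u ^ 2)) atTop
      (nhds (κ ^ (1 / H) * ((lam⁻¹ * P) ^ 2 / HH ^ 2) * (1 + 0) * (1 + 2 * 0) * exp 0)) :=
    ((((hh.const_add 1).const_mul _).mul ((hθ.const_mul 2).const_add 1))).mul
      ((continuous_exp.tendsto 0).comp (hinv _))
  have hlim : κ ^ (1 / H) * ((lam⁻¹ * P) ^ 2 / HH ^ 2) * (1 + 0) * (1 + 2 * 0) * exp 0 < 1 + ε := by
    rw [exp_zero, hκH]
    have e : (1 + ε) ^ (1 / 2 : ℝ) * (1 + ε) ^ (1 / 2 : ℝ) = 1 + ε := by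
      rw [← rpow_add (by positivity)]; norm_num
    nlinarith
  have hcondL : Tendsto (fun u : ℝ => (1 + 10 * (2 * δ)) / (1 - 2 * δ) / κ *
      ((1 + δ) ^ 2 + 4 * lam ^ (2*H) / u ^ 2) + lam ^ (2*H) / u ^ 2) atTop
      (nhds ((1 + 10 * (2 * δ)) / (1 - 2 * δ) / κ * ((1 + δ) ^ 2 + 0) + 0)) :=
    (((hinv _).const_add _).const_mul _).add (hinv _)
  have hcondlim : (1 + 10 * (2 * δ)) / (1 - 2 * δ) / κ * ((1 + δ) ^ 2 + 0) + 0 < 1 := by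
    rw [add_zero, add_zero, div_mul_eq_mul_div, div_lt_one hκ0]; exact hδκ
  filter_upwards [eventually_gt_atTop 0, hratio.eventually (gt_mem_nhds hlim),
    hcondL.eventually (gt_mem_nhds hcondlim),
    hh.eventually (gt_mem_nhds (show (0:ℝ) < δ / 2 by positivity))] with u hu h1 h2 h3 c hc
  have hqp := clumpScale_pos (H := H) hκ0 hu
  refine (hB.measureReal_exceed_strip_le_sum hH hH1.le (δ' := 2 * δ) hqp hl hu hc hδ0.le
    (by linarith) (by linarith) (integrable_exp_pickSup hB hH hHH hPick hl.le) ?_).trans ?_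
  · rw [clumpScale_rpow hH hκ0]
    refine le_trans (le_of_eq ?_) (le_sub_iff_add_le.2 h2.le)
    have : 1 - 2 * δ ≠ 0 := by linarith
    field_simp
  · refine le_trans (le_of_eq ?_) (mul_le_mul_of_nonneg_right h1.le (clumpRate_pos hH hHH hu).le)
    have hsq := clumpScale_sq hH hκ0 hu
    set q := clumpScale H κ u
    have e : (1 / (lam / q) + 1) * (2 + 1 / (H * u ^ 2 * (lam / q))) =
        (1 + lam / q) * (1 + 2 * (H * u ^ 2 * (lam / q))) * (q ^ 2 / (H * u ^ 2 * lam ^ 2)) := by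
      field_simp; ring
    rw [e, hsq]
    simp only [clumpRate, P]
    field_simp

end FBM

lemma GaussSpace.measureReal_lt_le {Ω : Type*} [MeasurableSpace Ω] {P : Measure Ω}
    {V : Submodule ℝ (Ω → ℝ)} (hV : GaussSpace P V) {f : Ω → ℝ} (hf : f ∈ V) {s v : ℝ}
    (hv : 0 ≤ v) (hfs : ∫ ω, f ω * f ω ∂P ≤ s ^ 2) :
    P.real {ω | v < f ω} ≤ exp (-(v ^ 2 / (2 * s ^ 2))) := by
  have := hV.isProbabilityMeasure
  have hX := hV.map_eq hf
  have hsub : HasSubgaussianMGF f (s ^ 2).toNNReal P := by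
    refine ⟨fun t => ?_, fun t => ?_⟩
    · have h1 := integrable_exp_mul_gaussianReal (μ := 0) (v := (∫ ω, f ω * f ω ∂P).toNNReal) t
      rw [← hX] at h1
      exact (integrable_map_measure (by fun_prop) (hV.measurable hf).aemeasurable).1 h1
    · rw [mgf_gaussianReal hX, coe_toNNReal _ (sq_nonneg s),
        coe_toNNReal _ (integral_nonneg fun ω => mul_self_nonneg _)]
      refine exp_le_exp.2 ?_
      nlinarith [sq_nonneg t, mul_le_mul_of_nonneg_right hfs (sq_nonneg t)]
  have h := hsub.measure_ge_le hv
  rw [coe_toNNReal _ (sq_nonneg s), neg_div] at h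
  exact (measureReal_mono (fun ω (h : v < f ω) => h.le) (measure_ne_top _ _)).trans h

lemma eventually_exp_le_clumpRate {H HH : ℝ} (hH : 0 < H) (hHH : 0 < HH) {η ε : ℝ} (hη : 0 < η)
    (hε : 0 < ε) :
    ∀ᶠ u in atTop, exp (-((1 + η) * u ^ 2 / 2)) ≤ ε * clumpRate H HH u := by
  set C := HH ^ 2 * 2 ^ (-(1 / H)) * H⁻¹ / √(2 * π)
  have hC : 0 < C := by positivity
  have h := tendsto_rpow_mul_exp_neg_mul_atTop_nhds_zero (3 - 2 / H) (η / 2) (by positivity)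
  filter_upwards [h.eventually (gt_mem_nhds (show 0 < ε * C by positivity)), eventually_ge_atTop 1]
    with u hu hu1
  have hu0 : 0 < u := by linarith
  have e1 : u ^ (3 - 2 / H) * (u ^ (2 / H - 2) * u⁻¹) = 1 := by
    rw [← rpow_neg_one u, ← rpow_add hu0, ← rpow_add hu0]
    ring_nf; simp
  have e2 : ε * clumpRate H HH u =
      ε * C * (u ^ (2 / H - 2) * u⁻¹) * exp (-(u ^ 2 / 2)) := by
    simp only [clumpRate, millsTail, C]; field_simp
  have e3 : exp (-((1 + η) * u ^ 2 / 2)) = exp (-(η / 2 * u ^ 2)) * exp (-(u ^ 2 / 2)) := by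
    rw [← exp_add]; ring_nf
  rw [e2, e3]
  refine mul_le_mul_of_nonneg_right ?_ (exp_pos _).le
  have h1 : exp (-(η / 2 * u ^ 2)) ≤ exp (-(η / 2) * u) := exp_le_exp.2 (by
    nlinarith [mul_nonneg hη.le (mul_nonneg hu0.le (sub_nonneg.2 hu1))])
  have hp : 0 < u ^ (2 / H - 2) * u⁻¹ := by positivity
  calc exp (-(η / 2 * u ^ 2)) ≤ exp (-(η / 2) * u) := h1
    _ = (u ^ (3 - 2 / H) * exp (-(η / 2) * u)) * (u ^ (2 / H - 2) * u⁻¹) := by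
        rw [mul_right_comm, e1, one_mul]
    _ ≤ _ := mul_le_mul_of_nonneg_right hu.le hp.le

namespace FBM

variable {Ω : Type*} [MeasurableSpace Ω] {μ : Measure Ω} {H HH : ℝ} {B : ℝ → Ω → ℝ}

lemma integral_sub_mul_sub (hB : FBM μ H B) (hH : 0 < H) {a b : ℝ} (ha : 0 ≤ a) (hb : 0 ≤ b) :
    ∫ ω, (B b ω - B a ω) * (B b ω - B a ω) ∂μ = |b - a| ^ (2 * H) := by
  rw [hB.cov_increments ha hb ha hb]
  simp only [sub_self, abs_zero, zero_rpow (show 2 * H ≠ 0 by positivity), abs_sub_comm a b]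
  ring

lemma exceed_strip_small_subset {Ω : Type*} {B : ℝ → Ω → ℝ} {c h h₀ δ u θ : ℝ}
    (hh : 0 < h₀) (hhh : h₀ ≤ h) (hhδ : h₀ ≤ δ / 2) (hδ : δ < 1) :
    exceed B (strip c 1 0 (1 - δ)) u ⊆
      (⋃ p ∈ (Finset.range (⌊2 / h₀⌋₊ + 1) ×ˢ Finset.range (⌊2 / h₀⌋₊ + 1)).filter
          (fun p : ℕ × ℕ => |(c + p.2 * h₀) - (c + p.1 * h₀)| ≤ 1 - δ / 2),
        {ω | (1 - 2 * θ) * u < B (c + p.2 * h₀) ω - B (c + p.1 * h₀) ω}) ∪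
      ((⋃ i ∈ Finset.range (⌊2 / h₀⌋₊ + 1),
        {ω | ∃ t : Icc 0 h, θ * u < 1 * (B (c + i * h₀ + t) ω - B (c + i * h₀) ω)}) ∪
      (⋃ i ∈ Finset.range (⌊2 / h₀⌋₊ + 1),
        {ω | ∃ t : Icc 0 h, θ * u < (-1) * (B (c + i * h₀ + t) ω - B (c + i * h₀) ω)})) := by
  rintro ω ⟨⟨a, b⟩, ⟨⟨ha1, ha2⟩, hb1, hb2⟩, hlt⟩
  simp only at ha1 ha2 hb1 hb2 hlt
  have key : ∀ a : ℝ, c ≤ a → a ≤ c + 2 → ∃ i ∈ Finset.range (⌊2 / h₀⌋₊ + 1),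
      c + i * h₀ ≤ a ∧ a < c + i * h₀ + h₀ := by
    intro a h1 h2
    refine ⟨⌊(a - c) / h₀⌋₊, Finset.mem_range.2 (Nat.lt_succ_of_le (Nat.floor_le_floor
      (div_le_div_of_nonneg_right (by linarith) hh.le))), ?_, ?_⟩
    · have := Nat.floor_le (div_nonneg (sub_nonneg.2 h1) hh.le)
      rw [le_div_iff₀ hh] at this; linarith
    · have := Nat.lt_floor_add_one ((a - c) / h₀)
      rw [div_lt_iff₀ hh] at this; linarith
  obtain ⟨i, hi, hi1, hi2⟩ := key a ha1 (by linarith)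
  obtain ⟨j, hj, hj1, hj2⟩ := key b (by linarith) (by linarith)
  by_contra hcon
  simp only [mem_union, mem_iUnion, not_or, not_exists, Set.mem_ofPred_eq, not_lt] at hcon
  obtain ⟨h1, h2, h3⟩ := hcon
  have h1' := h1 (i, j) (by
    rw [Finset.mem_filter, Finset.mem_product]
    refine ⟨⟨hi, hj⟩, ?_⟩
    rw [abs_le]; constructor <;> simp only <;> linarith)
  have h2' := h2 j hj ⟨b - (c + j * h₀), by constructor <;> linarith⟩
  have h3' := h3 i hi ⟨a - (c + i * h₀), by constructor <;> linarith⟩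
  simp only [add_sub_cancel] at h1' h2' h3'
  linarith

lemma eventually_exceed_strip_small_le (hB : FBM μ H B) (hH : 0 < H) (hHH : 0 < HH)
    (hPick : Tendsto (fun lam : ℝ => lam⁻¹ * pickMean μ H B lam) atTop (nhds HH))
    {δ : ℝ} (hδ : δ ∈ Ioo (0:ℝ) 1) {ε : ℝ} (hε : 0 < ε) :
    ∀ᶠ u in atTop, ∀ c, 0 ≤ c →
      μ.real (exceed B (strip c 1 0 (1 - δ)) u) ≤ ε * clumpRate H HH u := by
  have := hB.gauss.isProbabilityMeasure
  set σ := (1 - δ / 2) ^ H with hσ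
  have hδ2 : 0 < 1 - δ / 2 := by linarith [hδ.2]
  have hσ0 : 0 < σ := rpow_pos_of_pos hδ2 _
  have hσ1 : σ < 1 := rpow_lt_one hδ2.le (by linarith [hδ.1]) hH
  set θ := (1 - √σ) / 2 with hθd
  have hsσ : √σ < 1 := by rw [sqrt_lt' one_pos]; simpa using hσ1
  have hsσ0 : 0 < √σ := sqrt_pos.2 hσ0
  have hθ : 0 < θ := by simp only [θ]; linarith
  have hθσ : 1 - 2 * θ = √σ := by simp only [θ]; ring
  obtain ⟨h, hh, hev⟩ := hB.eventually_sup_le hH hHH hPick (1 / θ ^ 2) (by positivity)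
  set h₀ := min h (δ / 2)
  have hh0 : 0 < h₀ := lt_min hh (by linarith [hδ.1])
  set N := ⌊2 / h₀⌋₊ + 1
  have hN : (0:ℝ) < N := by positivity
  have hη : 0 < 1 / σ - 1 := by rw [sub_pos, lt_div_iff₀ hσ0]; linarith
  have hθu : Tendsto (fun u => θ * u) atTop atTop := tendsto_id.const_mul_atTop hθ
  filter_upwards [eventually_gt_atTop 0, hθu.eventually hev,
    eventually_exp_le_clumpRate hH hHH hη (show 0 < ε / (2 * N ^ 2) by positivity),
    eventually_exp_le_clumpRate hH hHH one_pos (show 0 < ε / (4 * N) by positivity)]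
    with u hu hv h1 h2 c hc
  have hsup : ∀ e : ℝ, e ^ 2 = 1 → μ.real (⋃ i ∈ Finset.range N,
      {ω | ∃ t : Icc 0 h, θ * u < e * (B (c + i * h₀ + t) ω - B (c + i * h₀) ω)}) ≤
        ε / 4 * clumpRate H HH u := by
    intro e he
    refine (measureReal_biUnion_finset_le _ _).trans ((Finset.sum_le_sum fun (i : ℕ) _ =>
      (hv e he (c + (i : ℝ) * h₀) (add_nonneg hc (mul_nonneg (Nat.cast_nonneg i) hh0.le))).trans (?_ : _ ≤ ε / (4 * N) * clumpRate H HH u)).trans_eq ?_)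
    · refine le_trans (exp_le_exp.2 (le_of_eq ?_)) h2
      field_simp; ring
    · rw [Finset.sum_const, Finset.card_range, nsmul_eq_mul]; field_simp
  refine (measureReal_mono (exceed_strip_small_subset (θ := θ) hh0 (min_le_left h _)
    (min_le_right _ _) hδ.2) (measure_ne_top _ _)).trans ?_
  refine (measureReal_union_le _ _).trans ?_
  have hmain : μ.real (⋃ p ∈ (Finset.range N ×ˢ Finset.range N).filter
          (fun p : ℕ × ℕ => |(c + p.2 * h₀) - (c + p.1 * h₀)| ≤ 1 - δ / 2),
        {ω | (1 - 2 * θ) * u < B (c + p.2 * h₀) ω - B (c + p.1 * h₀) ω}) ≤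
      ε / 2 * clumpRate H HH u := by
    have hpos : 0 ≤ ε / (2 * N ^ 2) * clumpRate H HH u := by
      have := clumpRate_pos hH hHH hu
      positivity
    refine (measureReal_biUnion_finset_le _ _).trans ((Finset.sum_le_sum fun p hp =>
      (?_ : _ ≤ ε / (2 * N ^ 2) * clumpRate H HH u)).trans
        ((Finset.sum_le_sum_of_subset_of_nonneg (Finset.filter_subset _ _)
          fun _ _ _ => hpos).trans_eq ?_))
    · have hp2 := (Finset.mem_filter.1 hp).2
      have hvar : ∫ ω, (B (c + p.2 * h₀) ω - B (c + p.1 * h₀) ω) *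
          (B (c + p.2 * h₀) ω - B (c + p.1 * h₀) ω) ∂μ ≤ σ ^ 2 := by
        rw [hB.integral_sub_mul_sub hH (by positivity) (by positivity), hσ, ← rpow_natCast,
          ← rpow_mul hδ2.le]
        have : H * ((2 : ℕ) : ℝ) = 2 * H := by push_cast; ring
        rw [this]
        exact rpow_le_rpow (abs_nonneg _) hp2 (by positivity)
      refine (hB.gauss.measureReal_lt_le (FBM.sub_mem _ _)
        (mul_nonneg (by rw [hθσ]; exact hsσ0.le) hu.le) hvar).trans
        (le_trans (exp_le_exp.2 (le_of_eq ?_)) h1)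
      rw [hθσ, mul_pow, sq_sqrt hσ0.le]; field_simp; ring
    · rw [Finset.sum_const, Finset.card_product, Finset.card_range, nsmul_eq_mul]
      push_cast; field_simp
  have h3 := hsup 1 (by norm_num)
  have h4 := hsup (-1) (by norm_num)
  have h5 := measureReal_union_le (μ := μ) (⋃ i ∈ Finset.range N,
        {ω | ∃ t : Icc 0 h, θ * u < 1 * (B (c + i * h₀ + t) ω - B (c + i * h₀) ω)})
      (⋃ i ∈ Finset.range N,
        {ω | ∃ t : Icc 0 h, θ * u < (-1) * (B (c + i * h₀ + t) ω - B (c + i * h₀) ω)})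
  linarith

lemma eventually_exceed_strip_unit_le (hB : FBM μ H B) (hH : 0 < H) (hH1 : H < 1/2) (hHH : 0 < HH)
    (hPick : Tendsto (fun lam : ℝ => lam⁻¹ * pickMean μ H B lam) atTop (nhds HH))
    {ε : ℝ} (hε : 0 < ε) :
    ∀ᶠ u in atTop, ∀ c, 0 ≤ c →
      μ.real (exceed B (strip c 1 0 1) u) ≤ (1 + ε) * clumpRate H HH u := by
  have := hB.gauss.isProbabilityMeasure
  obtain ⟨δ, hδ, h⟩ := hB.eventually_exceed_strip_le hH hH1 hHH hPick (half_pos hε)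
  filter_upwards [h, hB.eventually_exceed_strip_small_le hH hHH hPick hδ (half_pos hε)]
    with u h1 h2 c hc
  have hsub : exceed B (strip c 1 0 1) u ⊆
      exceed B (strip c 1 (1 - δ) 1) u ∪ exceed B (strip c 1 0 (1 - δ)) u := by
    rintro ω ⟨p, ⟨hp1, hp2, hp3⟩, hlt⟩
    rcases le_total (1 - δ) (p.2 - p.1) with hp | hp
    · exact Or.inl ⟨p, ⟨hp1, hp, hp3⟩, hlt⟩
    · exact Or.inr ⟨p, ⟨hp1, hp2, hp⟩, hlt⟩
  have h3 := (measureReal_mono hsub (measure_ne_top μ _)).trans (measureReal_union_le _ _)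
  have := h1 c hc
  have := h2 c hc
  linarith

end FBM

namespace GaussSpace

variable {Ω : Type*} [MeasurableSpace Ω] {P : Measure Ω} {V : Submodule ℝ (Ω → ℝ)}

lemma integral_add_mul_add (hV : GaussSpace P V) {f g f' g' : Ω → ℝ} (hf : f ∈ V) (hg : g ∈ V)
    (hf' : f' ∈ V) (hg' : g' ∈ V) :
    ∫ ω, (f ω + g ω) * (f' ω + g' ω) ∂P =
      ∫ ω, f ω * f' ω ∂P + ∫ ω, g ω * f' ω ∂P + (∫ ω, f ω * g' ω ∂P + ∫ ω, g ω * g' ω ∂P) := by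
  have i1 : Integrable (fun ω => f ω * f' ω) P := hV.integrable_mul hf hf'
  have i2 : Integrable (fun ω => g ω * f' ω) P := hV.integrable_mul hg hf'
  have i3 : Integrable (fun ω => f ω * g' ω) P := hV.integrable_mul hf hg'
  have i4 : Integrable (fun ω => g ω * g' ω) P := hV.integrable_mul hg hg'
  have i5 : Integrable (fun ω => f ω * f' ω + g ω * f' ω) P := i1.add i2
  have i6 : Integrable (fun ω => f ω * g' ω + g ω * g' ω) P := i3.add i4
  rw [← integral_add i1 i2, ← integral_add i3 i4, ← integral_add i5 i6]
  congr 1; ext ω; ring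

lemma integral_sub_mul_self (hV : GaussSpace P V) {f g : Ω → ℝ} (hf : f ∈ V) (hg : g ∈ V) :
    ∫ ω, (f ω - g ω) * (f ω - g ω) ∂P =
      ∫ ω, f ω * f ω ∂P + ∫ ω, g ω * g ω ∂P - 2 * ∫ ω, f ω * g ω ∂P := by
  have i1 : Integrable (fun ω => f ω * f ω) P := hV.integrable_mul hf hf
  have i2 : Integrable (fun ω => g ω * g ω) P := hV.integrable_mul hg hg
  have i3 : Integrable (fun ω => 2 * (f ω * g ω)) P := (hV.integrable_mul hf hg).const_mul 2
  have i5 : Integrable (fun ω => f ω * f ω + g ω * g ω) P := i1.add i2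
  rw [← integral_const_mul, ← integral_add i1 i2, ← integral_sub i5 i3]
  congr 1; ext ω; ring

lemma le_integral_add_mul_add (hV : GaussSpace P V) {f g f' g' : Ω → ℝ} (hf : f ∈ V) (hg : g ∈ V)
    (hf' : f' ∈ V) (hg' : g' ∈ V) :
    (∫ ω, (f ω + g ω) * (f ω + g ω) ∂P + ∫ ω, (f' ω + g' ω) * (f' ω + g' ω) ∂P) / 2 -
        ∫ ω, (f ω - f' ω) * (f ω - f' ω) ∂P - ∫ ω, (g ω - g' ω) * (g ω - g' ω) ∂P ≤
      ∫ ω, (f ω + g ω) * (f' ω + g' ω) ∂P := by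
  have a1 := V.add_mem hf hg
  have a2 := V.add_mem hf' hg'
  have a3 := V.sub_mem hf hf'
  have a4 := V.sub_mem hg hg'
  have i1 : Integrable (fun ω => (f ω + g ω) * (f ω + g ω)) P := hV.integrable_mul a1 a1
  have i2 : Integrable (fun ω => (f' ω + g' ω) * (f' ω + g' ω)) P := hV.integrable_mul a2 a2
  have i3 : Integrable (fun ω => (f ω - f' ω) * (f ω - f' ω)) P := hV.integrable_mul a3 a3
  have i4 : Integrable (fun ω => (g ω - g' ω) * (g ω - g' ω)) P := hV.integrable_mul a4 a4
  have i5 : Integrable (fun ω => (f ω + g ω) * (f' ω + g' ω)) P := hV.integrable_mul a1 a2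
  have i6 : Integrable (fun ω => (f ω + g ω) * (f ω + g ω) + (f' ω + g' ω) * (f' ω + g' ω)) P :=
    i1.add i2
  have i7 : Integrable (fun ω => ((f ω + g ω) * (f ω + g ω) + (f' ω + g' ω) * (f' ω + g' ω)) / 2)
    P := i6.div_const 2
  have i8 : Integrable (fun ω => ((f ω + g ω) * (f ω + g ω) + (f' ω + g' ω) * (f' ω + g' ω)) / 2 -
    (f ω - f' ω) * (f ω - f' ω)) P := i7.sub i3
  have i9 : Integrable (fun ω => ((f ω + g ω) * (f ω + g ω) + (f' ω + g' ω) * (f' ω + g' ω)) / 2 -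
    (f ω - f' ω) * (f ω - f' ω) - (g ω - g' ω) * (g ω - g' ω)) P := i8.sub i4
  rw [← integral_add i1 i2, ← integral_div, ← integral_sub i7 i3, ← integral_sub i8 i4]
  refine integral_mono i9 i5 fun ω => ?_
  simp only
  nlinarith [sq_nonneg ((f ω - f' ω) - (g ω - g' ω))]

end GaussSpace

/-- Correlation of the increments over `[a, b]` and `[c, d]`. -/
noncomputable def incCor (H a b c d : ℝ) : ℝ := incCov H a b c d / ((b - a) ^ H * (d - c) ^ H)

lemma incCor_self {H a b : ℝ} (hH : 0 < H) (hab : a < b) : incCor H a b a b = 1 := by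
  have : 0 < (b - a) ^ H := rpow_pos_of_pos (sub_pos.2 hab) _
  rw [incCor, incCov_self hH hab.le, sq, div_self (by positivity)]

lemma neg_half_le_incCor {H a b c d : ℝ} (hH : 0 ≤ H) (hH1 : H ≤ 1/2) (hab : a < b) (hcd : c < d) :
    -(1 / 2) ≤ incCor H a b c d := by
  have h1 : 0 < (b - a) ^ H := rpow_pos_of_pos (sub_pos.2 hab) _
  have h2 : 0 < (d - c) ^ H := rpow_pos_of_pos (sub_pos.2 hcd) _
  rw [incCor, le_div_iff₀ (by positivity)]
  have := neg_le_incCov hH hH1 hab.le hcd.le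
  linarith

lemma Continuous.incCor {ι : Type*} [TopologicalSpace ι] {H : ℝ} (hH : 0 < H) {a b c d : ι → ℝ}
    (ha : Continuous a) (hb : Continuous b) (hc : Continuous c) (hd : Continuous d)
    (hab : ∀ i, a i < b i) (hcd : ∀ i, c i < d i) :
    Continuous fun i => incCor H (a i) (b i) (c i) (d i) := by
  have h2 : ∀ x : ι → ℝ, Continuous x → Continuous fun i => |x i| ^ (2*H) := fun x hx =>
    hx.abs.rpow_const fun _ => Or.inr (by positivity)
  have h3 : ∀ x : ι → ℝ, Continuous x → Continuous fun i => x i ^ H := fun x hx =>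
    hx.rpow_const fun _ => Or.inr hH.le
  unfold SheppFBM.incCor incCov
  refine Continuous.div ((((h2 _ (hb.sub hc)).add (h2 _ (ha.sub hd))).sub (h2 _ (hb.sub hd))).sub
    (h2 _ (ha.sub hc)) |>.div_const 2) ((h3 _ (hb.sub ha)).mul (h3 _ (hd.sub hc))) fun i => ?_
  exact (mul_pos (rpow_pos_of_pos (sub_pos.2 (hab i)) _)
    (rpow_pos_of_pos (sub_pos.2 (hcd i)) _)).ne'

namespace FBM

variable {Ω : Type*} [MeasurableSpace Ω] {μ : Measure Ω} {H : ℝ} {B : ℝ → Ω → ℝ}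

lemma integral_std_mul_std (hB : FBM μ H B) {a b c d : ℝ} (ha : 0 ≤ a) (hb : 0 ≤ b) (hc : 0 ≤ c)
    (hd : 0 ≤ d) :
    ∫ ω, (B b ω - B a ω) / (b - a) ^ H * ((B d ω - B c ω) / (d - c) ^ H) ∂μ =
      incCor H a b c d := by
  rw [incCor, ← hB.incCov_eq ha hb hc hd, ← integral_div]
  congr 1; ext ω; rw [div_mul_div_comm]

lemma std_mem {Ω : Type*} {B : ℝ → Ω → ℝ} (a b : ℝ) :
    (fun ω => (B b ω - B a ω) / (b - a) ^ H) ∈ Submodule.span ℝ (range B) := by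
  have := (Submodule.span ℝ (range B)).smul_mem ((b - a) ^ H)⁻¹ (sub_mem (B := B) a b)
  convert this using 1
  ext ω; simp only [Pi.smul_apply, smul_eq_mul]; rw [div_eq_inv_mul]

lemma exceed_square_inter_subset {Ω : Type*} {B : ℝ → Ω → ℝ} {a b a' b' q lam u : ℝ} (hH : 0 < H)
    (hq : 0 < q) (hu : 0 < u) (hab : 0 < b - a - lam / q) (hab1 : b - a + lam / q ≤ 1)
    (hab' : 0 < b' - a' - lam / q) (hab1' : b' - a' + lam / q ≤ 1) :
    exceed B (square a b (lam / q)) u ∩ exceed B (square a' b' (lam / q)) u ⊆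
      {ω | ∃ t : Fin 4 → Icc (0:ℝ) lam, 2 * u <
        (B (b + t 1 / q) ω - B (a + t 0 / q) ω) / ((b + t 1 / q) - (a + t 0 / q)) ^ H +
        (B (b' + t 3 / q) ω - B (a' + t 2 / q) ω) / ((b' + t 3 / q) - (a' + t 2 / q)) ^ H} := by
  have hmem : ∀ x y : ℝ, x ∈ Icc y (y + lam / q) → (x - y) * q ∈ Icc 0 lam := by
    intro x y hx
    refine ⟨mul_nonneg (sub_nonneg.2 hx.1) hq.le, ?_⟩
    rw [← le_div_iff₀ hq]; linarith [hx.2]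
  have key : ∀ x y z : ℝ, 0 < x → x ≤ 1 → u < z → u < z / x ^ H := by
    intro x y z hx hx1 hz
    rw [lt_div_iff₀ (rpow_pos_of_pos hx _)]
    exact (mul_le_of_le_one_right hu.le (rpow_le_one hx.le hx1 hH.le)).trans_lt hz
  rintro ω ⟨⟨p, ⟨h1, h2⟩, h3⟩, ⟨p', ⟨h1', h2'⟩, h3'⟩⟩
  refine ⟨![⟨(p.1 - a) * q, hmem _ _ h1⟩, ⟨(p.2 - b) * q, hmem _ _ h2⟩,
    ⟨(p'.1 - a') * q, hmem _ _ h1'⟩, ⟨(p'.2 - b') * q, hmem _ _ h2'⟩], ?_⟩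
  have e1 : ∀ x y : ℝ, y + (x - y) * q / q = x := fun x y => by
    rw [mul_div_cancel_right₀ _ hq.ne', add_sub_cancel]
  simp only [Matrix.cons_val, e1]
  have k1 := key (p.2 - p.1) 0 _ (by linarith [h1.2, h2.1]) (by linarith [h1.1, h2.2]) h3
  have k2 := key (p'.2 - p'.1) 0 _ (by linarith [h1'.2, h2'.1]) (by linarith [h1'.1, h2'.2]) h3'
  linarith

lemma measureReal_exceed_inter_le (hB : FBM μ H B) (hH : 0 < H) (hH1 : H ≤ 1/2)
    {a b a' b' q lam u D : ℝ} (hq : 0 < q) (hu : 0 < u) (hl : 0 ≤ lam) (ha : 0 ≤ a) (ha' : 0 ≤ a')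
    (hlq : lam / q ≤ 1/20) (hab : 19/20 ≤ b - a - lam / q) (hab1 : b - a + lam / q ≤ 1)
    (hab' : 19/20 ≤ b' - a' - lam / q) (hab1' : b' - a' + lam / q ≤ 1)
    (hD0 : 0 ≤ D) (hD1 : D ≤ 1/2)
    (hcorr : ∀ p ∈ square a b (lam / q), ∀ p' ∈ square a' b' (lam / q),
      incCor H p.1 p.2 p'.1 p'.2 ≤ 1 - 2 * D)
    (hqu : 20 * u ^ 2 ≤ q ^ (2*H)) (hlu : 32 * lam ^ (2*H) ≤ u ^ 2)
    (hi : Integrable (fun ω => exp (pickSup H B lam ω)) μ) :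
    μ.real (exceed B (square a b (lam / q)) u ∩ exceed B (square a' b' (lam / q)) u) ≤
      millsTail u * exp (-(u ^ 2 * (D / 2))) * exp (8 * (lam ^ (2*H)) ^ 2 / u ^ 2) *
        pickMean μ H B lam ^ 4 := by
  have := hB.gauss.isProbabilityMeasure
  have h0 : ∀ t : Icc (0:ℝ) lam, 0 ≤ (t:ℝ) / q := fun t => div_nonneg t.2.1 hq.le
  have h1 : ∀ t : Icc (0:ℝ) lam, (t:ℝ) / q ≤ lam / q := fun t =>
    div_le_div_of_nonneg_right t.2.2 hq.le
  set I := Fin 4 → Icc (0:ℝ) lam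
  set A : I → ℝ := fun t => a + t 0 / q
  set C : I → ℝ := fun t => b + t 1 / q
  set A' : I → ℝ := fun t => a' + t 2 / q 
  set C' : I → ℝ := fun t => b' + t 3 / q
  have hτ : ∀ t : I, 19/20 ≤ C t - A t := fun t => by
    simp only [A, C]; linarith [h0 (t 1), h1 (t 0)]
  have hτ' : ∀ t : I, 19/20 ≤ C' t - A' t := fun t => by
    simp only [A', C']; linarith [h0 (t 3), h1 (t 2)]
  have hAC : ∀ t : I, A t < C t := fun t => by linarith [hτ t]
  have hAC' : ∀ t : I, A' t < C' t := fun t => by linarith [hτ' t]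
  have hA0 : ∀ t : I, 0 ≤ A t := fun t => add_nonneg ha (h0 _)
  have hA0' : ∀ t : I, 0 ≤ A' t := fun t => add_nonneg ha' (h0 _)
  have hC0 : ∀ t : I, 0 ≤ C t := fun t => (hA0 t).trans (hAC t).le
  have hC0' : ∀ t : I, 0 ≤ C' t := fun t => (hA0' t).trans (hAC' t).le
  set r : I → ℝ := fun t => incCor H (A t) (C t) (A' t) (C' t)
  have hr0 : ∀ t, -(1/2) ≤ r t := fun t => neg_half_le_incCor hH.le hH1 (hAC t) (hAC' t)
  have hr1 : ∀ t, r t ≤ 1 - 2 * D := fun t =>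
    hcorr (A t, C t) ⟨⟨le_add_of_nonneg_right (h0 _), add_le_add_right (h1 _) _⟩,
      le_add_of_nonneg_right (h0 _), add_le_add_right (h1 _) _⟩ (A' t, C' t)
      ⟨⟨le_add_of_nonneg_right (h0 _), add_le_add_right (h1 _) _⟩,
      le_add_of_nonneg_right (h0 _), add_le_add_right (h1 _) _⟩
  have hAcont : Continuous A := by simp only [A]; fun_prop
  have hCcont : Continuous C := by simp only [C]; fun_prop
  have hAcont' : Continuous A' := by simp only [A']; fun_prop
  have hCcont' : Continuous C' := by simp only [C']; fun_prop
  have hrc : Continuous r := Continuous.incCor hH hAcont hCcont hAcont' hCcont' hAC hAC'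
  set w := u * (1 + D / 2) with hw
  have huw : u ≤ w := le_mul_of_one_le_right hu.le (by linarith)
  have hw0 : 0 < w := hu.trans_le huw
  set Y : I → Ω → ℝ := fun t ω => (B (C t) ω - B (A t) ω) / (C t - A t) ^ H
  set Y' : I → Ω → ℝ := fun t ω => (B (C' t) ω - B (A' t) ω) / (C' t - A' t) ^ H
  have hYm : ∀ t, Y t ∈ Submodule.span ℝ (range B) := fun t => std_mem _ _
  have hYm' : ∀ t, Y' t ∈ Submodule.span ℝ (range B) := fun t => std_mem _ _
  have hYY : ∀ t, ∫ ω, Y t ω * Y t ω ∂μ = 1 := fun t =>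
    (hB.integral_std_mul_std (hA0 t) (hC0 t) (hA0 t) (hC0 t)).trans (incCor_self hH (hAC t))
  have hYY' : ∀ t, ∫ ω, Y' t ω * Y' t ω ∂μ = 1 := fun t =>
    (hB.integral_std_mul_std (hA0' t) (hC0' t) (hA0' t) (hC0' t)).trans (incCor_self hH (hAC' t))
  have hYr : ∀ t, ∫ ω, Y t ω * Y' t ω ∂μ = r t := fun t =>
    hB.integral_std_mul_std (hA0 t) (hC0 t) (hA0' t) (hC0' t)
  have hYr' : ∀ t, ∫ ω, Y' t ω * Y t ω ∂μ = r t := fun t => by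
    rw [← hYr]; congr 1; ext ω; ring
  have hvar : ∀ t, ∫ ω, (Y t ω + Y' t ω) * (Y t ω + Y' t ω) ∂μ = 2 + 2 * r t := fun t => by
    rw [hB.gauss.integral_add_mul_add (hYm t) (hYm' t) (hYm t) (hYm' t), hYY, hYY', hYr, hYr']; ring
  have hlocal : ∀ a₁ b₁ a₂ b₂ : ℝ, 19/20 ≤ b₁ - a₁ → 19/20 ≤ b₂ - a₂ → |a₁ - a₂| ≤ lam / q →
      |b₁ - b₂| ≤ lam / q → 1 - incDist H a₁ b₁ a₂ b₂ ≤ incCor H a₁ b₁ a₂ b₂ := by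
    intro a₁ b₁ a₂ b₂ g1 g2 g3 g4
    have p1 : 0 < (b₁ - a₁) ^ H := rpow_pos_of_pos (by linarith) _
    have p2 : 0 < (b₂ - a₂) ^ H := rpow_pos_of_pos (by linarith) _
    rw [incCor, le_div_iff₀ (by positivity)]
    refine le_trans ?_ (le_incCov_local (δ := 1/20) hH hH1 (by linarith) (by linarith) (by norm_num)
      (g3.trans hlq) (g4.trans hlq))
    refine mul_le_mul_of_nonneg_right ?_ (by positivity)
    nlinarith [incDist_nonneg H a₁ b₁ a₂ b₂]
  have hq' : 0 < q ^ (2*H) := rpow_pos_of_pos hq _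
  have hdist : ∀ t s : I, incDist H (A t) (C t) (A s) (C s) +
      incDist H (A' t) (C' t) (A' s) (C' s) = locDist H t s / q ^ (2*H) := by
    intro t s
    simp only [incDist, locDist, A, C, A', C', add_sub_add_left_eq_sub, ← sub_div,
      div_rpow_abs hq, Fin.sum_univ_four]
    ring
  have hσ0 : ∀ t, 1 ≤ 2 + 2 * r t := fun t => by linarith [hr0 t]
  have hlam : 0 ≤ lam ^ (2*H) := rpow_nonneg hl _
  have hslep := hB.measureReal_le_locProb (κ := Fin 4) (lam := lam) (w := w) (c := 2 / q ^ (2*H)) hH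
    (by linarith) hw0 (by positivity) ?_ hB.gauss (X := fun t ω => Y t ω + Y' t ω)
    (σ := fun t => √(2 + 2 * r t)) (fun t => Submodule.add_mem _ (hYm t) (hYm' t)) ?_
    (fun t => sqrt_pos.2 (by linarith [hσ0 t])) (by fun_prop)
    (fun t => by rw [hvar, sq_sqrt (by linarith [hσ0 t])]) ?_
  · refine le_trans (measureReal_mono ((exceed_square_inter_subset hH hq hu (by linarith) hab1
      (by linarith) hab1').trans ?_) (measure_ne_top _ _)) (hslep.trans
        ((hB.locProb_le hH hl hw0 hi).trans ?_))
    · rintro ω ⟨t, ht⟩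
      refine ⟨t, lt_of_le_of_lt ?_ ht⟩
      have h2 : √(2 + 2 * r t) ^ 2 ≤ 4 * (1 - D) := by
        rw [sq_sqrt (by linarith [hσ0 t])]; linarith [hr1 t]
      refine abs_le_of_sq_le_sq' (a := √(2 + 2 * r t) * w) ?_ (by positivity) |>.2
      rw [mul_pow, mul_pow, mul_pow]
      have h3 : (1 - D) * (1 + D / 2) ^ 2 ≤ 1 := by nlinarith [sq_nonneg D, mul_nonneg hD0 (sq_nonneg D)]
      have h4 : √(2 + 2 * r t) ^ 2 * (1 + D / 2) ^ 2 ≤ 4 := by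
        nlinarith [mul_le_mul_of_nonneg_right h2 (sq_nonneg (1 + D / 2))]
      nlinarith [mul_le_mul_of_nonneg_right h4 (sq_nonneg u)]
    · have e1 : millsTail w ≤ millsTail u * exp (-(u ^ 2 * (D / 2))) :=
        millsTail_mul_le hu (by linarith)
      have e2 : exp ((2 * Fintype.card (Fin 4) * lam ^ (2*H)) ^ 2 / (8 * w ^ 2)) ≤
          exp (8 * (lam ^ (2*H)) ^ 2 / u ^ 2) := by
        refine exp_le_exp.2 ?_
        have : 8 * (lam ^ (2*H)) ^ 2 / w ^ 2 ≤ 8 * (lam ^ (2*H)) ^ 2 / u ^ 2 :=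
          div_le_div_of_nonneg_left (by positivity) (by positivity) (pow_le_pow_left₀ hu.le huw 2)
        refine le_trans (le_of_eq ?_) this
        rw [Fintype.card_fin]; push_cast; field_simp; ring
      have e3 := mul_le_mul e1 e2 (exp_pos _).le (mul_nonneg (millsTail_pos hu).le (exp_pos _).le)
      rw [Fintype.card_fin]
      exact mul_le_mul_of_nonneg_right e3 (by positivity)
  · rw [Fintype.card_fin]
    have hww : w ^ 2 ≤ 25 / 16 * u ^ 2 := by
      rw [hw, mul_pow]; nlinarith [sq_nonneg u, mul_le_mul_of_nonneg_right
        (show (1 + D / 2) ^ 2 ≤ 25 / 16 by nlinarith) (sq_nonneg u)]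
    have g1 : 2 / q ^ (2*H) * (w ^ 2 + 2 * (4 : ℕ) * lam ^ (2*H)) ≤ 1 / 4 := by
      rw [div_mul_eq_mul_div, div_le_iff₀ hq']
      push_cast
      nlinarith
    have g2 : 2 * (4 : ℕ) * lam ^ (2*H) / (4 * w ^ 2) ≤ 1 / 4 := by
      rw [div_le_iff₀ (by positivity)]
      push_cast
      nlinarith [pow_le_pow_left₀ hu.le huw 2]
    linarith
  · intro ω
    have hBc := hB.cont ω
    simp only [Y, Y']
    refine Continuous.add (Continuous.div (by fun_prop) ((hCcont.sub hAcont).rpow_const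
      fun _ => Or.inr hH.le) fun t => (rpow_pos_of_pos (sub_pos.2 (hAC t)) _).ne')
      (Continuous.div (by fun_prop) ((hCcont'.sub hAcont').rpow_const
      fun _ => Or.inr hH.le) fun t => (rpow_pos_of_pos (sub_pos.2 (hAC' t)) _).ne')
  · intro t s
    refine le_trans ?_ (hB.gauss.le_integral_add_mul_add (hYm t) (hYm' t) (hYm s) (hYm' s))
    rw [hvar, hvar, hB.gauss.integral_sub_mul_self (hYm t) (hYm s),
      hB.gauss.integral_sub_mul_self (hYm' t) (hYm' s), hYY, hYY, hYY', hYY']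
    have c1 : 1 - incDist H (A t) (C t) (A s) (C s) ≤ ∫ ω, Y t ω * Y s ω ∂μ := by
      rw [hB.integral_std_mul_std (hA0 t) (hC0 t) (hA0 s) (hC0 s)]
      exact hlocal _ _ _ _ (hτ t) (hτ s) (abs_sub_le_div hq _ _ _) (abs_sub_le_div hq _ _ _)
    have c2 : 1 - incDist H (A' t) (C' t) (A' s) (C' s) ≤ ∫ ω, Y' t ω * Y' s ω ∂μ := by
      rw [hB.integral_std_mul_std (hA0' t) (hC0' t) (hA0' s) (hC0' s)]
      exact hlocal _ _ _ _ (hτ' t) (hτ' s) (abs_sub_le_div hq _ _ _) (abs_sub_le_div hq _ _ _)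
    have c3 := hdist t s
    set ς := √(2 + 2 * r t)
    set ς' := √(2 + 2 * r s)
    have d1 : ς ^ 2 = 2 + 2 * r t := sq_sqrt (by linarith [hσ0 t])
    have d2 : ς' ^ 2 = 2 + 2 * r s := sq_sqrt (by linarith [hσ0 s])
    have d3 : 1 ≤ ς := one_le_sqrt.2 (hσ0 t)
    have d4 : 1 ≤ ς' := one_le_sqrt.2 (hσ0 s)
    have d5 : 1 ≤ ς * ς' := one_le_mul_of_one_le_of_one_le d3 d4
    have d6 : 0 ≤ locDist H t s / q ^ (2*H) := div_nonneg (locDist_nonneg t s) hq'.le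
    have d7 : 2 / q ^ (2*H) * locDist H t s = 2 * (locDist H t s / q ^ (2*H)) := by ring
    rw [d7]
    nlinarith [sq_nonneg (ς - ς'), mul_nonneg d6 (sub_nonneg.2 d5)]

end FBM

lemma sum_sub_le_measureReal_biUnion {Ω ι : Type*} [MeasurableSpace Ω] {μ : Measure Ω}
    [IsFiniteMeasure μ] [DecidableEq ι] (s : Finset ι) {E : ι → Set Ω}
    (hE : ∀ x, MeasurableSet (E x)) :
    ∑ x ∈ s, (μ.real (E x) - ∑ y ∈ s.erase x, μ.real (E x ∩ E y)) ≤ μ.real (⋃ x ∈ s, E x) := by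
  have hU : ∀ x, MeasurableSet (⋃ y ∈ s.erase x, E y) := fun x =>
    Finset.measurableSet_biUnion _ fun y _ => hE y
  have h1 : ∀ x ∈ s, μ.real (E x) - ∑ y ∈ s.erase x, μ.real (E x ∩ E y) ≤
      μ.real (E x \ ⋃ y ∈ s.erase x, E y) := by
    intro x _
    have h2 := measureReal_inter_add_sdiff (μ := μ) (s := E x) (hU x)
    have h3 : μ.real (E x ∩ ⋃ y ∈ s.erase x, E y) ≤ ∑ y ∈ s.erase x, μ.real (E x ∩ E y) := by
      rw [inter_iUnion₂]
      exact measureReal_biUnion_finset_le _ _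
    linarith
  refine (Finset.sum_le_sum h1).trans ?_
  rw [← measureReal_biUnion_finset _ fun x _ => (hE x).diff (hU x)]
  · exact measureReal_mono (iUnion₂_mono fun x _ => sdiff_subset) (measure_ne_top _ _)
  · intro x hx y hy hxy
    refine disjoint_left.2 fun ω h4 h5 => h5.2 ?_
    exact mem_biUnion (Finset.mem_erase.2 ⟨hxy, hx⟩) h4.1

lemma summable_exp_neg_rpow {α : ℝ} (hα : 0 < α) :
    Summable fun n : ℕ => exp (-(1 / 2) * (n : ℝ) ^ α) := by
  have h1 := isLittleO_exp_neg_mul_rpow_atTop (show (0:ℝ) < 1 / 2 by norm_num) (-2 / α)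
  have h2 : Tendsto (fun n : ℕ => (n : ℝ) ^ α) atTop atTop :=
    (tendsto_rpow_atTop hα).comp tendsto_natCast_atTop_atTop
  refine summable_of_isBigO_nat (g := fun n : ℕ => ((n : ℝ) ^ α) ^ (-2 / α)) ?_
    (h1.comp_tendsto h2).isBigO
  have : ∀ n : ℕ, ((n : ℝ) ^ α) ^ (-2 / α) = (n : ℝ) ^ (-2 : ℝ) := fun n => by
    rw [← rpow_mul (Nat.cast_nonneg n)]; congr 1; field_simp
  simp only [this]
  exact summable_nat_rpow.2 (by norm_num)

lemma exists_lattice_sum_le {α : ℝ} (hα : 0 < α) :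
    ∃ S : ℝ, 0 ≤ S ∧ ∀ K : ℝ, 1 ≤ K → ∀ F : Finset (ℤ × ℤ), (0, 0) ∉ F →
      ∑ p ∈ F, exp (-(K * (|(p.1 : ℝ)| ^ α + |(p.2 : ℝ)| ^ α))) ≤ exp (-(K / 2)) * S := by
  set f : ℤ → ℝ := fun m => exp (-(1 / 2) * |(m : ℝ)| ^ α)
  have hf : Summable f := by
    have := summable_exp_neg_rpow hα
    refine Summable.of_nat_of_neg (this.congr fun n => ?_) (this.congr fun n => ?_) <;> simp [f]
  have hff : Summable fun p : ℤ × ℤ => f p.1 * f p.2 :=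
    hf.mul_of_nonneg hf (fun _ => (exp_pos _).le) fun _ => (exp_pos _).le
  have hnn : ∀ p : ℤ × ℤ, 0 ≤ f p.1 * f p.2 := fun p => mul_nonneg (exp_pos _).le (exp_pos _).le
  refine ⟨∑' p : ℤ × ℤ, f p.1 * f p.2, tsum_nonneg hnn, fun K hK F hF => ?_⟩
  refine le_trans (Finset.sum_le_sum fun p hp => ?_) ((Finset.mul_sum F
    (fun p : ℤ × ℤ => f p.1 * f p.2) (exp (-(K / 2)))).symm.le.trans
      (mul_le_mul_of_nonneg_left (hff.sum_le_tsum F fun p _ => hnn p) (exp_pos _).le))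
  simp only [f]
  rw [← exp_add, ← exp_add]
  refine exp_le_exp.2 ?_
  have h1 : ∀ m : ℤ, m ≠ 0 → 1 ≤ |(m : ℝ)| ^ α := fun m hm =>
    one_le_rpow (by exact_mod_cast Int.one_le_abs hm) hα.le
  have h0 : ∀ m : ℤ, 0 ≤ |(m : ℝ)| ^ α := fun m => rpow_nonneg (abs_nonneg _) _
  have h2 : 1 ≤ |(p.1 : ℝ)| ^ α + |(p.2 : ℝ)| ^ α := by
    by_cases hp1 : p.1 = 0
    · have hp2 : p.2 ≠ 0 := fun h => hF (by convert hp using 1; exact Prod.ext hp1.symm h.symm)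
      linarith [h1 _ hp2, h0 p.1]
    · linarith [h1 _ hp1, h0 p.2]
  nlinarith

lemma le_millsTail_mul {u x ρ : ℝ} (hu : 0 < u) (hx : 0 ≤ x) (hxρ : x ≤ ρ - 1) :
    millsTail u * (ρ⁻¹ * exp (-(u ^ 2 * (ρ * x)))) ≤ millsTail (u * (1 + x)) := by
  have hρ : 0 < ρ := by linarith
  unfold millsTail
  have e : exp (-(u ^ 2 / 2)) / (√(2 * π) * u) * (ρ⁻¹ * exp (-(u ^ 2 * (ρ * x)))) =
      exp (-(u ^ 2 / 2) + -(u ^ 2 * (ρ * x))) / (√(2 * π) * (u * ρ)) := by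
    rw [exp_add]; field_simp
  rw [e]
  refine div_le_div₀ (exp_pos _).le (exp_le_exp.2 ?_) (by positivity) ?_
  · nlinarith [mul_nonneg (sq_nonneg u) (mul_nonneg hx (by linarith : 0 ≤ ρ - 1 - x / 2))]
  · exact mul_le_mul_of_nonneg_left (mul_le_mul_of_nonneg_left (by linarith) hu.le) (sqrt_nonneg _)

lemma one_le_one_sub_rpow_mul {H x ρ : ℝ} (hH : 0 ≤ H) (hH1 : H ≤ 1) (hρ : 0 < ρ) (hx : 0 ≤ x)
    (hxρ : x ≤ (ρ - 1) / ρ) : 1 ≤ (1 - x) ^ H * (1 + H * ρ * x) := by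
  have h1 : ρ⁻¹ ≤ 1 - x := by
    have : (ρ - 1) / ρ = 1 - ρ⁻¹ := by field_simp
    linarith
  have h2 : 0 < 1 - x := (inv_pos.2 hρ).trans_le h1
  have h3 : (1 - x)⁻¹ ≤ ρ := inv_le_of_inv_le₀ hρ h1
  have h4 : (1 - x)⁻¹ = 1 + x * (1 - x)⁻¹ := by field_simp; ring
  have h5 : ((1 - x)⁻¹) ^ H ≤ 1 + H * ρ * x := by
    rw [h4]
    refine (rpow_one_add_le_one_add_mul_self (by
      have := mul_nonneg hx (inv_nonneg.2 h2.le); linarith) hH hH1).trans ?_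
    nlinarith [mul_nonneg hH hx, mul_le_mul_of_nonneg_left h3 (mul_nonneg hH hx)]
  calc (1:ℝ) = (1 - x) ^ H * ((1 - x)⁻¹) ^ H := by
        rw [← mul_rpow h2.le (inv_nonneg.2 h2.le), mul_inv_cancel₀ h2.ne', one_rpow]
    _ ≤ _ := mul_le_mul_of_nonneg_left h5 (rpow_nonneg h2.le _)

lemma mul_abs_sub_le_abs_sub {i j : ℤ} {h γ l x y : ℝ} (hγ : 0 ≤ γ) (hl : 0 ≤ l)
    (hh : h = (1 + γ) * l) (hx : x ∈ Icc (i * h) (i * h + l)) (hy : y ∈ Icc (j * h) (j * h + l)) :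
    γ * l * |((i - j : ℤ) : ℝ)| ≤ |x - y| := by
  wlog hij : j ≤ i generalizing i j x y
  · rw [abs_sub_comm x y, ← abs_neg, ← Int.cast_neg, neg_sub]
    exact this hy hx (le_of_not_ge hij)
  rcases hij.eq_or_lt with rfl | hij
  · simp
  · have h1 : (1:ℝ) ≤ i - j := by
      have : (j:ℝ) + 1 ≤ i := by exact_mod_cast hij
      linarith
    push_cast
    rw [abs_of_nonneg (by linarith)]
    refine le_trans ?_ (le_abs_self _)
    have h2 : (i:ℝ) * h - (j * h + l) ≤ x - y := by linarith [hx.1, hy.2]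
    rw [hh] at h2
    nlinarith [mul_le_mul_of_nonneg_right h1 hl]

namespace FBM

variable {Ω : Type*} [MeasurableSpace Ω] {μ : Measure Ω} {H HH : ℝ} {B : ℝ → Ω → ℝ}

lemma eventually_le_measureReal_exceed_square (hB : FBM μ H B) (hH : 0 < H) (hH1 : H < 1/2)
    {κ ρ lam A c : ℝ} (hκ : 0 < κ) (hκ1 : κ < 1) (hρ : 1 < ρ) (hl : 0 ≤ lam)
    (hi : Integrable (fun ω => exp (pickSup H B lam ω)) μ) (hc : c < pickMean μ H B lam ^ 2)
    (hc0 : 0 ≤ c) :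
    ∀ᶠ u in atTop, ∀ a b x : ℝ, 0 ≤ a → b - a + lam / clumpScale H κ u ≤ 1 → 0 ≤ x →
      1 - x ≤ b - a - lam / clumpScale H κ u → H * u ^ 2 * x ≤ A →
      millsTail u * (ρ⁻¹ * exp (-(u ^ 2 * (ρ * (H * ρ * x))))) * c ≤
        μ.real (exceed B (square a b (lam / clumpScale H κ u)) u) := by
  have hc' : c < pickMean μ H B lam ^ Fintype.card (Fin 2) := by rwa [Fintype.card_fin]
  obtain ⟨W, hW⟩ := eventually_atTop.1 (eventually_le_locProb hB hH hl hi hc')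
  have hu2 : Tendsto (fun u : ℝ => u ^ 2) atTop atTop := tendsto_pow_atTop two_ne_zero
  have hh : Tendsto (fun u => lam / clumpScale H κ u) atTop (nhds 0) :=
    (tendsto_clumpScale hH hκ).const_div_atTop lam
  have hx0 : Tendsto (fun u : ℝ => A / H / u ^ 2) atTop (nhds 0) := hu2.const_div_atTop _
  have hρ0 : 0 < ρ := by linarith
  filter_upwards [eventually_ge_atTop W, eventually_gt_atTop 0,
    hh.eventually (gt_mem_nhds (show (0:ℝ) < (1 - κ) / 10 by linarith)),
    hx0.eventually (gt_mem_nhds (show (0:ℝ) < (ρ - 1) / ρ by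
      exact div_pos (by linarith) (by linarith))),
    hx0.eventually (gt_mem_nhds (show (0:ℝ) < 1/4 by norm_num))] with u huW hu h1 h2 h3
  intro a b x ha hab1 hx hab hxA
  have hxA' : x ≤ A / H / u ^ 2 := by
    rw [le_div_iff₀ (by positivity), le_div_iff₀ hH]; linarith
  set q := clumpScale H κ u with hq
  have hqp : 0 < q := clumpScale_pos hκ hu
  have hy : 0 ≤ H * ρ * x := by positivity
  have hxρ : x ≤ (ρ - 1) / ρ := by linarith
  have hxρ' : ρ * x ≤ ρ - 1 := by rw [le_div_iff₀ hρ0] at hxρ; linarith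
  have hyρ : H * ρ * x ≤ ρ - 1 := by nlinarith [mul_nonneg hρ0.le hx]
  set w := u * (1 + H * ρ * x) with hw
  have hwu : u ≤ w := by rw [hw]; nlinarith [mul_nonneg hu.le hy]
  have key := hB.locProb_le_measureReal_exceedStd_square hH hH1.le (δ := (1 - κ) / 10) (a := a)
    (b := b) (lam := lam) (q := q) (w := w) hqp (by linarith) ha (by linarith) h1.le hl
    (by linarith) hab1 (by
      rw [hq, clumpScale_rpow hH hκ]
      have e : (1 - 10 * ((1 - κ) / 10)) / 2 / (κ * u ^ 2 / 2) * w ^ 2 = (w / u) ^ 2 := by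
        field_simp; ring
      rw [e]
      exact one_le_pow₀ ((one_le_div hu).2 hwu))
  have hsub : exceedStd H B (square a b (lam / q)) w ⊆ exceed B (square a b (lam / q)) u := by
    rintro ω ⟨p, hp, hpu⟩
    refine ⟨p, hp, lt_of_le_of_lt ?_ hpu⟩
    have hp1 := hp.1.1
    have hp2 := hp.1.2
    have hp3 := hp.2.1
    have h4 : 1 - x ≤ p.2 - p.1 := by linarith
    have h5 : (1 - x) ^ H ≤ (p.2 - p.1) ^ H := rpow_le_rpow (by linarith) h4 hH.le
    have h6 := one_le_one_sub_rpow_mul hH.le (by linarith) hρ0 hx hxρ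
    calc u = 1 * u := (one_mul u).symm
      _ ≤ ((1 - x) ^ H * (1 + H * ρ * x)) * u := by gcongr
      _ ≤ ((p.2 - p.1) ^ H * (1 + H * ρ * x)) * u := by gcongr
      _ = _ := by rw [hw]; ring
  calc _ ≤ millsTail w * c :=
        mul_le_mul_of_nonneg_right (le_millsTail_mul hu hy hyρ) hc0
    _ ≤ locProb μ H B (Fin 2) lam w := hW w (huW.trans hwu)
    _ ≤ _ := key
    _ ≤ _ := by
      have := hB.gauss.isProbabilityMeasure
      exact measureReal_mono hsub (measure_ne_top _ _)

lemma eventually_measureReal_exceed_inter_le (hB : FBM μ H B) (hH : 0 < H) (hH1 : H < 1/2)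
    {κ lam lam' : ℝ} (hκ : 0 < κ) (hl : 0 ≤ lam)
    (hl' : lam' = lam * (40 / κ) ^ (1 / (2 * H)))
    (hi : Integrable (fun ω => exp (pickSup H B lam' ω)) μ) :
    ∀ᶠ u in atTop, ∀ a b a' b' s M : ℝ, 0 ≤ a → 0 ≤ a' →
      19/20 ≤ b - a - lam / clumpScale H κ u → b - a + lam / clumpScale H κ u ≤ 1 →
      19/20 ≤ b' - a' - lam / clumpScale H κ u → b' - a' + lam / clumpScale H κ u ≤ 1 →
      0 ≤ s → 1 ≤ M → s ≤ 2 * M →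
      (∀ p ∈ square a b (lam / clumpScale H κ u), ∀ p' ∈ square a' b' (lam / clumpScale H κ u),
        s ≤ incDist H p.1 p.2 p'.1 p'.2) →
      μ.real (exceed B (square a b (lam / clumpScale H κ u)) u ∩
          exceed B (square a' b' (lam / clumpScale H κ u)) u) ≤
        2 * pickMean μ H B lam' ^ 4 * millsTail u * exp (-(u ^ 2 * (s / (16 * M)))) := by
  have hu2 : Tendsto (fun u : ℝ => u ^ 2) atTop atTop := tendsto_pow_atTop two_ne_zero
  have hh : Tendsto (fun u => lam / clumpScale H κ u) atTop (nhds 0) :=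
    (tendsto_clumpScale hH hκ).const_div_atTop lam
  have hl0 : 0 ≤ lam' := by rw [hl']; positivity
  have hx0 : Tendsto (fun u : ℝ => exp (8 * (lam' ^ (2*H)) ^ 2 / u ^ 2)) atTop (nhds 1) := by
    have := (continuous_exp.tendsto 0).comp (hu2.const_div_atTop (8 * (lam' ^ (2*H)) ^ 2))
    rwa [exp_zero] at this
  filter_upwards [eventually_gt_atTop 0, hh.eventually (gt_mem_nhds (show (0:ℝ) < 1/20 by norm_num)),
    hx0.eventually (gt_mem_nhds (show (1:ℝ) < 2 by norm_num)),
    hu2.eventually_ge_atTop (32 * lam' ^ (2*H))] with u hu h1 h2 h3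
  intro a b a' b' s M ha ha' hab hab1 hab' hab1' hs hM hsM hS
  have e : lam / clumpScale H κ u = lam' / clumpScale H 40 u := by
    have : clumpScale H 40 u = clumpScale H κ u * (40 / κ) ^ (1 / (2 * H)) := by
      unfold clumpScale
      rw [← mul_rpow (by positivity) (by positivity)]
      congr 1; field_simp
    have h0 : (0:ℝ) < (40 / κ) ^ (1 / (2 * H)) := by positivity
    rw [this, hl', mul_div_mul_right _ _ h0.ne']
  rw [e] at h1 hab hab1 hab' hab1' hS ⊢
  have hlen : ∀ {x y : ℝ}, ∀ p ∈ square x y (lam' / clumpScale H 40 u),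
      y - x - lam' / clumpScale H 40 u ≤ p.2 - p.1 ∧
      p.2 - p.1 ≤ y - x + lam' / clumpScale H 40 u := by
    rintro x y p ⟨⟨hp1, hp2⟩, hp3, hp4⟩
    constructor <;> linarith
  have hDM : s / (8 * M) ≤ 1 / 4 := by
    rw [div_le_div_iff₀ (by positivity) (by norm_num)]; linarith
  have hsM' : s / M ≤ s := div_le_self hs hM
  have h8 : s / (8 * M) = s / M / 8 := by rw [mul_comm, div_div]
  refine (hB.measureReal_exceed_inter_le hH hH1.le (D := s / (8 * M))
    (clumpScale_pos (by norm_num) hu) hu hl0 ha ha' h1.le hab hab1 hab' hab1' (by positivity)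
    (by linarith) ?_ ?_ h3 hi).trans ?_
  · intro p hp p' hp'
    obtain ⟨h4, h5⟩ := hlen p hp
    obtain ⟨h6, h7⟩ := hlen p' hp'
    have hpos : 0 < (p.2 - p.1) ^ H * (p'.2 - p'.1) ^ H :=
      mul_pos (rpow_pos_of_pos (by linarith) _) (rpow_pos_of_pos (by linarith) _)
    rw [incCor, div_le_iff₀ hpos]
    refine (incCov_le_global hH hH1.le (δ := 1/20) le_rfl (by linarith) (by linarith) (by linarith)
      (by linarith)).trans (mul_le_mul_of_nonneg_right (max_le (by linarith) ?_) hpos.le)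
    have := hS p hp p' hp'
    linarith
  · rw [clumpScale_rpow hH (by norm_num)]; linarith
  · have hP : 0 ≤ pickMean μ H B lam' := integral_nonneg fun ω => (exp_pos _).le
    have hm := (millsTail_pos hu).le
    have e2 : s / (8 * M) / 2 = s / (16 * M) := by rw [div_div]; congr 1; ring
    rw [e2]
    calc millsTail u * exp (-(u ^ 2 * (s / (16 * M)))) * exp (8 * (lam' ^ (2*H)) ^ 2 / u ^ 2) *
          pickMean μ H B lam' ^ 4
        ≤ millsTail u * exp (-(u ^ 2 * (s / (16 * M)))) * 2 * pickMean μ H B lam' ^ 4 := by gcongr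
      _ = _ := by ring

end FBM

namespace FBM

variable {Ω : Type*} [MeasurableSpace Ω] {μ : Measure Ω} {H HH : ℝ} {B : ℝ → Ω → ℝ}

lemma le_measureReal_exceed_strip_of_cells (hB : FBM μ H B) (hH : 0 < H) (hH1 : H < 1/2)
    {h l γ L u C S A : ℝ} {N K : ℕ} {G : ℝ → ℝ} (hγ : 0 ≤ γ) (hl : 0 ≤ l) (hh : h = (1 + γ) * l)
    (hNL : N * h ≤ L) (hL : 0 ≤ L) (hK : (K + 1) * h ≤ 1/20) (hA : H * u ^ 2 * ((K + 1) * h) ≤ A)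
    (hC : 0 ≤ C)
    (hS : ∀ K : ℝ, 1 ≤ K → ∀ F : Finset (ℤ × ℤ), (0, 0) ∉ F →
      ∑ p ∈ F, exp (-(K * (|(p.1 : ℝ)| ^ (2*H) + |(p.2 : ℝ)| ^ (2*H)))) ≤ exp (-(K / 2)) * S)
    (hcell : ∀ a b x : ℝ, 0 ≤ a → b - a + l ≤ 1 → 0 ≤ x → 1 - x ≤ b - a - l →
      H * u ^ 2 * x ≤ A → G x ≤ μ.real (exceed B (square a b l) u))
    (hpair : ∀ a b a' b' s M : ℝ, 0 ≤ a → 0 ≤ a' → 19/20 ≤ b - a - l → b - a + l ≤ 1 →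
      19/20 ≤ b' - a' - l → b' - a' + l ≤ 1 → 0 ≤ s → 1 ≤ M → s ≤ 2 * M →
      (∀ p ∈ square a b l, ∀ p' ∈ square a' b' l, s ≤ incDist H p.1 p.2 p'.1 p'.2) →
      μ.real (exceed B (square a b l) u ∩ exceed B (square a' b' l) u) ≤
        C * exp (-(u ^ 2 * (s / (16 * M)))))
    (hK0 : 1 ≤ u ^ 2 * (γ * l) ^ (2*H) / (16 * (L + 2))) :
    N * ∑ k ∈ Finset.range K, G ((k + 2) * h) -
      N * K * (C * (exp (-(u ^ 2 * (γ * l) ^ (2*H) / (16 * (L + 2)) / 2)) * S)) ≤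
      μ.real (exceed B (strip 0 L 0 1) u) := by
  have := hB.gauss.isProbabilityMeasure
  have hh0 : 0 ≤ h := by rw [hh]; positivity
  have hlh : l ≤ h := by rw [hh]; nlinarith [mul_nonneg hγ hl]
  set a : ℕ × ℕ → ℝ := fun p => p.1 * h
  set b : ℕ × ℕ → ℝ := fun p => 1 + ((p.1:ℝ) - p.2 - 1) * h
  set E : ℕ × ℕ → Set Ω := fun p => exceed B (square (a p) (b p) l) u
  set I := Finset.range N ×ˢ Finset.range K
  have hI : ∀ p ∈ I, 0 ≤ a p ∧ a p + l ≤ L ∧ b p - a p + l ≤ 1 ∧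
      b p - a p - l ≥ 1 - ((p.2:ℝ) + 2) * h ∧ ((p.2:ℝ) + 2) * h ≤ (K + 1) * h := by
    intro p hp
    obtain ⟨hp1, hp2⟩ := Finset.mem_product.1 hp
    have h1 : (p.1 : ℝ) + 1 ≤ N := by exact_mod_cast Finset.mem_range.1 hp1
    have h2 : (p.2 : ℝ) + 1 ≤ K := by exact_mod_cast Finset.mem_range.1 hp2
    have h3 := mul_le_mul_of_nonneg_right h1 hh0
    have h4 := mul_le_mul_of_nonneg_right h2 hh0
    have h5 : 0 ≤ (p.2:ℝ) * h := by positivity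
    refine ⟨by positivity, by simp only [a]; linarith, by simp only [a, b]; linarith,
      by simp only [a, b]; linarith, by linarith⟩
  have hsub : (⋃ p ∈ I, E p) ⊆ exceed B (strip 0 L 0 1) u := by
    refine iUnion₂_subset fun p hp => exceed_mono ?_ u
    obtain ⟨h1, h2, h3, h4, h5⟩ := hI p hp
    rintro x ⟨⟨hx1, hx2⟩, hx3, hx4⟩
    refine ⟨⟨by linarith, by linarith⟩, by linarith, by linarith⟩
  refine le_trans ?_ ((sum_sub_le_measureReal_biUnion I
    (E := E) fun p => hB.measurableSet_exceed _ _).trans (measureReal_mono hsub (measure_ne_top _ _)))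
  set K0 := u ^ 2 * (γ * l) ^ (2*H) / (16 * (L + 2)) with hK0d
  have hpairs : ∀ p ∈ I, ∑ p' ∈ I.erase p, μ.real (E p ∩ E p') ≤ C * (exp (-(K0 / 2)) * S) := by
    intro p hp
    set f : ℕ × ℕ → ℤ × ℤ := fun p' => ((p.1:ℤ) - p'.1, ((p.1:ℤ) - p.2 - 1) - (p'.1 - p'.2 - 1))
    have hf : Function.Injective f := by
      rintro ⟨x, y⟩ ⟨x', y'⟩ hxy
      simp only [f, Prod.mk.injEq] at hxy
      ext <;> simp only <;> omega
    have hle : ∀ p' ∈ I.erase p, μ.real (E p ∩ E p') ≤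
        C * exp (-(K0 * (|((f p').1 : ℝ)| ^ (2*H) + |((f p').2 : ℝ)| ^ (2*H)))) := by
      intro p' hp'
      obtain ⟨h1, h2, h3, h4, h5⟩ := hI p hp
      obtain ⟨h1', h2', h3', h4', h5'⟩ := hI p' (Finset.mem_of_mem_erase hp')
      set s := (γ * l) ^ (2*H) * (|((f p').1 : ℝ)| ^ (2*H) + |((f p').2 : ℝ)| ^ (2*H)) with hs
      have hs0 : 0 ≤ s := by positivity
      have hdist : ∀ x ∈ square (a p) (b p) l, ∀ x' ∈ square (a p') (b p') l,
          s ≤ incDist H x.1 x.2 x'.1 x'.2 := by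
        rintro x ⟨hx1, hx2, hx3⟩ x' ⟨hx1', hx2', hx3'⟩
        have h6 := mul_abs_sub_le_abs_sub (i := p.1) (j := p'.1) (h := h) hγ hl hh
          (by simpa [a] using hx1) (by simpa [a] using hx1')
        have h7 := mul_abs_sub_le_abs_sub (i := (p.1:ℤ) - p.2 - 1) (j := (p'.1:ℤ) - p'.2 - 1)
          (h := h) (x := x.2 - 1) (y := x'.2 - 1) hγ hl hh
          (by push_cast; simp only [b] at hx2 hx3; exact ⟨by linarith, by linarith⟩)
          (by push_cast; simp only [b] at hx2' hx3'; exact ⟨by linarith, by linarith⟩)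
        rw [show x.2 - 1 - (x'.2 - 1) = x.2 - x'.2 by ring] at h7
        rw [hs, mul_add, ← mul_rpow (by positivity) (abs_nonneg _),
          ← mul_rpow (by positivity) (abs_nonneg _)]
        exact add_le_add (rpow_le_rpow (by positivity) h6 (by positivity))
          (rpow_le_rpow (by positivity) h7 (by positivity))
      have hle1 : ∀ x : ℝ, |x| ≤ L + 2 → |x| ^ (2*H) ≤ L + 2 := fun x hx =>
        (rpow_le_rpow (abs_nonneg _) hx (by positivity)).trans
          ((rpow_le_rpow_of_exponent_le (by linarith) (by linarith)).trans_eq (rpow_one _))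
      have hsM : s ≤ 2 * (L + 2) := by
        refine (hdist (a p, b p) ⟨⟨le_rfl, by simpa using hl⟩, le_rfl, by simpa using hl⟩
          (a p', b p') ⟨⟨le_rfl, by simpa using hl⟩, le_rfl, by simpa using hl⟩).trans ?_
        have h6 := hle1 (a p - a p') (abs_le.2 ⟨by linarith, by linarith⟩)
        have h7 := hle1 (b p - b p') (abs_le.2 ⟨by linarith, by linarith⟩)
        simp only [incDist]; linarith
      refine (hpair (a p) (b p) (a p') (b p') s (L + 2) h1 h1' (by linarith) h3 (by linarith) h3'
        hs0 (by linarith) hsM hdist).trans (le_of_eq ?_)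
      congr 2
      rw [hs, hK0d]; ring
    refine (Finset.sum_le_sum hle).trans ?_
    rw [← Finset.mul_sum]
    refine mul_le_mul_of_nonneg_left ?_ hC
    refine le_trans (le_of_eq ?_) (hS K0 hK0 ((I.erase p).map ⟨f, hf⟩) ?_)
    · rw [Finset.sum_map]; rfl
    · intro h0
      obtain ⟨p', hp', h1⟩ := Finset.mem_map.1 h0
      have h2 : p' = p := hf (by rw [show f p' = (0, 0) from h1]; simp [f])
      exact Finset.ne_of_mem_erase hp' h2
  have hcard : (I.card : ℝ) = N * K := by simp [I]
  calc _ = ∑ p ∈ I, (G (((p.2:ℝ) + 2) * h) - C * (exp (-(K0 / 2)) * S)) := by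
        rw [Finset.sum_sub_distrib, Finset.sum_const, nsmul_eq_mul, hcard, Finset.sum_product]
        simp
    _ ≤ _ := Finset.sum_le_sum fun p hp => by
        obtain ⟨h1, h2, h3, h4, h5⟩ := hI p hp
        refine sub_le_sub (hcell _ _ _ h1 h3 (by positivity) h4 ?_) (hpairs p hp)
        exact (mul_le_mul_of_nonneg_left h5 (by positivity)).trans hA

end FBM

lemma exists_lt_mul_one_sub_exp {H ε : ℝ} (hε : 0 < ε) :
    ∃ η ∈ Ioo (0:ℝ) 1, ∃ A > 0, 1 - ε < (1 - η) ^ (1 / H) * ((1 + η) ^ 2)⁻¹ * ((1 + η) ^ 3)⁻¹ *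
      (1 - η) * (1 - exp (-((1 + η) ^ 2 * A))) := by
  have h1 : ContinuousAt (fun η : ℝ => (1 - η) ^ (1 / H) * ((1 + η) ^ 2)⁻¹ * ((1 + η) ^ 3)⁻¹ *
      (1 - η)) 0 := by
    refine ContinuousAt.mul (ContinuousAt.mul (ContinuousAt.mul ?_ ?_) ?_) (by fun_prop)
    · exact ContinuousAt.rpow_const (by fun_prop) (Or.inl (by norm_num))
    · exact ContinuousAt.inv₀ (by fun_prop) (by norm_num)
    · exact ContinuousAt.inv₀ (by fun_prop) (by norm_num)
  have h2 := (h1.tendsto.mono_left (nhdsWithin_le_nhds (s := Ioi 0))).eventually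
    (lt_mem_nhds (show 1 - ε < _ by norm_num; exact hε))
  obtain ⟨η, h3, hη⟩ := (h2.and (Ioo_mem_nhdsGT (show (0:ℝ) < 1 by norm_num))).exists
  refine ⟨η, hη, ?_⟩
  have hη0 : 0 < 1 + η := by linarith [hη.1]
  have h4 : Tendsto (fun A : ℝ => (1 - η) ^ (1 / H) * ((1 + η) ^ 2)⁻¹ * ((1 + η) ^ 3)⁻¹ *
      (1 - η) * (1 - exp (-((1 + η) ^ 2 * A)))) atTop (nhds ((1 - η) ^ (1 / H) *
      ((1 + η) ^ 2)⁻¹ * ((1 + η) ^ 3)⁻¹ * (1 - η) * (1 - 0))) := by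
    refine (Tendsto.const_sub 1 ?_).const_mul _
    exact tendsto_exp_neg_atTop_nhds_zero.comp (tendsto_id.const_mul_atTop (by positivity))
  rw [sub_zero, mul_one] at h4
  obtain ⟨A, h5, h6⟩ := ((h4.eventually (lt_mem_nhds h3)).and (eventually_gt_atTop 0)).exists
  exact ⟨A, h6, h5⟩

lemma tendsto_sq_mul_exp_neg_rpow {c α : ℝ} (hc : 0 < c) (hα : 0 < α) :
    Tendsto (fun x : ℝ => x ^ 2 * exp (-(c * x ^ α))) atTop (nhds 0) := by
  refine ((tendsto_rpow_mul_exp_neg_mul_atTop_nhds_zero (2 / α) c hc).comp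
    (tendsto_rpow_atTop hα)).congr' ?_
  filter_upwards [eventually_gt_atTop 0] with x hx
  simp only [Function.comp]
  rw [← rpow_mul hx.le, mul_div_cancel₀ _ hα.ne', neg_mul, rpow_two]

lemma le_sum_exp_neg {y : ℝ} (hy : 0 < y) (K : ℕ) :
    exp (-(2 * y)) * (1 - exp (-(y * K))) / y ≤ ∑ k ∈ Finset.range K, exp (-(y * (k + 2))) := by
  have h1 : ∀ k : ℕ, exp (-(y * (k + 2))) = exp (-(2 * y)) * exp (-y) ^ k := fun k => by
    rw [← exp_nat_mul, ← exp_add]; congr 1; ring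
  have h2 : exp (-y) < 1 := by rw [← exp_zero]; exact exp_lt_exp.2 (by linarith)
  simp only [h1]
  rw [← Finset.mul_sum, geom_sum_eq h2.ne, mul_div_assoc, ← exp_nat_mul]
  refine mul_le_mul_of_nonneg_left ?_ (exp_pos _).le
  have e : (exp (K * -y) - 1) / (exp (-y) - 1) = (1 - exp (-(y * K))) / (1 - exp (-y)) := by
    rw [← neg_div_neg_eq, neg_sub, neg_sub]; congr 4; ring
  rw [e]
  have h3 : exp (-(y * K)) ≤ 1 := by
    rw [← exp_zero]; exact exp_le_exp.2 (by rw [neg_nonpos]; positivity)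
  exact div_le_div_of_nonneg_left (by linarith) (by linarith) (by linarith [add_one_le_exp (-y)])

namespace FBM

variable {Ω : Type*} [MeasurableSpace Ω] {μ : Measure Ω} {H HH : ℝ} {B : ℝ → Ω → ℝ}

lemma tendsto_pickMean_mul_exp_neg {c α d : ℝ} (hc : 0 < c) (hα : 0 < α) (hd : 0 < d)
    (hPick : Tendsto (fun lam : ℝ => lam⁻¹ * pickMean μ H B lam) atTop (nhds HH)) :
    Tendsto (fun lam : ℝ => pickMean μ H B (lam * d) ^ 4 * exp (-(c * lam ^ α)) / lam ^ 2)
      atTop (nhds 0) := by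
  have h1 := (((hPick.comp (tendsto_id.atTop_mul_const hd)).pow 4).mul
    (tendsto_sq_mul_exp_neg_rpow hc hα)).const_mul (d ^ 4)
  rw [mul_zero, mul_zero] at h1
  refine h1.congr' ?_
  filter_upwards [eventually_gt_atTop 0] with x hx
  simp only [Function.comp, id]
  field_simp

lemma eventually_le_exceed_strip (hB : FBM μ H B) (hH : 0 < H) (hH1 : H < 1/2) (hHH : 0 < HH)
    (hPick : Tendsto (fun lam : ℝ => lam⁻¹ * pickMean μ H B lam) atTop (nhds HH))
    {ε L : ℝ} (hε : 0 < ε) (hL : 0 < L) :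
    ∀ᶠ u in atTop, (1 - ε) * L * clumpRate H HH u ≤ μ.real (exceed B (strip 0 L 0 1) u) := by
  obtain ⟨η, ⟨hη0, hη1⟩, A, hA, hF⟩ := exists_lt_mul_one_sub_exp (H := H) hε
  obtain ⟨S, hS0, hS⟩ := exists_lattice_sum_le (α := 2 * H) (by positivity)
  set κ := 1 - η with hκ
  set ρ := 1 + η with hρ
  have hκ0 : 0 < κ := by linarith
  have hρ1 : 1 < ρ := by linarith
  have hρ0 : 0 < ρ := by linarith
  set d : ℝ := (40 / κ) ^ (1 / (2 * H)) with hd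
  have hd0 : 0 < d := by positivity
  set c := η ^ (2 * H) / (8 * κ * (L + 2)) with hcd
  have hc : 0 < c := by positivity
  -- the constant in front of `L * clumpRate` obtained from cells of size `lam`
  set F : ℝ → ℝ := fun lam => κ ^ (1 / H) * (ρ ^ 2)⁻¹ * (HH ^ 2)⁻¹ * ((ρ ^ 3)⁻¹ *
    (κ * (lam⁻¹ * pickMean μ H B lam) ^ 2) * (1 - exp (-(ρ ^ 2 * A))) -
    2 * A * S * (pickMean μ H B (lam * d) ^ 4 * exp (-(c / 2 * lam ^ (2*H))) / lam ^ 2)) with hFd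
  have hFl : Tendsto F atTop (nhds (κ ^ (1 / H) * (ρ ^ 2)⁻¹ * (HH ^ 2)⁻¹ * ((ρ ^ 3)⁻¹ *
      (κ * HH ^ 2) * (1 - exp (-(ρ ^ 2 * A))) - 2 * A * S * 0))) :=
    ((((hPick.pow 2).const_mul κ).const_mul _).mul_const _ |>.sub
      ((tendsto_pickMean_mul_exp_neg (half_pos hc) (by positivity) hd0 hPick).const_mul
        (2 * A * S))).const_mul _
  have hcl : Tendsto (fun lam : ℝ => c * lam ^ (2*H)) atTop atTop :=
    (tendsto_rpow_atTop (by positivity)).const_mul_atTop hc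
  have hpm := hPick.eventually (lt_mem_nhds hHH)
  obtain ⟨lam, ⟨⟨hFlam, hl⟩, hK0⟩, hpm⟩ := (((hFl.eventually (lt_mem_nhds (show 1 - ε < _ by
    convert hF using 1; field_simp; ring))).and (eventually_gt_atTop 0)).and
    (hcl.eventually_ge_atTop 1)).and hpm |>.exists
  have hpm0 : 0 < pickMean μ H B lam := pos_of_mul_pos_right hpm (inv_nonneg.2 hl.le)
  have hq := tendsto_clumpScale (κ := κ) hH hκ0
  have hh : Tendsto (fun u => ρ * (lam / clumpScale H κ u)) atTop (nhds 0) := by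
    simpa using (hq.const_div_atTop lam).const_mul ρ
  have hθ : Tendsto (fun u => H * u ^ 2 * (ρ * (lam / clumpScale H κ u))) atTop (nhds 0) := by
    have := (tendsto_sq_div_clumpScale hH hH1 hκ0).const_mul (H * ρ * lam)
    rw [mul_zero] at this
    exact this.congr fun u => by ring
  have hAh : Tendsto (fun u : ℝ => A / H / u ^ 2 + ρ * (lam / clumpScale H κ u)) atTop
      (nhds (0 + 0)) :=
    ((tendsto_pow_atTop two_ne_zero).const_div_atTop _).add hh
  set P := pickMean μ H B lam with hP
  set P' := pickMean μ H B (lam * d) with hP'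
  have hcl : κ * P ^ 2 < P ^ 2 := by
    have : 0 < P ^ 2 := by positivity
    nlinarith
  have hlim : Tendsto (fun u : ℝ => (L - ρ * (lam / clumpScale H κ u)) *
      (κ ^ (1 / H) / (ρ ^ 2 * lam ^ 2 * HH ^ 2) *
      ((ρ ^ 3)⁻¹ * (κ * P ^ 2) * (exp (-(2 * (ρ ^ 2 * (H * u ^ 2 *
        (ρ * (lam / clumpScale H κ u)))))) *
        (1 - exp (-(ρ ^ 2 * (A - H * u ^ 2 * (ρ * (lam / clumpScale H κ u))))))) -
      2 * A * S * (P' ^ 4 * exp (-(c / 2 * lam ^ (2*H))))))) atTop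
      (nhds ((L - 0) *
      (κ ^ (1 / H) / (ρ ^ 2 * lam ^ 2 * HH ^ 2) *
      ((ρ ^ 3)⁻¹ * (κ * P ^ 2) * (exp (-(2 * (ρ ^ 2 * 0))) *
        (1 - exp (-(ρ ^ 2 * (A - 0))))) -
      2 * A * S * (P' ^ 4 * exp (-(c / 2 * lam ^ (2*H)))))))) := by
    refine (hh.const_sub L).mul (Tendsto.const_mul _ (Tendsto.sub_const (Tendsto.const_mul _
      (Tendsto.mul ?_ (Tendsto.const_sub 1 ?_))) _))
    · exact (continuous_exp.tendsto _).comp ((hθ.const_mul _).const_mul _).neg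
    · exact (continuous_exp.tendsto _).comp ((hθ.const_sub _).const_mul _).neg
  have hlim1 : (1 - ε) * L < (L - 0) * (κ ^ (1 / H) / (ρ ^ 2 * lam ^ 2 * HH ^ 2) *
      ((ρ ^ 3)⁻¹ * (κ * P ^ 2) * (exp (-(2 * (ρ ^ 2 * 0))) * (1 - exp (-(ρ ^ 2 * (A - 0))))) -
      2 * A * S * (P' ^ 4 * exp (-(c / 2 * lam ^ (2*H)))))) := by
    have := mul_lt_mul_of_pos_right hFlam hL
    refine this.trans_eq ?_
    simp only [hFd, sub_zero, mul_zero, neg_zero, exp_zero, one_mul, ← hP, ← hP']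
    field_simp
  filter_upwards [eventually_gt_atTop 0, hB.eventually_le_measureReal_exceed_square hH hH1
    (κ := κ) (ρ := ρ) (lam := lam) (A := A + 1) (c := κ * P ^ 2) hκ0 (by linarith) hρ1 hl.le
    (integrable_exp_pickSup hB hH hHH hPick hl.le) hcl (by positivity),
    hB.eventually_measureReal_exceed_inter_le hH hH1 (κ := κ) hκ0 hl.le (lam' := lam * d) rfl
    (integrable_exp_pickSup hB hH hHH hPick (by positivity)),
    hlim.eventually (lt_mem_nhds hlim1), hh.eventually (gt_mem_nhds hL),
    hθ.eventually (gt_mem_nhds (show (0:ℝ) < 1 by norm_num)),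
    hAh.eventually (gt_mem_nhds (show (0:ℝ) + 0 < 1/20 by norm_num))] with
    u hu hcell hpair hlow hhL hθ1 hAh1
  have hqp : 0 < clumpScale H κ u := clumpScale_pos hκ0 hu
  have hsq := clumpScale_sq hH hκ0 hu
  have hqH := clumpScale_rpow (u := u) hH hκ0
  set q := clumpScale H κ u with hqd
  set l := lam / q with hld
  have hl0 : 0 < l := by positivity
  set h := ρ * l with hhd
  have hh0 : 0 < h := by positivity
  set θ := H * u ^ 2 * h with hθd
  have hθ0 : 0 < θ := by positivity
  set X := (ρ ^ 3)⁻¹ * (κ * P ^ 2) * (exp (-(2 * (ρ ^ 2 * θ))) * (1 - exp (-(ρ ^ 2 * (A - θ))))) -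
      2 * A * S * (P' ^ 4 * exp (-(c / 2 * lam ^ (2*H)))) with hX
  have hm := millsTail_pos hu
  have hrate := clumpRate_pos hH hHH hu
  have hQ : 0 < κ ^ (1 / H) / (ρ ^ 2 * lam ^ 2 * HH ^ 2) := by positivity
  rcases le_or_gt X 0 with hX0 | hX0
  · have h1 : (L - h) * (κ ^ (1 / H) / (ρ ^ 2 * lam ^ 2 * HH ^ 2) * X) ≤ 0 :=
      mul_nonpos_of_nonneg_of_nonpos (by linarith) (mul_nonpos_of_nonneg_of_nonpos hQ.le hX0)
    exact (mul_nonpos_of_nonpos_of_nonneg (hlow.trans_le h1).le hrate.le).trans measureReal_nonneg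
  set N := ⌊L / h⌋₊
  set K := ⌊A / θ⌋₊
  have hN : (N : ℝ) * h ≤ L := by
    have := Nat.floor_le (show 0 ≤ L / h by positivity)
    rwa [le_div_iff₀ hh0] at this
  have hN' : L - h ≤ N * h := by
    have := (Nat.lt_floor_add_one (L / h)).le
    rw [div_le_iff₀ hh0] at this; linarith
  have hK : (K : ℝ) * θ ≤ A := by
    have := Nat.floor_le (show 0 ≤ A / θ by positivity)
    rwa [le_div_iff₀ hθ0] at this
  have hK' : A - θ ≤ K * θ := by
    have := (Nat.lt_floor_add_one (A / θ)).le
    rw [div_le_iff₀ hθ0] at this; linarith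
  have hKh : (K : ℝ) * h ≤ A / H / u ^ 2 := by
    rw [le_div_iff₀ (by positivity), le_div_iff₀ hH]; rw [hθd] at hK; linarith
  have hexp : u ^ 2 * (η * l) ^ (2*H) / (16 * (L + 2)) = c * lam ^ (2*H) := by
    rw [hld, ← mul_div_assoc, div_rpow (by positivity) hqp.le, hqH, mul_rpow hη0.le hl.le, hcd]
    field_simp; ring
  have main := hB.le_measureReal_exceed_strip_of_cells hH hH1 (h := h) (l := l) (γ := η) (L := L)
    (u := u) (C := 2 * P' ^ 4 * millsTail u) (S := S) (A := A + 1) (N := N) (K := K)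
    (G := fun x => millsTail u * (ρ⁻¹ * exp (-(u ^ 2 * (ρ * (H * ρ * x))))) * (κ * P ^ 2))
    hη0.le hl0.le hhd hN hL.le (by linarith) (by
      have : H * u ^ 2 * ((K + 1) * h) = K * θ + θ := by rw [hθd]; ring
      linarith) (by positivity) hS hcell hpair (by rw [hexp]; exact hK0)
  refine le_trans ?_ main
  rw [hexp]
  have hG : millsTail u / θ * ((ρ ^ 3)⁻¹ * (κ * P ^ 2) * (exp (-(2 * (ρ ^ 2 * θ))) *
      (1 - exp (-(ρ ^ 2 * (A - θ)))))) ≤ ∑ k ∈ Finset.range K,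
      millsTail u * (ρ⁻¹ * exp (-(u ^ 2 * (ρ * (H * ρ * ((k + 2) * h)))))) * (κ * P ^ 2) := by
    have h1 : ∀ k : ℕ, millsTail u * (ρ⁻¹ * exp (-(u ^ 2 * (ρ * (H * ρ * ((k + 2) * h)))))) *
        (κ * P ^ 2) = millsTail u * ρ⁻¹ * (κ * P ^ 2) * exp (-(ρ ^ 2 * θ * (k + 2))) := fun k => by
      rw [show u ^ 2 * (ρ * (H * ρ * ((k + 2) * h))) = ρ ^ 2 * θ * (k + 2) by rw [hθd]; ring]; ring
    simp only [h1]
    rw [← Finset.mul_sum]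
    have h2 := le_sum_exp_neg (show 0 < ρ ^ 2 * θ by positivity) K
    have h3 : exp (-(ρ ^ 2 * θ * K)) ≤ exp (-(ρ ^ 2 * (A - θ))) := exp_le_exp.2 (by
      have := mul_le_mul_of_nonneg_left hK' (sq_nonneg ρ)
      linarith)
    refine le_trans ?_ (mul_le_mul_of_nonneg_left h2 (by positivity))
    calc _ = millsTail u * ρ⁻¹ * (κ * P ^ 2) * (exp (-(2 * (ρ ^ 2 * θ))) *
          (1 - exp (-(ρ ^ 2 * (A - θ)))) / (ρ ^ 2 * θ)) := by field_simp
      _ ≤ _ := by gcongr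
  have hKC : (K : ℝ) * (2 * P' ^ 4 * millsTail u * (exp (-(c * lam ^ (2*H) / 2)) * S)) ≤
      millsTail u / θ * (2 * A * S * (P' ^ 4 * exp (-(c / 2 * lam ^ (2*H))))) := by
    have h1 : (K : ℝ) ≤ A / θ := by rwa [le_div_iff₀ hθ0]
    refine (mul_le_mul_of_nonneg_right h1 (by positivity)).trans_eq ?_
    rw [show c * lam ^ (2*H) / 2 = c / 2 * lam ^ (2*H) by ring]
    field_simp
  calc (1 - ε) * L * clumpRate H HH u
      ≤ (L - h) * (κ ^ (1 / H) / (ρ ^ 2 * lam ^ 2 * HH ^ 2) * X) * clumpRate H HH u := by gcongr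
    _ ≤ (N * h) * (κ ^ (1 / H) / (ρ ^ 2 * lam ^ 2 * HH ^ 2) * X) * clumpRate H HH u := by gcongr
    _ = N * (millsTail u / θ * X) := by
      have e : millsTail u / θ = h * (κ ^ (1 / H) / (ρ ^ 2 * lam ^ 2 * HH ^ 2)) *
          clumpRate H HH u := by
        have e1 : κ ^ (1 / H) * 2 ^ (-(1 / H)) * u ^ (2 / H - 2) = q ^ 2 / u ^ 2 := by
          rw [hsq]; field_simp
        calc millsTail u / θ = h * (q ^ 2 / u ^ 2) * (ρ ^ 2 * lam ^ 2)⁻¹ * H⁻¹ * millsTail u := by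
              rw [hθd, hhd, hld]; field_simp
          _ = _ := by rw [← e1, clumpRate]; field_simp
      rw [e]; ring
    _ ≤ _ := by
      rw [hX, mul_sub, mul_sub, mul_assoc (N:ℝ) (K:ℝ)]
      exact sub_le_sub (mul_le_mul_of_nonneg_left hG (Nat.cast_nonneg _))
        (mul_le_mul_of_nonneg_left hKC (Nat.cast_nonneg _))

end FBM

lemma incCov_add (H a b c d t : ℝ) :
    incCov H (a + t) (b + t) (c + t) (d + t) = incCov H a b c d := by
  unfold incCov; simp only [add_sub_add_right_eq_sub]

namespace FBM

variable {Ω : Type*} [MeasurableSpace Ω] {μ : Measure Ω} {H HH : ℝ} {B : ℝ → Ω → ℝ}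

/-- Cauchy–Schwarz for increments. -/
lemma incCov_le_mul (hB : FBM μ H B) (hH : 0 < H) {a b c d : ℝ} (ha : 0 ≤ a) (hab : a ≤ b)
    (hc : 0 ≤ c) (hcd : c ≤ d) : incCov H a b c d ≤ (b - a) ^ H * (d - c) ^ H := by
  rcases hab.eq_or_lt with rfl | hab'
  · rw [sub_self, zero_rpow hH.ne', zero_mul]
    refine le_of_eq ?_; unfold incCov; ring
  rcases hcd.eq_or_lt with rfl | hcd'
  · rw [sub_self, zero_rpow hH.ne', mul_zero]
    refine le_of_eq ?_; unfold incCov; ring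
  have hσ : 0 < (b - a) ^ H := rpow_pos_of_pos (by linarith) _
  have hτ : 0 < (d - c) ^ H := rpow_pos_of_pos (by linarith) _
  set σ := (b - a) ^ H with hσd
  set τ := (d - c) ^ H with hτd
  have h0 : 0 ≤ ∫ ω, (τ * (B b ω - B a ω) - σ * (B d ω - B c ω)) *
      (τ * (B b ω - B a ω) - σ * (B d ω - B c ω)) ∂μ :=
    integral_nonneg fun ω => mul_self_nonneg _
  rw [hB.gauss.integral_sub_mul_self (f := fun ω => τ * (B b ω - B a ω))
    (g := fun ω => σ * (B d ω - B c ω)) (Submodule.smul_mem _ τ (sub_mem a b))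
    (Submodule.smul_mem _ σ (sub_mem c d))] at h0
  have e : ∀ x y : ℝ, ∀ f g : Ω → ℝ, ∫ ω, (x * f ω) * (y * g ω) ∂μ = x * y * ∫ ω, f ω * g ω ∂μ := by
    intro x y f g
    rw [← integral_const_mul]; congr 1; ext ω; ring
  have hb : 0 ≤ b := ha.trans hab
  have hd : 0 ≤ d := hc.trans hcd
  rw [e, e, e, hB.incCov_eq ha hb ha hb, hB.incCov_eq hc hd hc hd, hB.incCov_eq ha hb hc hd,
    incCov_self hH hab, incCov_self hH hcd, ← hσd, ← hτd] at h0
  by_contra! h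
  have := mul_lt_mul_of_pos_left h (mul_pos hσ hτ)
  linarith

lemma measureReal_pi_exceed (hB : FBM μ H B) (S : Set (ℝ × ℝ)) (u : ℝ) (n : ℕ) :
    (Measure.pi fun _ : Fin n => μ).real
      {ω | ∃ i : Fin n × S, u < B i.2.1.2 (ω i.1) - B i.2.1.1 (ω i.1)} =
      1 - (1 - μ.real (exceed B S u)) ^ n := by
  have := hB.gauss.isProbabilityMeasure
  have hm := hB.measurableSet_exceed S u
  have e : {ω : Fin n → Ω | ∃ i : Fin n × S, u < B i.2.1.2 (ω i.1) - B i.2.1.1 (ω i.1)} =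
      (Set.pi univ fun _ : Fin n => (exceed B S u)ᶜ)ᶜ := by
    ext ω
    simp [exceed, lt_sub_iff_add_lt]
  rw [e, measureReal_compl (MeasurableSet.univ_pi fun _ => hm.compl), probReal_univ]
  congr 1
  rw [measureReal_def, Measure.pi_pi, ENNReal.toReal_prod]
  simp only [← measureReal_def, measureReal_compl hm, probReal_univ]
  simp

/-- Covariance of the field of increments of `n` independent copies. -/
lemma integral_pi_inc (hB : FBM μ H B) {n : ℕ} (k j : Fin n) {a b c d : ℝ} (ha : 0 ≤ a)
    (hb : 0 ≤ b) (hc : 0 ≤ c) (hd : 0 ≤ d) :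
    ∫ ω : Fin n → Ω, (B b (ω k) - B a (ω k)) * (B d (ω j) - B c (ω j))
      ∂(Measure.pi fun _ : Fin n => μ) = if k = j then incCov H a b c d else 0 := by
  rw [hB.gauss.integral_eval_mul_eval (f := fun ω => B b ω - B a ω)
    (g := fun ω => B d ω - B c ω) (sub_mem _ _) (sub_mem _ _), hB.incCov_eq ha hb hc hd]

lemma one_sub_pow_le_measureReal_exceed (hB : FBM μ H B) (hH : 0 < H) (hH1 : H ≤ 1/2) {L T u : ℝ}
    (hL : 0 ≤ L) {n : ℕ} (hT : n * (L + 1) ≤ T) :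
    1 - (1 - μ.real (exceed B (strip 0 L 0 1) u)) ^ n ≤ μ.real (exceed B (strip 0 T 0 1) u) := by
  have := hB.gauss.isProbabilityMeasure
  rw [← hB.measureReal_pi_exceed]
  set S := strip 0 L 0 1
  have hS : ∀ p : S, 0 ≤ p.1.1 ∧ p.1.1 ≤ L ∧ 0 ≤ p.1.2 - p.1.1 ∧ p.1.2 - p.1.1 ≤ 1 := fun p =>
    ⟨p.2.1.1, by simpa using p.2.1.2, p.2.2.1, p.2.2.2⟩
  set r : Fin n → ℝ := fun k => (k:ℝ) * (L + 1)
  have hr : ∀ k, 0 ≤ r k := fun k => by positivity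
  have hrlt : ∀ k j : Fin n, k < j → r k + (L + 1) ≤ r j := fun k j hkj => by
    have : ((k:ℕ):ℝ) + 1 ≤ (j:ℕ) := by exact_mod_cast hkj
    have := mul_le_mul_of_nonneg_right this (show 0 ≤ L + 1 by linarith)
    simp only [r]; linarith
  have hcov : ∀ i j : Fin n × S, ∫ ω, (B (i.2.1.2 + r i.1) ω - B (i.2.1.1 + r i.1) ω) *
      (B (j.2.1.2 + r j.1) ω - B (j.2.1.1 + r j.1) ω) ∂μ =
      incCov H (i.2.1.1 + r i.1) (i.2.1.2 + r i.1) (j.2.1.1 + r j.1) (j.2.1.2 + r j.1) := by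
    intro i j
    obtain ⟨h1, h2, h3, h4⟩ := hS i.2
    obtain ⟨h1', h2', h3', h4'⟩ := hS j.2
    have := hr i.1
    have := hr j.1
    exact hB.incCov_eq (by linarith) (by linarith) (by linarith) (by linarith)
  have hcov' : ∀ i j : Fin n × S, ∫ ω : Fin n → Ω, (B i.2.1.2 (ω i.1) - B i.2.1.1 (ω i.1)) *
      (B j.2.1.2 (ω j.1) - B j.2.1.1 (ω j.1)) ∂(Measure.pi fun _ : Fin n => μ) =
      if i.1 = j.1 then incCov H i.2.1.1 i.2.1.2 j.2.1.1 j.2.1.2 else 0 := by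
    intro i j
    obtain ⟨h1, h2, h3, h4⟩ := hS i.2
    obtain ⟨h1', h2', h3', h4'⟩ := hS j.2
    exact hB.integral_pi_inc _ _ (by linarith) (by linarith) (by linarith) (by linarith)
  refine (slepian (I := Fin n × S) (hB.gauss.gaussSpace_pi (κ := Fin n)) hB.gauss
    (X := fun i ω => B i.2.1.2 (ω i.1) - B i.2.1.1 (ω i.1))
    (Y := fun i ω => B (i.2.1.2 + r i.1) ω - B (i.2.1.1 + r i.1) ω)
    (fun i => GaussSpace.comp_eval_mem_pi (sub_mem _ _) i.1) (fun i => sub_mem _ _) ?_ ?_ ?_ ?_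
    (l := fun _ => u) continuous_const).trans ?_
  · intro ω
    refine continuous_prod_of_discrete_left.2 fun k => ?_
    have := hB.cont (ω k)
    show Continuous fun p : S => B p.1.2 (ω k) - B p.1.1 (ω k)
    fun_prop
  · intro ω
    have h1 := hB.cont ω
    have h2 : Continuous r := continuous_of_discreteTopology
    fun_prop
  · intro i
    rw [hcov, hcov', if_pos rfl, incCov_add]
  · intro i j
    rw [hcov, hcov']
    obtain ⟨h1, h2, h3, h4⟩ := hS i.2
    obtain ⟨h1', h2', h3', h4'⟩ := hS j.2
    split_ifs with h
    · rw [h, incCov_add]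
    · rcases lt_or_gt_of_ne h with h5 | h5
      · have := hrlt _ _ h5
        exact incCov_nonpos_of_le hH.le hH1 (by linarith) (by linarith) (by linarith)
      · have := hrlt _ _ h5
        rw [incCov_comm]
        exact incCov_nonpos_of_le hH.le hH1 (by linarith) (by linarith) (by linarith)
  · refine measureReal_mono ?_ (measure_ne_top _ _)
    rintro ω ⟨i, hi⟩
    obtain ⟨h1, h2, h3, h4⟩ := hS i.2
    have h5 := hr i.1
    have h6 : r i.1 + (L + 1) ≤ T := by
      have : ((i.1:ℕ):ℝ) + 1 ≤ n := by exact_mod_cast i.1.2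
      have := mul_le_mul_of_nonneg_right this (show 0 ≤ L + 1 by linarith)
      simp only [r]; linarith
    exact ⟨(_, _), ⟨⟨by simp only; linarith, by simp only; linarith⟩, by simp only; linarith,
      by simp only; linarith⟩, hi⟩

lemma measureReal_exists_exceed_mul_le (hB : FBM μ H B) (hH : 0 < H) (hH1 : H ≤ 1/2)
    {l g ρ u v : ℝ} (hl : 0 ≤ l) (hg : 1 < g) (hρ : H * (g - 1) ^ (2 * H - 1) ≤ ρ) (hρ1 : ρ < 1)
    (hv : 0 ≤ v) (n : ℕ) :
    μ.real {ω | ∃ k : Fin n, ∃ p ∈ strip 0 l 0 1, (u + √ρ * v) / √(1 - ρ) <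
        B (p.2 + k * (l + g)) ω - B (p.1 + k * (l + g)) ω} * μ.real {ω | -v ≤ B 1 ω} ≤
      1 - (1 - μ.real (exceed B (strip 0 l 0 1) u)) ^ n := by
  have := hB.gauss.isProbabilityMeasure
  rw [← hB.measureReal_pi_exceed]
  set S := strip 0 l 0 1
  have hS : ∀ p : S, 0 ≤ p.1.1 ∧ p.1.1 ≤ l ∧ 0 ≤ p.1.2 - p.1.1 ∧ p.1.2 - p.1.1 ≤ 1 := fun p =>
    ⟨p.2.1.1, by simpa using p.2.1.2, p.2.2.1, p.2.2.2⟩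
  have hρ0 : 0 ≤ ρ := le_trans (mul_nonneg hH.le (rpow_nonneg (by linarith) _)) hρ
  set r : Fin n → ℝ := fun k => (k:ℝ) * (l + g)
  have hr : ∀ k, 0 ≤ r k := fun k => by positivity
  have hrlt : ∀ k j : Fin n, k < j → r k + (l + g) ≤ r j := fun k j hkj => by
    have : ((k:ℕ):ℝ) + 1 ≤ (j:ℕ) := by exact_mod_cast hkj
    have := mul_le_mul_of_nonneg_right this (show 0 ≤ l + g by linarith)
    simp only [r]; linarith
  set σ : Fin n × S → ℝ := fun i => (i.2.1.2 - i.2.1.1) ^ H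
  have hσ0 : ∀ i, 0 ≤ σ i := fun i => rpow_nonneg (hS i.2).2.2.1 _
  have hσ1 : ∀ i, σ i ≤ 1 := fun i => rpow_le_one (hS i.2).2.2.1 (hS i.2).2.2.2 hH.le
  set f : Fin n × S → Ω → ℝ := fun i ω =>
    √(1 - ρ) * (B (i.2.1.2 + r i.1) ω - B (i.2.1.1 + r i.1) ω)
  set z : Fin n × S → Ω → ℝ := fun i ω => √ρ * σ i * B 1 ω
  have hf : ∀ i, f i ∈ Submodule.span ℝ (range B) := fun i =>
    Submodule.smul_mem _ (√(1 - ρ)) (sub_mem _ _)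
  have hz : ∀ i, z i ∈ Submodule.span ℝ (range B) := fun i =>
    Submodule.smul_mem _ (√ρ * σ i) (mem 1)
  have hV1 : ∫ ω, B 1 ω * B 1 ω ∂μ = 1 := by
    rw [hB.cov 1 1 zero_le_one zero_le_one, sub_self, abs_zero, zero_rpow (by positivity)]; norm_num
  have hs1 : √(1 - ρ) * √(1 - ρ) = 1 - ρ := mul_self_sqrt (by linarith)
  have hs2 : √ρ * √ρ = ρ := mul_self_sqrt hρ0
  have hcov : ∀ i j : Fin n × S, ∫ w : Ω × Ω, (f i w.1 + z i w.2) * (f j w.1 + z j w.2) ∂(μ.prod μ) =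
      (1 - ρ) * incCov H (i.2.1.1 + r i.1) (i.2.1.2 + r i.1) (j.2.1.1 + r j.1) (j.2.1.2 + r j.1) +
        ρ * (σ i * σ j) := by
    intro i j
    obtain ⟨h1, h2, h3, h4⟩ := hS i.2
    obtain ⟨h1', h2', h3', h4'⟩ := hS j.2
    have := hr i.1
    have := hr j.1
    rw [integral_prod_mul_cross hB.gauss hB.gauss (hf i) (hf j) (hz i) (hz j),
      ← hB.incCov_eq (by linarith) (by linarith) (by linarith) (by linarith), ← integral_const_mul]
    congr 1
    · congr 1; ext ω; simp only [f]
      linear_combination ((B (i.2.1.2 + r i.1) ω - B (i.2.1.1 + r i.1) ω) *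
        (B (j.2.1.2 + r j.1) ω - B (j.2.1.1 + r j.1) ω)) * hs1
    · have e : ∀ ω, z i ω * z j ω = ρ * (σ i * σ j) * (B 1 ω * B 1 ω) := fun ω => by
        simp only [z]
        linear_combination (σ i * σ j * B 1 ω * B 1 ω) * hs2
      simp only [e]
      rw [integral_const_mul, hV1, mul_one]
  have hcov' : ∀ i j : Fin n × S, ∫ ω : Fin n → Ω, (B i.2.1.2 (ω i.1) - B i.2.1.1 (ω i.1)) *
      (B j.2.1.2 (ω j.1) - B j.2.1.1 (ω j.1)) ∂(Measure.pi fun _ : Fin n => μ) =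
      if i.1 = j.1 then incCov H i.2.1.1 i.2.1.2 j.2.1.1 j.2.1.2 else 0 := by
    intro i j
    obtain ⟨h1, h2, h3, h4⟩ := hS i.2
    obtain ⟨h1', h2', h3', h4'⟩ := hS j.2
    exact hB.integral_pi_inc _ _ (by linarith) (by linarith) (by linarith) (by linarith)
  have hσc : Continuous σ := by
    refine Continuous.rpow_const (by fun_prop) fun _ => Or.inr hH.le
  have hfar : ∀ i j : Fin n × S, i.1 < j.1 → 0 ≤ (1 - ρ) * incCov H (i.2.1.1 + r i.1)
      (i.2.1.2 + r i.1) (j.2.1.1 + r j.1) (j.2.1.2 + r j.1) + ρ * (σ i * σ j) := by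
    intro i j hij
    obtain ⟨h1, h2, h3, h4⟩ := hS i.2
    obtain ⟨h1', h2', h3', h4'⟩ := hS j.2
    have h5 := hrlt _ _ hij
    have h6 := neg_le_incCov_of_gap (H := H) (a := i.2.1.1 + r i.1) (b := i.2.1.2 + r i.1)
      (c := j.2.1.1 + r j.1) (d := j.2.1.2 + r j.1) (g := g - 1) hH hH1 (by linarith) (by linarith)
      (by linarith) (by linarith) (by linarith)
    simp only [add_sub_add_right_eq_sub] at h6
    have h7 : 0 ≤ σ i * σ j := mul_nonneg (hσ0 i) (hσ0 j)
    have h8 := mul_le_mul_of_nonneg_right hρ h7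
    set c := incCov H (i.2.1.1 + r i.1) (i.2.1.2 + r i.1) (j.2.1.1 + r j.1) (j.2.1.2 + r j.1)
    have h9 : -(ρ * (σ i * σ j)) ≤ c := by simp only [σ] at h8 ⊢; linarith
    rcases le_total 0 c with h10 | h10
    · have := mul_nonneg (show 0 ≤ 1 - ρ by linarith) h10
      have := mul_nonneg hρ0 h7
      linarith
    · nlinarith [mul_nonneg hρ0 (neg_nonneg.2 h10)]
  have key := slepian (I := Fin n × S) (hB.gauss.gaussSpace_prod hB.gauss)
    (hB.gauss.gaussSpace_pi (κ := Fin n)) (X := fun i w => f i w.1 + z i w.2)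
    (Y := fun i ω => B i.2.1.2 (ω i.1) - B i.2.1.1 (ω i.1))
    (fun i => GaussSpace.mem_prod (hf i) (hz i))
    (fun i => GaussSpace.comp_eval_mem_pi (sub_mem _ _) i.1) ?_ ?_ ?_ ?_
    (l := fun _ => u) continuous_const
  · rw [← measureReal_prod_prod]
    refine le_trans (measureReal_mono ?_ (measure_ne_top _ _)) key
    rintro w ⟨⟨k, p, hp, h1⟩, h2⟩
    refine ⟨(k, ⟨p, hp⟩), ?_⟩
    rw [div_lt_iff₀ (sqrt_pos.2 (by linarith))] at h1
    have h3 : -(√ρ * v) ≤ z (k, ⟨p, hp⟩) w.2 := by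
      have h4 : √ρ * σ (k, ⟨p, hp⟩) * -v ≤ z (k, ⟨p, hp⟩) w.2 :=
        mul_le_mul_of_nonneg_left h2 (mul_nonneg (sqrt_nonneg _) (hσ0 _))
      have h5 := mul_le_mul_of_nonneg_left (hσ1 (k, ⟨p, hp⟩))
        (mul_nonneg (sqrt_nonneg ρ) hv)
      linarith
    have h6 : f (k, ⟨p, hp⟩) w.1 = √(1 - ρ) * (B (p.2 + k * (l + g)) w.1 -
      B (p.1 + k * (l + g)) w.1) := rfl
    show u < f (k, ⟨p, hp⟩) w.1 + z (k, ⟨p, hp⟩) w.2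
    rw [h6]
    linarith
  · intro w
    have h1 := hB.cont w.1
    have h2 : Continuous r := continuous_of_discreteTopology
    simp only [f, z]
    fun_prop
  · intro ω
    refine continuous_prod_of_discrete_left.2 fun k => ?_
    have := hB.cont (ω k)
    show Continuous fun p : S => B p.1.2 (ω k) - B p.1.1 (ω k)
    fun_prop
  · intro i
    rw [hcov, hcov', if_pos rfl, incCov_add, incCov_self hH (by linarith [(hS i.2).2.2.1])]
    simp only [σ]; ring
  · intro i j
    rw [hcov, hcov']
    obtain ⟨h1, h2, h3, h4⟩ := hS i.2
    obtain ⟨h1', h2', h3', h4'⟩ := hS j.2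
    split_ifs with h
    · rw [h, incCov_add]
      have h5 := hB.incCov_le_mul hH h1 (by linarith) h1' (by linarith : j.2.1.1 ≤ j.2.1.2)
        (b := i.2.1.2)
      have h6 := mul_le_mul_of_nonneg_left h5 hρ0
      simp only [σ]; linarith
    · rcases lt_or_gt_of_ne h with h5 | h5
      · exact hfar i j h5
      · have := hfar j i h5
        rwa [incCov_comm, mul_comm (σ j)] at this

end FBM

/-- The level `b_T + x / a_T` of the Gumbel limit. -/
noncomputable def gumbelLevel (H HH T x : ℝ) : ℝ :=
  √(2 * log T) + (√(2 * log T))⁻¹ * ((1/H - 3/2) * log (log T) +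
    log ((2:ℝ) ^ (-(3:ℝ)/2) * HH ^ 2 * H⁻¹ * (2 * π) ^ (-(1:ℝ)/2)) + x)

lemma tendsto_sqrt_two_mul_log : Tendsto (fun T : ℝ => √(2 * log T)) atTop atTop :=
  tendsto_sqrt_atTop.comp (tendsto_log_atTop.const_mul_atTop two_pos)

lemma tendsto_gumbelLevel_sub (H HH : ℝ) {x : ℝ → ℝ} {x₀ : ℝ} (hx : Tendsto x atTop (nhds x₀)) :
    Tendsto (fun T => gumbelLevel H HH T (x T) - √(2 * log T)) atTop (nhds 0) := by
  have h1 : Tendsto (fun T : ℝ => (√(2 * log T))⁻¹) atTop (nhds 0) :=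
    tendsto_inv_atTop_zero.comp tendsto_sqrt_two_mul_log
  have h2 : Tendsto (fun s : ℝ => log s / s ^ (1/2 : ℝ)) atTop (nhds 0) :=
    (isLittleO_log_rpow_atTop (by norm_num)).tendsto_div_nhds_zero
  have h3 : Tendsto (fun T : ℝ => (√(2 * log T))⁻¹ * log (log T)) atTop (nhds 0) := by
    have := (h2.comp tendsto_log_atTop).const_mul (√2)⁻¹
    rw [mul_zero] at this
    refine this.congr fun T => ?_
    simp only [Function.comp]
    rw [← sqrt_eq_rpow, sqrt_mul zero_le_two, mul_inv]; ring
  have h4 := (h3.const_mul (1/H - 3/2)).add (h1.mul (hx.const_add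
    (log ((2:ℝ) ^ (-(3:ℝ)/2) * HH ^ 2 * H⁻¹ * (2 * π) ^ (-(1:ℝ)/2)))))
  simp only [mul_zero, zero_mul, add_zero] at h4
  refine h4.congr fun T => ?_
  simp only [gumbelLevel]; ring

lemma tendsto_gumbelLevel (H HH : ℝ) {x : ℝ → ℝ} {x₀ : ℝ} (hx : Tendsto x atTop (nhds x₀)) :
    Tendsto (fun T => gumbelLevel H HH T (x T)) atTop atTop := by
  have := (tendsto_gumbelLevel_sub H HH hx).add_atTop tendsto_sqrt_two_mul_log
  simpa using this

lemma tendsto_mul_clumpRate_gumbelLevel {H HH : ℝ} (hH : 0 < H) (hHH : 0 < HH) {x : ℝ → ℝ} {x₀ : ℝ}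
    (hx : Tendsto x atTop (nhds x₀)) :
    Tendsto (fun T => T * clumpRate H HH (gumbelLevel H HH T (x T))) atTop (nhds (exp (-x₀))) := by
  have hq := tendsto_gumbelLevel_sub H HH hx
  have h1 : Tendsto (fun T : ℝ => (√(2 * log T))⁻¹) atTop (nhds 0) :=
    tendsto_inv_atTop_zero.comp tendsto_sqrt_two_mul_log
  have hr := (hq.mul h1).const_add 1
  rw [mul_zero, add_zero] at hr
  have hlim := (((hr.rpow_const (Or.inl one_ne_zero) (p := 2 * (1/H - 3/2))).mul
    ((continuous_exp.tendsto _).comp hx.neg)).mul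
      ((continuous_exp.tendsto _).comp ((hq.pow 2).div_const 2).neg))
  simp only [one_rpow, one_mul, ne_eq, OfNat.ofNat_ne_zero, not_false_eq_true, zero_pow, zero_div,
    neg_zero, exp_zero, mul_one] at hlim
  refine hlim.congr' ?_
  filter_upwards [eventually_gt_atTop (exp 1), (tendsto_gumbelLevel H HH hx).eventually_gt_atTop 0]
    with T hT hu
  have hT0 : 0 < T := (exp_pos 1).trans hT
  have hl : 1 < log T := (lt_log_iff_exp_lt hT0).2 hT
  have hl0 : 0 < log T := by linarith
  have ha : 0 < √(2 * log T) := sqrt_pos.2 (by linarith)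
  have ha2 : √(2 * log T) ^ 2 = 2 * log T := sq_sqrt (by linarith)
  set u := gumbelLevel H HH T (x T) with hud
  set K' := (2:ℝ) ^ (-(3:ℝ)/2) * HH ^ 2 * H⁻¹ * (2 * π) ^ (-(1:ℝ)/2) with hK'
  have hK'0 : 0 < K' := by positivity
  set a := √(2 * log T)
  set c := 1/H - 3/2 with hc
  have hD : a * (u - a) = c * log (log T) + log K' + x T := by
    have : u = a + a⁻¹ * (c * log (log T) + log K' + x T) := rfl
    rw [this, add_sub_cancel_left, mul_inv_cancel_left₀ ha.ne']
  have e1 : 1 + (u - a) * a⁻¹ = u / a := by field_simp; ring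
  have e2 : (u / a) ^ (2 * c) = u ^ (2 * c) * ((2 * log T) ^ c)⁻¹ := by
    rw [div_rpow hu.le ha.le, rpow_mul ha.le, rpow_two, ha2]; rfl
  have e3 : T * exp (-(u ^ 2 / 2)) = exp (-x T) * exp (-((u - a) ^ 2 / 2)) * K'⁻¹ *
      ((log T) ^ c)⁻¹ := by
    have : T * exp (-(u ^ 2 / 2)) = exp (log T - u ^ 2 / 2) := by
      rw [sub_eq_add_neg, exp_add, exp_log hT0]
    rw [this, rpow_def_of_pos hl0, ← exp_neg (log (log T) * c)]
    nth_rewrite 1 [← exp_log hK'0]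
    rw [← exp_neg (log K'), ← exp_add, ← exp_add, ← exp_add]
    congr 1
    nlinarith
  have e4 : clumpRate H HH u = (HH ^ 2 * 2 ^ (-(1/H)) * H⁻¹ * (2 * π) ^ (-(1:ℝ)/2)) * u ^ (2 * c) *
      exp (-(u ^ 2 / 2)) := by
    have e5 : u ^ (2 / H - 2) = u ^ (2 * c) * u := by
      nth_rewrite 3 [← rpow_one u]
      rw [← rpow_add hu]; congr 1; rw [hc]; ring
    have e6 : √(2 * π) = ((2 * π) ^ (-(1:ℝ)/2))⁻¹ := by
      rw [← rpow_neg (by positivity), sqrt_eq_rpow]; norm_num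
    rw [clumpRate, millsTail, e5, e6]; field_simp
  have e7 : (2:ℝ) ^ c = 2 ^ (1/H) * 2 ^ (-(3:ℝ)/2) := by
    rw [← rpow_add two_pos]; congr 1; rw [hc]; ring
  have e8 : (2:ℝ) ^ (-(1/H)) = (2 ^ (1/H))⁻¹ := rpow_neg zero_le_two _
  simp only [Function.comp]
  rw [e1, e2, e4, mul_left_comm T, e3, mul_rpow zero_le_two hl0.le, e7, e8, hK']
  have := rpow_pos_of_pos hl0 c
  field_simp
  rfl

lemma exists_nat_mul_le_le {d y : ℝ} (hy : 0 ≤ y) (n : ℕ) (h : y ≤ (n + 1) * d) :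
    ∃ k : ℕ, k < n + 1 ∧ k * d ≤ y ∧ y ≤ k * d + d := by
  induction n with
  | zero => exact ⟨0, by simp, by simpa using hy, by simpa using h⟩
  | succ n ih =>
    rcases le_total y ((n + 1) * d) with h1 | h1
    · obtain ⟨k, hk, h2⟩ := ih h1
      exact ⟨k, by omega, h2⟩
    · refine ⟨n + 1, by omega, by push_cast; exact h1, ?_⟩
      push_cast at h ⊢; linarith

lemma exceed_strip_subset_iUnion {Ω : Type*} {B : ℝ → Ω → ℝ} {c l u : ℝ} :
    exceed B (strip c l 0 1) u ⊆
      ⋃ k ∈ Finset.range (⌊l⌋₊ + 1), exceed B (strip (c + k) 1 0 1) u := by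
  rintro ω ⟨p, ⟨⟨h1, h2⟩, h3⟩, h4⟩
  simp only [mem_iUnion, Finset.mem_range]
  refine ⟨⌊p.1 - c⌋₊, ?_, p, ⟨⟨?_, ?_⟩, h3⟩, h4⟩
  · exact Nat.lt_succ_of_le (Nat.floor_mono (by linarith))
  · linarith [Nat.floor_le (show 0 ≤ p.1 - c by linarith)]
  · linarith [Nat.lt_floor_add_one (p.1 - c)]

lemma exceed_strip_subset_blocks {Ω : Type*} {B : ℝ → Ω → ℝ} {l g T u : ℝ} {n : ℕ} (hn : n ≠ 0)
    (hT : T = n * (l + g)) :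
    exceed B (strip 0 T 0 1) u ⊆ {ω | ∃ k : Fin n, ∃ p ∈ strip 0 l 0 1,
      u < B (p.2 + k * (l + g)) ω - B (p.1 + k * (l + g)) ω} ∪
      ⋃ k ∈ Finset.range n, exceed B (strip (k * (l + g) + l) g 0 1) u := by
  obtain ⟨m, rfl⟩ := Nat.exists_eq_succ_of_ne_zero hn
  rintro ω ⟨p, ⟨⟨h1, h2⟩, h3⟩, h4⟩
  obtain ⟨k, hk, h5, h6⟩ := exists_nat_mul_le_le (d := l + g) h1 m (by
    rw [zero_add, hT] at h2; push_cast at h2; exact h2)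
  rcases le_total p.1 (k * (l + g) + l) with h7 | h7
  · refine Or.inl ⟨⟨k, hk⟩, (p.1 - k * (l + g), p.2 - k * (l + g)), ⟨⟨?_, ?_⟩, ?_⟩, ?_⟩
    · simp only; linarith
    · simp only; linarith
    · simpa using h3
    · simpa using h4
  · refine Or.inr ?_
    simp only [mem_iUnion, Finset.mem_range]
    exact ⟨k, hk, p, ⟨⟨h7, by linarith⟩, h3⟩, h4⟩

namespace FBM

variable {Ω : Type*} [MeasurableSpace Ω] {μ : Measure Ω} {H HH : ℝ} {B : ℝ → Ω → ℝ}

lemma eventually_forall_exceed_strip_le (hB : FBM μ H B) (hH : 0 < H) (hH1 : H < 1/2) (hHH : 0 < HH)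
    (hPick : Tendsto (fun lam : ℝ => lam⁻¹ * pickMean μ H B lam) atTop (nhds HH))
    {ε : ℝ} (hε : 0 < ε) : ∀ᶠ u in atTop, ∀ c l, 0 ≤ c → 0 ≤ l →
      μ.real (exceed B (strip c l 0 1) u) ≤ (l + 1) * ((1 + ε) * clumpRate H HH u) := by
  filter_upwards [hB.eventually_exceed_strip_unit_le hH hH1 hHH hPick hε, eventually_gt_atTop 0]
    with u hu hu0 c l hc hl
  have := hB.gauss.isProbabilityMeasure
  refine (measureReal_mono exceed_strip_subset_iUnion (measure_ne_top _ _)).trans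
    ((measureReal_biUnion_finset_le _ _).trans
      ((Finset.sum_le_sum fun (k : ℕ) _ => hu (c + (k : ℕ)) (add_nonneg hc k.cast_nonneg)).trans ?_))
  rw [Finset.sum_const, Finset.card_range, nsmul_eq_mul]
  refine mul_le_mul_of_nonneg_right ?_ (mul_nonneg (by linarith) (clumpRate_pos hH hHH hu0).le)
  push_cast
  linarith [Nat.floor_le hl]

lemma one_sub_exp_le_measureReal (hB : FBM μ H B) (hH : 0 < H) {v : ℝ} (hv : 0 ≤ v) :
    1 - exp (-(v ^ 2 / 2)) ≤ μ.real {ω | -v ≤ B 1 ω} := by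
  have := hB.gauss.isProbabilityMeasure
  have hV1 : ∫ ω, B 1 ω * B 1 ω ∂μ = 1 := by
    rw [hB.cov 1 1 zero_le_one zero_le_one, sub_self, abs_zero, zero_rpow (by positivity)]; norm_num
  have h := hB.gauss.measureReal_lt_le (f := fun ω => -B 1 ω) (s := 1)
    (Submodule.neg_mem _ (mem 1)) hv (by simp [hV1])
  have h2 : (univ : Set Ω) ⊆ {ω | -v ≤ B 1 ω} ∪ {ω | v < -B 1 ω} := fun ω _ => by
    rcases le_or_gt (-v) (B 1 ω) with h | h
    · exact Or.inl h
    · exact Or.inr (show v < -B 1 ω by linarith)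
  have h3 := (measureReal_mono h2 (measure_ne_top μ _)).trans (measureReal_union_le _ _)
  rw [probReal_univ] at h3
  norm_num at h
  linarith

lemma eventually_le_exceed_gumbelLevel (hB : FBM μ H B) (hH : 0 < H) (hH1 : H < 1/2) (hHH : 0 < HH)
    (hPick : Tendsto (fun lam : ℝ => lam⁻¹ * pickMean μ H B lam) atTop (nhds HH))
    (x : ℝ) {δ : ℝ} (hδ : 0 < δ) : ∀ᶠ T in atTop,
      1 - exp (-exp (-x)) - δ ≤ μ.real (exceed B (strip 0 T 0 1) (gumbelLevel H HH T x)) := by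
  have := hB.gauss.isProbabilityMeasure
  obtain ⟨L, hL0, hL⟩ : ∃ L : ℝ, 0 < L ∧
      1 - exp (-exp (-x)) - δ < 1 - exp (-(exp (-x) * ((1 - (L + 1)⁻¹) * L * (L + 1)⁻¹))) := by
    have h1 : Tendsto (fun L : ℝ => (L + 1)⁻¹) atTop (nhds 0) :=
      tendsto_inv_atTop_zero.comp (tendsto_atTop_add_const_right _ _ tendsto_id)
    have h2 := (((h1.const_sub 1).mul (h1.const_sub 1)).const_mul (exp (-x))).neg
    have h3 := ((continuous_exp.tendsto _).comp h2).const_sub 1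
    simp only [sub_zero, mul_one] at h3
    obtain ⟨L, h4, h5⟩ := ((h3.eventually (lt_mem_nhds (show 1 - exp (-exp (-x)) - δ < _ by
      linarith))).and (eventually_gt_atTop 0)).exists
    refine ⟨L, h5, h4.trans_eq ?_⟩
    simp only [Function.comp]
    congr 4
    field_simp; ring
  set ε := (L + 1)⁻¹ with hε
  have hε0 : 0 < ε := by positivity
  have hε1 : ε < 1 := inv_lt_one_of_one_lt₀ (by linarith)
  have hu := tendsto_gumbelLevel H HH (tendsto_const_nhds (x := x) (f := atTop))
  have hrate := tendsto_mul_clumpRate_gumbelLevel hH hHH (tendsto_const_nhds (x := x) (f := atTop))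
  have hlim := (hrate.mul ((tendsto_inv_atTop_zero.const_sub (L + 1)⁻¹).const_mul
    ((1 - ε) * L))).neg
  have hlim2 := ((continuous_exp.tendsto _).comp hlim).const_sub 1
  rw [sub_zero] at hlim2
  filter_upwards [hlim2.eventually (lt_mem_nhds hL),
    hu.eventually (hB.eventually_le_exceed_strip hH hH1 hHH hPick hε0 hL0),
    eventually_gt_atTop 0, hu.eventually_gt_atTop 0] with T h1 h2 hT hu0
  set u := gumbelLevel H HH T x
  have hR := clumpRate_pos hH hHH hu0
  set n := ⌊T / (L + 1)⌋₊
  have hn : (n:ℝ) * (L + 1) ≤ T := by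
    rw [← le_div_iff₀ (by linarith)]; exact Nat.floor_le (by positivity)
  have hn2 : T / (L + 1) - 1 ≤ n := by linarith [Nat.lt_floor_add_one (T / (L + 1))]
  refine h1.le.trans (le_trans ?_ (hB.one_sub_pow_le_measureReal_exceed hH hH1.le hL0.le hn))
  have hp1 : μ.real (exceed B (strip 0 L 0 1) u) ≤ 1 := measureReal_le_one
  set p := μ.real (exceed B (strip 0 L 0 1) u)
  have h3 : (1 - p) ^ n ≤ exp (-(n * p)) := by
    rw [← mul_neg, exp_nat_mul]
    exact pow_le_pow_left₀ (by linarith) (by linarith [add_one_le_exp (-p)]) n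
  have h4 : (T / (L + 1) - 1) * ((1 - ε) * L * clumpRate H HH u) ≤ n * p :=
    mul_le_mul hn2 h2 (mul_nonneg (mul_nonneg (by linarith) hL0.le) hR.le) (Nat.cast_nonneg _)
  refine sub_le_sub_left (h3.trans (exp_le_exp.2 (neg_le_neg (le_trans (le_of_eq ?_) h4)))) 1
  rw [div_eq_mul_inv]
  have : T * T⁻¹ = 1 := mul_inv_cancel₀ hT.ne'
  linear_combination (-(clumpRate H HH u * (1 - ε) * L)) * this

end FBM

lemma gumbelLevel_add_mul (H HH x y : ℝ) {T : ℝ} (hT : √(2 * log T) ≠ 0) :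
    gumbelLevel H HH T (x + √(2 * log T) * y) = gumbelLevel H HH T x + y := by
  unfold gumbelLevel; field_simp; ring

/-- Splitting off a small common Gaussian component shifts the normalised level negligibly. -/
lemma exists_tendsto_gumbelLevel_eq {H HH x C : ℝ} (hH1 : H < 1/2) (hC : 0 ≤ C) :
    ∃ y : ℝ → ℝ, Tendsto y atTop (nhds x) ∧ ∀ᶠ T in atTop, C * T ^ (2 * H - 1) < 1 ∧
      gumbelLevel H HH T (y T) = gumbelLevel H HH T x * √(1 - C * T ^ (2 * H - 1)) /
        (1 + √(C * T ^ (2 * H - 1))) := by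
  set ρ : ℝ → ℝ := fun T => C * T ^ (2 * H - 1) with hρ
  set u : ℝ → ℝ := fun T => gumbelLevel H HH T x with hu
  set a : ℝ → ℝ := fun T => √(2 * log T) with ha
  have hua : Tendsto (fun T => u T - a T) atTop (nhds 0) :=
    tendsto_gumbelLevel_sub H HH tendsto_const_nhds
  have hu0 : Tendsto u atTop atTop := tendsto_gumbelLevel H HH tendsto_const_nhds
  have ha0 : Tendsto a atTop atTop := tendsto_sqrt_two_mul_log
  have hρ0 : Tendsto ρ atTop (nhds 0) := by
    have := (tendsto_rpow_neg_atTop (show 0 < 1 - 2 * H by linarith)).const_mul C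
    rw [mul_zero] at this
    refine this.congr fun T => ?_
    simp only [hρ]; congr 2; ring
  have hlog : Tendsto (fun T => log T * √(ρ T)) atTop (nhds 0) := by
    have := ((isLittleO_log_rpow_atTop (show 0 < 1/2 - H by linarith)).tendsto_div_nhds_zero).const_mul √C
    rw [mul_zero] at this
    refine this.congr' ?_
    filter_upwards [eventually_gt_atTop 0] with T hT
    rw [hρ, sqrt_mul hC, sqrt_eq_rpow (T ^ (2 * H - 1)), ← rpow_mul hT.le, div_eq_mul_inv,
      ← rpow_neg hT.le]
    rw [show -(1/2 - H) = (2 * H - 1) * (1/2) by ring]; ring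
  refine ⟨fun T => x + a T * (u T * √(1 - ρ T) / (1 + √(ρ T)) - u T), ?_, ?_⟩
  · have h8 : Tendsto (fun T => a T * (u T * √(1 - ρ T) / (1 + √(ρ T)) - u T)) atTop (nhds 0) := by
      refine squeeze_zero_norm' (a := fun T => 8 * (log T * √(ρ T))) ?_ (by
        simpa using hlog.const_mul 8)
      filter_upwards [eventually_gt_atTop 1, hρ0.eventually (gt_mem_nhds (one_pos)),
        hua.eventually (gt_mem_nhds (one_pos)), ha0.eventually_ge_atTop 1,
        hu0.eventually_ge_atTop 0] with T hT h1 h2 h3 h4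
      have hl : 0 < log T := log_pos hT
      have ha2 : a T ^ 2 = 2 * log T := sq_sqrt (by linarith)
      have hρT : 0 ≤ ρ T := mul_nonneg hC (rpow_nonneg (by linarith) _)
      set s := √(ρ T) with hs
      have hs2 : s * s = ρ T := mul_self_sqrt hρT
      have hs0 : 0 ≤ s := sqrt_nonneg _
      have hs1 : s ≤ 1 := sqrt_le_one.2 h1.le
      set r := √(1 - ρ T) with hr
      have hr2 : r * r = 1 - ρ T := mul_self_sqrt (by linarith)
      have hr0 : 0 ≤ r := sqrt_nonneg _
      have hr1 : r ≤ 1 := by nlinarith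
      have hr3 : 1 - ρ T ≤ r := by nlinarith
      have e : a T * (u T * r / (1 + s) - u T) = -(a T * u T * ((1 + s - r) / (1 + s))) := by
        field_simp; ring
      have h5 : (1 + s - r) / (1 + s) ≤ 2 * s := by
        rw [div_le_iff₀ (by linarith)]; nlinarith
      have h6 : 0 ≤ (1 + s - r) / (1 + s) := div_nonneg (by linarith) (by linarith)
      have h7 : a T * u T ≤ 4 * log T := by nlinarith
      have h8 : 0 ≤ a T * u T := mul_nonneg (by linarith) h4
      rw [e, norm_neg, norm_of_nonneg (mul_nonneg h8 h6)]
      have := mul_le_mul h7 h5 h6 (by positivity)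
      linarith
    simpa using h8.const_add x
  · filter_upwards [hρ0.eventually (gt_mem_nhds (one_pos)), ha0.eventually_gt_atTop 0]
      with T h1 h2
    refine ⟨h1, ?_⟩
    simp only [ha]
    rw [gumbelLevel_add_mul H HH x _ h2.ne']
    simp only [hu]; ring

namespace FBM

variable {Ω : Type*} [MeasurableSpace Ω] {μ : Measure Ω} {H HH : ℝ} {B : ℝ → Ω → ℝ}

lemma eventually_exceed_gumbelLevel_le (hB : FBM μ H B) (hH : 0 < H) (hH1 : H < 1/2) (hHH : 0 < HH)
    (hPick : Tendsto (fun lam : ℝ => lam⁻¹ * pickMean μ H B lam) atTop (nhds HH))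
    (x : ℝ) {δ : ℝ} (hδ : 0 < δ) : ∀ᶠ T in atTop,
      μ.real (exceed B (strip 0 T 0 1) (gumbelLevel H HH T x)) ≤ 1 - exp (-exp (-x)) + δ := by
  have := hB.gauss.isProbabilityMeasure
  set c := exp (-x) with hc
  have hc0 : 0 < c := exp_pos _
  obtain ⟨n, hn, hn0, hnc⟩ : ∃ n : ℕ, 1 - (1 - c / n) ^ n < 1 - exp (-c) + δ / 2 ∧ n ≠ 0 ∧
      c < n := by
    have h1 := (tendsto_one_add_div_pow_exp (-c)).const_sub 1
    obtain ⟨n, h2, h3, h4⟩ := ((h1.eventually (gt_mem_nhds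
      (show 1 - exp (-c) < 1 - exp (-c) + δ / 2 by linarith))).and
      ((eventually_ne_atTop 0).and (tendsto_natCast_atTop_atTop.eventually_gt_atTop c))).exists
    refine ⟨n, ?_, h3, h4⟩
    rw [sub_eq_add_neg 1 (c / n), ← neg_div]; exact h2
  have hnp : (0:ℝ) < n := hc0.trans hnc
  set ε := δ / (4 * c) with hε
  have hε0 : 0 < ε := by positivity
  set b := (n * (1 + ε))⁻¹ with hb
  have hb0 : 0 < b := by positivity
  set κ := ε * b / 2 with hκ
  have hκ0 : 0 < κ := by positivity
  have hC : 0 ≤ H * κ ^ (2 * H - 1) := by positivity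
  obtain ⟨y, hy, hyT⟩ := exists_tendsto_gumbelLevel_eq (HH := HH) (x := x) hH1 hC
  have hx : Tendsto (fun _ : ℝ => x) atTop (nhds x) := tendsto_const_nhds
  have hu := tendsto_gumbelLevel H HH hy
  have hu' := tendsto_gumbelLevel H HH hx
  have hR := tendsto_mul_clumpRate_gumbelLevel hH hHH hy
  have hR' := tendsto_mul_clumpRate_gumbelLevel hH hHH hx
  have hlin : ∀ {r : ℝ → ℝ} (_ : Tendsto (fun T => T * r T) atTop (nhds c)) (k : ℝ),
      Tendsto (fun T => (k * T + 1) * ((1 + ε) * r T)) atTop (nhds (k * (1 + ε) * c)) := by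
    intro r hr k
    have h1 := (hr.const_mul (k * (1 + ε))).add
      ((tendsto_inv_atTop_zero.mul hr).const_mul (1 + ε))
    simp only [zero_mul, mul_zero, add_zero] at h1
    refine h1.congr' ?_
    filter_upwards [eventually_ne_atTop 0] with T hT
    field_simp
  have hp := hlin hR b
  have hp' := (hlin hR' (ε * b)).const_mul (n:ℝ)
  have hψ : Tendsto (fun T => 1 - exp (-(gumbelLevel H HH T (y T) ^ 2 / 2))) atTop (nhds 1) := by
    have h1 : Tendsto (fun T => gumbelLevel H HH T (y T) ^ 2 / 2) atTop atTop :=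
      ((tendsto_pow_atTop two_ne_zero).comp hu).atTop_div_const two_pos
    simpa using (tendsto_exp_neg_atTop_nhds_zero.comp h1).const_sub 1
  have hlim := (((hp.const_sub 1).pow n).const_sub 1).div hψ one_ne_zero |>.add hp'
  have e1 : b * (1 + ε) * c = c / n := by rw [hb]; field_simp
  have e2 : n * (ε * b * (1 + ε) * c) = δ / 4 := by rw [hb, hε]; field_simp
  rw [e2, e1, div_one] at hlim
  rw [e1] at hp
  filter_upwards [hlim.eventually (gt_mem_nhds (show _ < 1 - exp (-c) + δ by linarith)),
    hp.eventually (gt_mem_nhds (show c / n < 1 by rwa [div_lt_one hnp])),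
    hψ.eventually (lt_mem_nhds one_pos), hyT, hu.eventually_gt_atTop 0, hu'.eventually_gt_atTop 0,
    hu.eventually (hB.eventually_forall_exceed_strip_le hH hH1 hHH hPick hε0),
    hu'.eventually (hB.eventually_forall_exceed_strip_le hH hH1 hHH hPick hε0),
    eventually_ge_atTop κ⁻¹] with T h1 h2 h3 h4 hu0 hu0' h5 h6 hT
  have hT0 : 0 < T := lt_of_lt_of_le (inv_pos.2 hκ0) hT
  set u := gumbelLevel H HH T (y T)
  set u' := gumbelLevel H HH T x
  set ρ := H * κ ^ (2 * H - 1) * T ^ (2 * H - 1) with hρ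
  have hκT : 1 ≤ κ * T := by
    rwa [inv_le_iff_one_le_mul₀' hκ0] at hT
  have hg : 2 * (κ * T) = ε * b * T := by rw [hκ]; ring
  have hTn : T = n * (b * T + ε * b * T) := by rw [hb]; field_simp
  have hρ1 : H * (ε * b * T - 1) ^ (2 * H - 1) ≤ ρ := by
    rw [hρ, mul_assoc H (κ ^ _), ← mul_rpow hκ0.le hT0.le]
    exact mul_le_mul_of_nonneg_left
      (rpow_le_rpow_of_nonpos (by linarith) (by linarith) (by linarith)) hH.le
  have hlev : (u + √ρ * u) / √(1 - ρ) = u' := by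
    have := sqrt_nonneg ρ
    have : 0 < √(1 - ρ) := sqrt_pos.2 (by linarith [h4.1])
    rw [h4.2]; field_simp
  have key := hB.measureReal_exists_exceed_mul_le hH hH1.le (l := b * T) (g := ε * b * T) (ρ := ρ)
    (u := u) (v := u) (by positivity) (by linarith) hρ1 h4.1 hu0.le n
  rw [hlev] at key
  have hp1 := h5 0 (b * T) le_rfl (by positivity)
  set p := μ.real (exceed B (strip 0 (b * T) 0 1) u)
  have hpow : 1 - (1 - p) ^ n ≤ 1 - (1 - (b * T + 1) * ((1 + ε) * clumpRate H HH u)) ^ n :=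
    sub_le_sub_left (pow_le_pow_left₀ (by linarith) (by linarith) n) 1
  have hψ1 := hB.one_sub_exp_le_measureReal hH hu0.le
  set A := {ω | ∃ k : Fin n, ∃ p ∈ strip 0 (b * T) 0 1,
      u' < B (p.2 + k * (b * T + ε * b * T)) ω - B (p.1 + k * (b * T + ε * b * T)) ω}
  have hA : μ.real A ≤ (1 - (1 - (b * T + 1) * ((1 + ε) * clumpRate H HH u)) ^ n) /
      (1 - exp (-(u ^ 2 / 2))) := by
    rw [le_div_iff₀ h3]
    exact (mul_le_mul_of_nonneg_left hψ1 measureReal_nonneg).trans (key.trans hpow)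
  have hgap : μ.real (⋃ k ∈ Finset.range n,
      exceed B (strip (k * (b * T + ε * b * T) + b * T) (ε * b * T) 0 1) u') ≤
      n * ((ε * b * T + 1) * ((1 + ε) * clumpRate H HH u')) := by
    refine (measureReal_biUnion_finset_le _ _).trans
      ((Finset.sum_le_sum fun k _ => h6 _ _ (by positivity) (by positivity)).trans_eq ?_)
    rw [Finset.sum_const, Finset.card_range, nsmul_eq_mul]
  refine ((measureReal_mono (exceed_strip_subset_blocks hn0 hTn) (measure_ne_top _ _)).trans
    (measureReal_union_le _ _)).trans (le_trans (add_le_add hA hgap) h1.le)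

end FBM

/-- Pólya's theorem for the Gumbel distribution: pointwise convergence of distribution functions is
uniform. -/
lemma tendsto_iSup_abs_sub_gumbel {F : ℝ → ℝ → ℝ} (hm : ∀ T, Monotone (F T))
    (h0 : ∀ T x, 0 ≤ F T x) (h1 : ∀ T x, F T x ≤ 1)
    (hF : ∀ x, Tendsto (fun T => F T x) atTop (nhds (exp (-exp (-x))))) :
    Tendsto (fun T => ⨆ x : ℝ, |F T x - exp (-exp (-x))|) atTop (nhds 0) := by
  rw [Metric.tendsto_atTop']
  intro δ hδ
  obtain ⟨N, hN⟩ := exists_nat_gt (2 / δ)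
  have hN0 : (0:ℝ) < N := (by positivity : (0:ℝ) < 2 / δ).trans hN
  have hNδ : 2 / (N:ℝ) < δ := by rwa [div_lt_comm₀ hN0 hδ]
  set q : ℕ → ℝ := fun k => -log (-log (k / N)) with hq
  have hq' : ∀ k : ℕ, 0 < k → k < N → 0 < -log ((k:ℝ) / N) := fun k hk hkN => by
    have hk0 : (0:ℝ) < k := by exact_mod_cast hk
    have : log ((k:ℝ) / N) < 0 := log_neg (by positivity) (by
      rw [div_lt_one hN0]; exact_mod_cast hkN)
    linarith
  have hqG : ∀ k : ℕ, 0 < k → k < N → exp (-exp (-(q k))) = k / N := fun k hk hkN => by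
    have hk0 : (0:ℝ) < k := by exact_mod_cast hk
    simp only [hq]
    rw [neg_neg, exp_log (hq' k hk hkN), neg_neg, exp_log (by positivity)]
  have hqle : ∀ k : ℕ, 0 < k → k < N → ∀ x, (k:ℝ) / N ≤ exp (-exp (-x)) → q k ≤ x := by
    intro k hk hkN x hx
    rw [← hqG k hk hkN, exp_le_exp, neg_le_neg_iff, exp_le_exp] at hx
    linarith
  have hleq : ∀ k : ℕ, 0 < k → k < N → ∀ x, exp (-exp (-x)) ≤ (k:ℝ) / N → x ≤ q k := by
    intro k hk hkN x hx
    rw [← hqG k hk hkN, exp_le_exp, neg_le_neg_iff, exp_le_exp] at hx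
    linarith
  have hev : ∀ᶠ T in atTop, ∀ k ∈ Finset.range N, |F T (q k) - exp (-exp (-(q k)))| < 1 / N :=
    (Finset.eventually_all _).2 fun k _ => by
      have := (hF (q k)).sub_const (exp (-exp (-(q k))))
      rw [sub_self] at this
      have := this.abs
      rw [abs_zero] at this
      exact this.eventually (gt_mem_nhds (by positivity))
  obtain ⟨T₀, hT₀⟩ := eventually_atTop.1 hev
  refine ⟨T₀, fun T hT => ?_⟩
  have hT' := hT₀ T hT.le
  have hle : ∀ x, |F T x - exp (-exp (-x))| ≤ 2 / N := by
    intro x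
    set G := exp (-exp (-x)) with hG
    have hG0 : 0 < G := exp_pos _
    have hG1 : G < 1 := by rw [← exp_zero]; exact exp_lt_exp.2 (by linarith [exp_pos (-x)])
    set k := ⌊G * N⌋₊
    have hk1 : (k:ℝ) ≤ G * N := Nat.floor_le (by positivity)
    have hk2 : G * N < k + 1 := Nat.lt_floor_add_one _
    have hkN : k < N := by
      have : (k:ℝ) < N := by nlinarith
      exact_mod_cast this
    have hk1' : (k:ℝ) / N ≤ G := by rwa [div_le_iff₀ hN0]
    have hk2' : G ≤ (k:ℝ) / N + 1 / N := by
      rw [← add_div, le_div_iff₀ hN0]; exact hk2.le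
    have hkk : ((k + 1 : ℕ):ℝ) / N = (k:ℝ) / N + 1 / N := by push_cast; rw [add_div]
    have e : 2 / (N:ℝ) = 1 / N + 1 / N := by ring
    rw [abs_le]
    constructor
    · rcases Nat.eq_zero_or_pos k with hk | hk
      · rw [hk] at hk2'
        simp only [Nat.cast_zero, zero_div, zero_add] at hk2'
        have : 0 < 1 / (N:ℝ) := by positivity
        linarith [h0 T x]
      · have h2 := hT' k (Finset.mem_range.2 hkN)
        rw [hqG k hk hkN, abs_lt] at h2
        linarith [hm T (hqle k hk hkN x hk1'), h2.1]
    · rcases (Nat.succ_le_of_lt hkN).eq_or_lt with hk | hk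
      · have : (k:ℝ) / N + 1 / N = 1 := by
          rw [← hkk, ← Nat.succ_eq_add_one, hk, div_self hN0.ne']
        have : 0 < 1 / (N:ℝ) := by positivity
        linarith [h1 T x]
      · have h2 := hT' (k + 1) (Finset.mem_range.2 hk)
        rw [hqG (k + 1) k.succ_pos hk, abs_lt, hkk] at h2
        linarith [hm T (hleq (k + 1) k.succ_pos hk x (by rw [hkk]; exact hk2')), h2.2]
  rw [dist_zero_right, norm_of_nonneg (Real.iSup_nonneg fun x => abs_nonneg _)]
  exact (ciSup_le hle).trans_lt hNδ

lemma iSup_iSup_le_iff {b : ℝ → ℝ} (hb : Continuous b) {T u : ℝ} (hT : 0 ≤ T) :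
    ⨆ (τ : Icc (0:ℝ) 1) (s : Icc (0:ℝ) T), (b (s + τ) - b s) ≤ u ↔
      ∀ (τ : Icc (0:ℝ) 1) (s : Icc (0:ℝ) T), b (s + τ) - b s ≤ u := by
  have : Nonempty (Icc (0:ℝ) T) := ⟨⟨0, le_rfl, hT⟩⟩
  have hc : Continuous fun p : Icc (0:ℝ) 1 × Icc (0:ℝ) T => b (p.2 + p.1) - b p.2 := by fun_prop
  obtain ⟨C, hC⟩ := (isCompact_range hc).bddAbove
  have hC' : ∀ (τ : Icc (0:ℝ) 1) (s : Icc (0:ℝ) T), b (s + τ) - b s ≤ C := fun τ s =>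
    hC ⟨(τ, s), rfl⟩
  have h1 : ∀ τ : Icc (0:ℝ) 1, BddAbove (range fun s : Icc (0:ℝ) T => b (s + τ) - b s) := fun τ =>
    ⟨C, by rintro _ ⟨s, rfl⟩; exact hC' τ s⟩
  rw [ciSup_le_iff ⟨C, by rintro _ ⟨τ, rfl⟩; exact ciSup_le (hC' τ)⟩]
  exact forall_congr' fun τ => ciSup_le_iff (h1 τ)

lemma exists_continuous_modification {Ω : Type*} [MeasurableSpace Ω] {μ : Measure Ω} {H : ℝ}
    {B : ℝ → Ω → ℝ} (hmeas : ∀ t : ℝ, Measurable (B t)) (hzero : ∀ ω, B 0 ω = 0)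
    (hcont : ∀ᵐ ω ∂μ, Continuous fun t => B t ω)
    (hgauss : ∀ (n : ℕ) (c : Fin n → ℝ) (t : Fin n → ℝ),
      ∃ v : NNReal, μ.map (fun ω => ∑ i, c i * B (t i) ω) = gaussianReal 0 v)
    (hcov : ∀ t s : ℝ, 0 ≤ t → 0 ≤ s →
      ∫ ω, B t ω * B s ω ∂μ = (t ^ (2*H) + s ^ (2*H) - |t - s| ^ (2*H)) / 2) :
    ∃ B' : ℝ → Ω → ℝ, FBM μ H B' ∧ ∀ᵐ ω ∂μ, ∀ t, B' t ω = B t ω := by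
  classical
  set N := toMeasurable μ {ω | ¬ Continuous fun t => B t ω}
  have hN : MeasurableSet N := measurableSet_toMeasurable _ _
  have hN0 : μ N = 0 := by rw [measure_toMeasurable]; exact hcont
  set B' : ℝ → Ω → ℝ := fun t => N.piecewise (fun _ => 0) (B t) with hB'
  have hnot : ∀ ω, ω ∉ N → ∀ t, B' t ω = B t ω := fun ω hω t => piecewise_eq_of_notMem _ _ _ hω
  have hae : ∀ᵐ ω ∂μ, ∀ t, B' t ω = B t ω := by
    filter_upwards [compl_mem_ae_iff.2 hN0] with ω hω using hnot ω hω
  refine ⟨B', ⟨gaussSpace_span (fun t => measurable_const.piecewise hN (hmeas t)) ?_, ?_, ?_, ?_⟩,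
    hae⟩
  · intro n c t
    obtain ⟨v, hv⟩ := hgauss n c t
    refine ⟨v, ?_⟩
    rw [← hv]
    refine Measure.map_congr ?_
    filter_upwards [hae] with ω hω
    simp only [hω]
  · intro ω
    by_cases hω : ω ∈ N
    · simp only [hB', piecewise_eq_of_mem _ _ _ hω]; exact continuous_const
    · simp only [hnot ω hω]
      by_contra h
      exact hω (subset_toMeasurable μ _ h)
  · intro ω
    by_cases hω : ω ∈ N
    · simp only [hB', piecewise_eq_of_mem _ _ _ hω]
    · rw [hnot ω hω, hzero]
  · intro t s ht hs
    rw [← hcov t s ht hs]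
    refine integral_congr_ae ?_
    filter_upwards [hae] with ω hω
    simp only [hω]

namespace FBM

variable {Ω : Type*} [MeasurableSpace Ω] {μ : Measure Ω} {H HH : ℝ} {B : ℝ → Ω → ℝ}

lemma iSup_le_eq_compl_exceed (hB : FBM μ H B) {T u : ℝ} (hT : 0 ≤ T) :
    {ω | ⨆ (τ : Icc (0:ℝ) 1) (s : Icc (0:ℝ) T), (B (s + τ) ω - B s ω) ≤ u} =
      (exceed B (strip 0 T 0 1) u)ᶜ := by
  ext ω
  rw [Set.mem_ofPred_eq, iSup_iSup_le_iff (hB.cont ω) hT]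
  constructor
  · rintro h ⟨p, ⟨h1, h2⟩, h3⟩
    rw [zero_add] at h1
    have := h ⟨_, h2⟩ ⟨_, h1⟩
    simp only [add_sub_cancel] at this
    linarith
  · intro h τ s
    by_contra! h1
    exact h ⟨(s, s + τ), ⟨by rw [zero_add]; exact s.2, by simp⟩, h1⟩

lemma tendsto_measureReal_iSup_le (hB : FBM μ H B) (hH : 0 < H) (hH1 : H < 1/2) (hHH : 0 < HH)
    (hPick : Tendsto (fun lam : ℝ => lam⁻¹ * pickMean μ H B lam) atTop (nhds HH)) (x : ℝ) :
    Tendsto (fun T : ℝ => μ.real {ω | ⨆ (τ : Icc (0:ℝ) 1) (s : Icc (0:ℝ) T),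
      (B (s + τ) ω - B s ω) ≤ gumbelLevel H HH T x}) atTop (nhds (exp (-exp (-x)))) := by
  have := hB.gauss.isProbabilityMeasure
  rw [Metric.tendsto_nhds]
  intro δ hδ
  filter_upwards [eventually_ge_atTop 0,
    hB.eventually_exceed_gumbelLevel_le hH hH1 hHH hPick x (half_pos hδ),
    hB.eventually_le_exceed_gumbelLevel hH hH1 hHH hPick x (half_pos hδ)] with T hT h1 h2
  rw [hB.iSup_le_eq_compl_exceed hT, measureReal_compl (hB.measurableSet_exceed _ _), probReal_univ,
    Real.dist_eq, abs_lt]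
  constructor <;> linarith

end FBM

end SheppFBM

/-- Remark b): Gumbel limit law for `M_H(T)` as `T → ∞`, with
`a_T = √(2 ln T)` and
`b_T = a_T + a_T⁻¹[(1/H - 3/2) ln ln T + ln(2^{-3/2} 𝓗_{2H}² H⁻¹ (2π)^{-1/2})]`. -/
theorem shepp_fbm_gumbel_limit
    {Ω : Type*} [MeasurableSpace Ω] (μ : Measure Ω) [IsProbabilityMeasure μ]
    (H : ℝ) (hH : H ∈ Set.Ioo (0:ℝ) (1/2))
    (B : ℝ → Ω → ℝ)
    (hmeas : ∀ t : ℝ, Measurable (B t))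
    (hzero : ∀ ω, B 0 ω = 0)
    (hcont : ∀ᵐ ω ∂μ, Continuous fun t => B t ω)
    (hgauss : ∀ (n : ℕ) (c : Fin n → ℝ) (t : Fin n → ℝ),
      ∃ v : NNReal, μ.map (fun ω => ∑ i, c i * B (t i) ω) =
        ProbabilityTheory.gaussianReal 0 v)
    (hcov : ∀ t s : ℝ, 0 ≤ t → 0 ≤ s →
      ∫ ω, B t ω * B s ω ∂μ = (t ^ (2*H) + s ^ (2*H) - |t - s| ^ (2*H)) / 2)
    (HH : ℝ) (hHH : 0 < HH)
    (hPick : Tendsto (fun lam : ℝ => lam⁻¹ *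
        ∫ ω, Real.exp (⨆ t : Set.Icc (0:ℝ) lam,
          (Real.sqrt 2 * B (t:ℝ) ω - (t:ℝ) ^ (2*H))) ∂μ) atTop (nhds HH))
    :
    Tendsto (fun T : ℝ =>
        ⨆ x : ℝ,
          |(μ {ω | Real.sqrt (2 * Real.log T) *
              ((⨆ (τ : Set.Icc (0:ℝ) (1)) (s : Set.Icc (0:ℝ) (T)),
            (B ((s:ℝ) + (τ:ℝ)) ω - B (s:ℝ) ω)) -
                (Real.sqrt (2 * Real.log T) + (Real.sqrt (2 * Real.log T))⁻¹ *
                  ((1/H - 3/2) * Real.log (Real.log T) +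
                    Real.log ((2:ℝ) ^ (-(3:ℝ)/2) * HH ^ 2 * H⁻¹ *
                      (2 * π) ^ (-(1:ℝ)/2))))) ≤ x}).toReal -
            Real.exp (-Real.exp (-x))|)
      atTop (nhds 0) := by
  obtain ⟨B', hB, hae⟩ := SheppFBM.exists_continuous_modification hmeas hzero hcont hgauss hcov
  have hPick' : Tendsto (fun lam : ℝ => lam⁻¹ * SheppFBM.FBM.pickMean μ H B' lam) atTop
      (nhds HH) := by
    refine hPick.congr fun lam => ?_
    congr 1
    refine integral_congr_ae ?_
    filter_upwards [hae] with ω hω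
    simp only [SheppFBM.FBM.pickSup, hω]
  refine SheppFBM.tendsto_iSup_abs_sub_gumbel (fun T x y hxy => ?_) (fun _ _ => ENNReal.toReal_nonneg)
    (fun _ _ => measureReal_le_one) (fun x => ?_)
  · exact measureReal_mono (fun ω hω => le_trans hω hxy) (measure_ne_top _ _)
  · refine (hB.tendsto_measureReal_iSup_le hH.1 hH.2 hHH hPick' x).congr' ?_
    filter_upwards [eventually_gt_atTop 1] with T hT
    have ha : 0 < √(2 * log T) := sqrt_pos.2 (by linarith [log_pos hT])
    rw [measureReal_def]
    congr 1
    refine measure_congr (eventuallyEq_set.2 ?_)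
    filter_upwards [hae] with ω hω
    simp only [hω]
    rw [mul_comm √(2 * log T), ← le_div_iff₀ ha, sub_le_iff_le_add', SheppFBM.gumbelLevel, mul_add _ _ x,
      div_eq_inv_mul x, add_assoc]
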